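/- arXiv:1601.03791 — 3 statements merged into one kernel-verified Lean document; each statement's English description precedes it below -/
import Mathlib

section
/- Let k ≥ 1 be an integer. Every finite simple graph G with Δ(G) + 1 ≤ k has an equitable k-coloring. -/
/-- `G` has an equitable `k`-coloring: a proper coloring with `k` colors in which any two
color classes differ in size by at most one. -/
def SimpleGraph.HasEquitableColoring {V : Type*} [Fintype V] (G : SimpleGraph V) (k : ℕ) :
    Prop :=
  ∃ C : G.Coloring (Fin k), ∀ i j : Fin k,
    (Finset.univ.filter fun v => C v = i).card ≤ (Finset.univ.filter fun v => C v = j).card + 1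

namespace HS
open Finset
open scoped Classical

inductive Rch (R : ℕ → ℕ → Prop) (a : ℕ) : Finset ℕ → ℕ → Prop
  | refl (F : Finset ℕ) (h : a ∉ F) : Rch R a F a
  | step (F : Finset ℕ) (b c : ℕ) (h : b ∉ F) (hR : R b c) (hc : Rch R a (insert b F) c) :
      Rch R a F b

theorem Rch.not_mem {R a F c} (h : Rch R a F c) : c ∉ F := by
  cases h <;> assumption

theorem Rch.mono {R a F c} (h : Rch R a F c) : ∀ F', F' ⊆ F → Rch R a F' c := by
  induction h with
  | refl F h => exact fun F' hF => Rch.refl _ (fun h' => h (hF h'))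
  | step F b c h hR hc ih =>
    exact fun F' hF => Rch.step _ _ _ (fun h' => h (hF h')) hR (ih _ (insert_subset_insert _ hF))

theorem Rch.not_mem_end {R a F c} (h : Rch R a F c) : a ∉ F := by
  induction h with
  | refl F h => exact h
  | step F b c h hR hc ih => exact fun h' => ih (mem_insert_of_mem h')

theorem Rch.split {R a F c} (h : Rch R a F c) :
    ∀ b, b ∉ F → Rch R a F b ∨ Rch R a (insert b F) c := by
  induction h with
  | refl F h =>
    intro b hb
    by_cases hab : a = b
    · subst hab; exact Or.inl (Rch.refl _ h)
    · exact Or.inr (Rch.refl _ (by simp [hab, h]))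
  | step F b' c h hR hc ih =>
    intro b hb
    by_cases hab : b = b'
    · subst hab; exact Or.inl (Rch.step _ _ _ h hR hc)
    · rcases ih b (by simp [hab, hb]) with h1 | h1
      · exact Or.inl (h1.mono _ (subset_insert _ _))
      · refine Or.inr (Rch.step _ _ c (by simp [Ne.symm hab, h]) hR ?_)
        rwa [Finset.insert_comm]

theorem Rch.cons {R a F b c} (h : Rch R a F c) (hR : R b c) (hb : b ∉ F) : Rch R a F b := by
  rcases h.split b hb with h1 | h1
  · exact h1
  · exact Rch.step _ _ _ hb hR h1

theorem Rch.transfer {R R' : ℕ → ℕ → Prop} {a F c} (h : Rch R a F c) :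
    (∀ b d, b ∉ F → d ∉ F → Rch R a ∅ b → Rch R a ∅ d → R b d → R' b d) → Rch R' a ∅ c := by
  induction h with
  | refl F h => exact fun _ => Rch.refl _ (by simp)
  | step F b c h hR hc ih =>
    intro H
    have hb : Rch R a ∅ b := (Rch.step _ _ _ h hR hc).mono _ (by simp)
    have hc' : Rch R a ∅ c := hc.mono _ (by simp)
    have hcF : c ∉ F := fun h' => hc.not_mem (mem_insert_of_mem h')
    refine Rch.cons (ih ?_) (H b c h hcF hb hc' hR) (by simp)
    intro b' d' hb' hd'
    exact H b' d' (fun h' => hb' (mem_insert_of_mem h')) (fun h' => hd' (mem_insert_of_mem h'))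

theorem Rch.enlarge {R a F c} (K : Finset ℕ) (hK : ∀ b ∈ K, ¬ Rch R a ∅ b) (h : Rch R a F c) :
    Rch R a (F ∪ K) c := by
  induction h with
  | refl F h =>
    refine Rch.refl _ ?_
    have : a ∉ K := fun h' => hK a h' (Rch.refl _ (by simp))
    simp [h, this]
  | step F b c h hR hc ih =>
    have hb : b ∉ K := fun h' => hK b h' ((Rch.step _ _ _ h hR hc).mono _ (by simp))
    refine Rch.step _ _ c (by simp [h, hb]) hR ?_
    rwa [Finset.insert_union] at ih

variable {V : Type*}

def IsEq (G : SimpleGraph V) (S : Finset V) (C : Finset ℕ) (s : ℕ) (f : V → ℕ) : Prop :=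
  (∀ v ∈ S, f v ∈ C) ∧ (∀ u ∈ S, ∀ v ∈ S, G.Adj u v → f u ≠ f v) ∧
  ∀ c ∈ C, #{v ∈ S | f v = c} = s

structure Near (G : SimpleGraph V) (S : Finset V) (C : Finset ℕ) (s : ℕ) (f : V → ℕ) (a b : ℕ) :
    Prop where
  mem : ∀ v ∈ S, f v ∈ C
  proper : ∀ u ∈ S, ∀ v ∈ S, G.Adj u v → f u ≠ f v
  ha : a ∈ C
  hb : b ∈ C
  size : ∀ c ∈ C, #{v ∈ S | f v = c} + (if c = a then 1 else 0) = s + (if c = b then 1 else 0)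

/-- colour `b` has a vertex movable to `c` -/
def Mov (G : SimpleGraph V) (S : Finset V) (C : Finset ℕ) (f : V → ℕ) (b c : ℕ) : Prop :=
  b ∈ C ∧ c ∈ C ∧ ∃ v ∈ S, f v = b ∧ ∀ w ∈ S, G.Adj v w → f w ≠ c

theorem card_update (S : Finset V) (f : V → ℕ) (v : V) (hv : v ∈ S) (c d : ℕ) :
    #{w ∈ S | Function.update f v c w = d} + (if d = f v then 1 else 0) =
    #{w ∈ S | f w = d} + (if d = c then 1 else 0) := by
  have h1 : #{w ∈ S | Function.update f v c w = d} =
      #{w ∈ S.erase v | f w = d} + (if d = c then 1 else 0) := by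
    conv_lhs => rw [← insert_erase hv]
    rw [filter_insert]
    have : {w ∈ S.erase v | Function.update f v c w = d} = {w ∈ S.erase v | f w = d} := by
      apply filter_congr
      intro w hw
      rw [Function.update_of_ne (ne_of_mem_erase hw)]
    rw [this]
    by_cases h : d = c
    · simp [h]
    · simp [h, Ne.symm h]
  have h2 : #{w ∈ S | f w = d} =
      #{w ∈ S.erase v | f w = d} + (if d = f v then 1 else 0) := by
    conv_lhs => rw [← insert_erase hv]
    rw [filter_insert]
    by_cases h : d = f v
    · simp [h]
    · simp [h, Ne.symm h]
  omega

theorem shift (G : SimpleGraph V) (S : Finset V) (C : Finset ℕ) (s : ℕ) (f0 : V → ℕ) (a : ℕ)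
    (F : Finset ℕ) (b : ℕ) (h : Rch (Mov G S C f0) a F b) :
    ∀ f, (∀ v ∈ S, f0 v ∉ F → f v = f0 v) → (∀ v ∈ S, f v ∉ F → f v ≠ b → f0 v = f v) →
      Near G S C s f a b → ∃ f', IsEq G S C s f' := by
  induction h with
  | refl F h =>
    intro f _ _ hN
    exact ⟨f, hN.mem, hN.proper, fun c hc => by have := hN.size c hc; omega⟩
  | step F b c h hR hc ih =>
    intro f h1 h2 hN
    obtain ⟨hbC, hcC, v, hv, hvb, hvc⟩ := hR
    have hcn := hc.not_mem
    simp only [mem_insert, not_or] at hcn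
    have hfv : f v = b := by rw [h1 v hv (by rwa [hvb]), hvb]
    have key : ∀ w ∈ S, G.Adj v w → f w ≠ c := by
      intro w hw ha hwc
      apply hvc w hw ha
      rw [h2 w hw (by rw [hwc]; exact hcn.2) (by rw [hwc]; exact hcn.1), hwc]
    refine ih (Function.update f v c) ?_ ?_ ⟨?_, ?_, hN.ha, hcC, ?_⟩
    · intro w hw hwF
      simp only [mem_insert, not_or] at hwF
      have : w ≠ v := by rintro rfl; exact hwF.1 hvb
      rw [Function.update_of_ne this]
      exact h1 w hw hwF.2
    · intro w hw hwF hwc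
      have : w ≠ v := by rintro rfl; simp at hwc
      rw [Function.update_of_ne this] at *
      simp only [mem_insert, not_or] at hwF
      exact h2 w hw hwF.2 hwF.1
    · intro w hw
      by_cases hwv : w = v
      · subst hwv; simpa using hcC
      · rw [Function.update_of_ne hwv]; exact hN.mem w hw
    · intro u hu w hw huw
      by_cases huv : u = v
      · subst huv
        rw [Function.update_self, Function.update_of_ne huw.ne']
        exact (key w hw huw).symm
      · rw [Function.update_of_ne huv]
        by_cases hwv : w = v
        · subst hwv
          rw [Function.update_self]; exact key u hu huw.symm
        · rw [Function.update_of_ne hwv]; exact hN.proper u hu w hw huw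
    · intro d hd
      have e1 := card_update S f v hv c d
      have e2 := hN.size d hd
      rw [hfv] at e1
      omega

/-- The recoloured graph -/
noncomputable def recol (f g : V → ℕ) (B : Finset V) (y z : V) (W X : ℕ) : V → ℕ :=
  fun v => if v = z then X else if v = y then W else if v ∈ B then g v else f v

theorem recol_near (G : SimpleGraph V) (S : Finset V) (C : Finset ℕ) (s : ℕ) (f g : V → ℕ)
    (a b : ℕ) (hN : Near G S C s f a b) (𝒜 : Finset ℕ) (h𝒜 : 𝒜 ⊆ C) (hb : b ∉ 𝒜) (ha : a ∈ 𝒜)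
    (B : Finset V) (hB : B = {v ∈ S | f v ∉ 𝒜}) (y z : V) (hy : y ∈ B) (hz : z ∈ S)
    (hz𝒜 : f z ∈ 𝒜) (hsolo : ∀ w ∈ S, G.Adj y w → f w = f z → w = z)
    (hg : IsEq G (B.erase y) (C \ 𝒜) s g) (X : ℕ) (hX : X ∈ C) (hXW : X ≠ f z)
    (hfree : ∀ w ∈ S, G.Adj z w → w ≠ y → (if w ∈ B then g w else f w) ≠ X) :
    Near G S C s (recol f g B y z (f z) X) a X := by
  obtain ⟨g1, g2, g3⟩ := hg
  have hyS : y ∈ S := by rw [hB] at hy; exact (mem_filter.1 hy).1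
  have hyz : y ≠ z := by rintro rfl; rw [hB] at hy; exact (mem_filter.1 hy).2 hz𝒜
  have hmB : ∀ v ∈ S, v ∉ B → f v ∈ 𝒜 := by
    intro v hv hvB; by_contra h; exact hvB (by rw [hB]; simp [hv, h])
  have hgB : ∀ v ∈ B, v ≠ y → g v ∈ C ∧ g v ∉ 𝒜 := by
    intro v hv hvy; have := g1 v (by simp [hv, hvy]); simpa using this
  refine ⟨?_, ?_, hN.ha, hX, ?_⟩
  · intro v hv
    unfold recol
    split_ifs with h1 h2 h3
    · exact hX
    · exact h𝒜 hz𝒜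
    · exact (hgB v h3 h2).1
    · exact hN.mem v hv
  · have hzc : ∀ w ∈ S, G.Adj z w → recol f g B y z (f z) X w ≠ X := by
      intro w hw hzw
      unfold recol
      rw [if_neg hzw.ne']
      by_cases hwy : w = y
      · rw [if_pos hwy]; exact hXW.symm
      · rw [if_neg hwy]; exact hfree w hw hzw hwy
    have hyc : ∀ w ∈ S, G.Adj y w → w ≠ z → recol f g B y z (f z) X w ≠ f z := by
      intro w hw hyw hwz
      unfold recol
      rw [if_neg hwz, if_neg hyw.ne']
      split_ifs with h
      · intro h'; exact (hgB w h hyw.ne').2 (h' ▸ hz𝒜)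
      · intro h'; exact hwz (hsolo w hw hyw h')
    have rz : recol f g B y z (f z) X z = X := by simp [recol]
    have ry : recol f g B y z (f z) X y = f z := by simp [recol, hyz]
    intro u hu v hv huv
    by_cases h1 : u = z
    · subst h1; rw [rz]; exact (hzc v hv huv).symm
    by_cases h2 : v = z
    · subst h2; rw [rz]; exact hzc u hu huv.symm
    by_cases h3 : u = y
    · subst h3; rw [ry]; exact (hyc v hv huv h2).symm
    by_cases h4 : v = y
    · subst h4; rw [ry]; exact hyc u hu huv.symm h1
    simp only [recol, h1, h2, h3, h4, if_false]
    split_ifs with h5 h6 h6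
    · exact g2 u (by simp [h5, h3]) v (by simp [h6, h4]) huv
    · intro h; exact (hgB u h5 h3).2 (h ▸ hmB v hv h6)
    · intro h; exact (hgB v h6 h4).2 (h ▸ hmB u hu h5)
    · exact hN.proper u hu v hv huv
  · intro c hc
    set h : V → ℕ := fun v => if v ∈ B.erase y then g v else f v with hh
    have hfy : f y ∉ 𝒜 := by rw [hB] at hy; exact (mem_filter.1 hy).2
    have hhy : h y = f y := by simp [hh]
    have hrec : recol f g B y z (f z) X = Function.update (Function.update h y (f z)) z X := by
      funext v
      by_cases h1 : v = z
      · simp [recol, h1]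
      by_cases h2 : v = y
      · subst h2; simp [recol, h1]
      simp [recol, h1, h2, hh]
    have e1 := card_update S h y hyS (f z) c
    have e2 := card_update S (Function.update h y (f z)) z hz X c
    rw [← hrec, Function.update_of_ne hyz.symm] at e2
    have hzB : z ∉ B := by rw [hB]; simp [hz𝒜]
    have hhz : h z = f z := by simp [hh, hzB]
    rw [hhz] at e2
    rw [hhy] at e1
    have e3 : #{v ∈ S | h v = c} + (if c = a then 1 else 0) = s + (if c = f y then 1 else 0) := by
      by_cases hcA : c ∈ 𝒜
      · have : {v ∈ S | h v = c} = {v ∈ S | f v = c} := by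
          apply filter_congr
          intro v hv
          simp only [hh]
          split_ifs with h'
          · rw [mem_erase] at h'
            have h1 := (hgB v h'.2 h'.1).2
            have h2 : f v ∉ 𝒜 := by have := h'.2; rw [hB] at this; exact (mem_filter.1 this).2
            constructor
            · rintro rfl; exact absurd hcA h1
            · rintro rfl; exact absurd hcA h2
          · rfl
        rw [this, hN.size c hc]
        have h1 : c ≠ b := by rintro rfl; exact hb hcA
        have h2 : c ≠ f y := by rintro rfl; exact hfy hcA
        simp [h1, h2]
      · have h1 : c ≠ a := by rintro rfl; exact hcA ha
        have h3 := g3 c (by simp [hc, hcA])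
        rw [← h3]
        have : {v ∈ S | h v = c} = {v ∈ B.erase y | g v = c} ∪ (if c = f y then {y} else ∅) := by
          ext v
          simp only [mem_filter, mem_union, hh]
          by_cases hvy : v = y
          · subst hvy
            by_cases h' : c = f v
            · simp [h', hyS]
            · simp [h', Ne.symm h']
          · have : v ∉ (if c = f y then ({y} : Finset V) else ∅) := by
              split_ifs <;> simp [hvy]
            simp only [this, or_false, mem_erase, ne_eq, hvy, not_false_eq_true, true_and]
            by_cases hvB : v ∈ B
            · have : v ∈ S := by rw [hB] at hvB; exact (mem_filter.1 hvB).1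
              simp [hvB, this]
            · simp only [hvB, if_false, false_and, iff_false, not_and]
              rintro hvS rfl
              exact hcA (hmB v hvS hvB)
        rw [this, card_union_of_disjoint]
        · simp only [h1, if_false]; split_ifs <;> simp
        · split_ifs <;> simp
    omega


theorem deg_split (G : SimpleGraph V) (S : Finset V) (f : V → ℕ) (𝒜 : Finset ℕ) (v : V) :
    ∑ c ∈ 𝒜, #{w ∈ S | G.Adj v w ∧ f w = c} + #{w ∈ {v ∈ S | f v ∉ 𝒜} | G.Adj v w} =
      #{w ∈ S | G.Adj v w} := by
  have h1 : #{w ∈ {w ∈ S | G.Adj v w} | f w ∈ 𝒜} =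
      ∑ c ∈ 𝒜, #{w ∈ S | G.Adj v w ∧ f w = c} := by
    rw [card_eq_sum_card_fiberwise (f := f) (t := 𝒜) (fun w hw => (mem_filter.1 hw).2 : Set.MapsTo f (↑({w ∈ {w ∈ S | G.Adj v w} | f w ∈ 𝒜} : Finset V)) ↑𝒜)]
    refine sum_congr rfl fun c hc => ?_
    congr 1
    ext w
    simp only [mem_filter]
    constructor
    · rintro ⟨⟨⟨a, b⟩, c⟩, d⟩; exact ⟨a, b, d⟩
    · rintro ⟨a, b, rfl⟩; exact ⟨⟨⟨a, b⟩, hc⟩, rfl⟩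
  rw [← h1, filter_comm (fun v => f v ∉ 𝒜) (fun w => G.Adj v w) S, card_filter_add_card_filter_not]

def Solo (G : SimpleGraph V) (S : Finset V) (f : V → ℕ) (T : Finset ℕ) (B : Finset V)
    (z y : V) : Prop :=
  z ∈ S ∧ f z ∈ T ∧ y ∈ B ∧ G.Adj y z ∧ ∀ w ∈ S, G.Adj y w → f w = f z → w = z

theorem sum_lower (G : SimpleGraph V) (S : Finset V) (f : V → ℕ) (K : Finset ℕ) (x : V)
    (h : ∀ c ∈ K, ∃ w ∈ S, G.Adj x w ∧ f w = c) :
    #K ≤ ∑ c ∈ K, #{w ∈ S | G.Adj x w ∧ f w = c} := by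
  rw [card_eq_sum_ones]
  refine sum_le_sum fun c hc => ?_
  obtain ⟨w, hw, h1, h2⟩ := h c hc
  exact card_pos.2 ⟨w, by simp [hw, h1, h2]⟩

theorem dB_le (G : SimpleGraph V) (S : Finset V) (f : V → ℕ) (𝒜 K : Finset ℕ) (hK : K ⊆ 𝒜) (x : V)
    (h : ∀ c ∈ K, ∃ w ∈ S, G.Adj x w ∧ f w = c) :
    #K + #{w ∈ {v ∈ S | f v ∉ 𝒜} | G.Adj x w} ≤ #{w ∈ S | G.Adj x w} := by
  rw [← deg_split G S f 𝒜 x]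
  have := sum_lower G S f K x h
  have h2 : ∑ c ∈ K, #{w ∈ S | G.Adj x w ∧ f w = c} ≤ ∑ c ∈ 𝒜, #{w ∈ S | G.Adj x w ∧ f w = c} :=
    sum_le_sum_of_subset hK
  omega

theorem double_count (G : SimpleGraph V) (P Q : Finset V) :
    ∑ y ∈ Q, #{x ∈ P | G.Adj y x} = ∑ x ∈ P, #{y ∈ Q | G.Adj x y} := by
  simp only [card_filter]
  rw [sum_comm]
  simp only [G.adj_comm]

theorem exists_pair (G : SimpleGraph V) (S : Finset V) (f : V → ℕ) (𝒜 T : Finset ℕ) (q s U : ℕ)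
    (B : Finset V) (hB : B = {v ∈ S | f v ∉ 𝒜})
    (hdeg : ∀ v ∈ S, #{w ∈ S | G.Adj v w} < #𝒜 + q) (hBc : #B = q * s + 1)
    (h1 : ∀ y ∈ B, ∀ c ∈ 𝒜, ∃ w ∈ S, G.Adj y w ∧ f w = c)
    (hTA : T ⊆ 𝒜) (hU : U ∈ 𝒜) (hUT : U ∉ T) (hTn : T.Nonempty)
    (hT : ∀ x ∈ S, f x ∈ T → ∀ c ∈ 𝒜, c ≠ U → c ∉ T → ∃ w ∈ S, G.Adj x w ∧ f w = c)
    (hsz : ∀ c ∈ T, #{v ∈ S | f v = c} = s)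
    (hso : ∀ z y, Solo G S f T B z y → ∀ c ∈ 𝒜, c ≠ f z → ∃ w ∈ S, G.Adj z w ∧ f w = c) :
    ∃ z y₁ y₂, Solo G S f T B z y₁ ∧ Solo G S f T B z y₂ ∧ y₁ ≠ y₂ ∧ ¬ G.Adj y₁ y₂ := by
  have hBS : B ⊆ S := by rw [hB]; exact filter_subset _ _
  -- degree bounds
  have d1 : ∀ y ∈ B, #{w ∈ B | G.Adj y w} + 1 ≤ q := by
    intro y hy
    have := dB_le G S f 𝒜 𝒜 subset_rfl y (h1 y hy)
    have := hdeg y (hBS hy)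
    rw [← hB] at *
    omega
  have d2 : ∀ x ∈ S, f x ∈ T → #{w ∈ B | G.Adj x w} ≤ q + #T := by
    intro x hx hxT
    have := dB_le G S f 𝒜 ((𝒜.erase U) \ T) (sdiff_subset.trans (erase_subset _ _)) x (by
      intro c hc
      simp only [mem_sdiff, mem_erase] at hc
      exact hT x hx hxT c hc.1.2 hc.1.1 hc.2)
    have h3 := hdeg x hx
    have h4 : T ⊆ 𝒜.erase U := fun c hc => by
      rw [mem_erase]; exact ⟨fun h => hUT (h ▸ hc), hTA hc⟩
    rw [card_sdiff_of_subset h4, card_erase_of_mem hU] at this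
    have h5 := card_le_card h4
    rw [card_erase_of_mem hU] at h5
    have := card_pos.2 ⟨U, hU⟩
    rw [← hB] at *
    omega
  have d3 : ∀ z y, Solo G S f T B z y → #{w ∈ B | G.Adj z w} ≤ q := by
    intro z y hzy
    have := dB_le G S f 𝒜 (𝒜.erase (f z)) (erase_subset _ _) z (by
      intro c hc
      simp only [mem_erase] at hc
      exact hso z y hzy c hc.2 hc.1)
    have h3 := hdeg z hzy.1
    rw [card_erase_of_mem (hTA hzy.2.1)] at this
    have := card_pos.2 ⟨_, hTA hzy.2.1⟩
    rw [← hB] at *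
    omega
  -- (3)
  have d4 : ∀ y ∈ B, #T + #{w ∈ B | G.Adj y w} + 1 ≤ #{z ∈ S | Solo G S f T B z y} + q := by
    intro y hy
    have e1 := deg_split G S f 𝒜 y
    have e2 := hdeg y (hBS hy)
    have e3 := sum_lower G S f (𝒜 \ T) y (fun c hc => h1 y hy c (mem_sdiff.1 hc).1)
    rw [← sum_sdiff hTA] at e1
    have e4 : #{z ∈ S | Solo G S f T B z y} =
        ∑ c ∈ T, #{z ∈ {z ∈ S | Solo G S f T B z y} | f z = c} :=
      card_eq_sum_card_fiberwise (fun w hw => (mem_filter.1 hw).2.2.1)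
    have e5 : 2 * #T ≤ ∑ c ∈ T, #{w ∈ S | G.Adj y w ∧ f w = c} +
        ∑ c ∈ T, #{z ∈ {z ∈ S | Solo G S f T B z y} | f z = c} := by
      rw [← sum_add_distrib, mul_comm, ← smul_eq_mul, ← sum_const]
      refine sum_le_sum fun c hc => ?_
      obtain ⟨w, hw, hyw, hwc⟩ := h1 y hy c (hTA hc)
      by_cases hs : Solo G S f T B w y
      · have p1 : 0 < #{w ∈ S | G.Adj y w ∧ f w = c} := card_pos.2 ⟨w, by simp [hw, hyw, hwc]⟩
        have p2 : 0 < #{z ∈ {z ∈ S | Solo G S f T B z y} | f z = c} :=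
          card_pos.2 ⟨w, by simp [hw, hs, hwc]⟩
        omega
      · have : ∃ w' ∈ S, G.Adj y w' ∧ f w' = f w ∧ w' ≠ w := by
          by_contra hcon
          push Not at hcon
          exact hs ⟨hw, hwc ▸ hc, hy, hyw, hcon⟩
        obtain ⟨w', hw', hyw', hfw', hne⟩ := this
        have p1 : 1 < #{w ∈ S | G.Adj y w ∧ f w = c} :=
          one_lt_card.2 ⟨w, by simp [hw, hyw, hwc], w', by simp [hw', hyw', hfw', hwc], hne.symm⟩
        omega
    have e6 := card_sdiff_add_card_eq_card hTA
    rw [← hB] at e1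
    omega
  -- Lemma 2
  have d5 : q < #T := by
    by_contra hcon
    push Not at hcon
    obtain ⟨W, hW⟩ := hTn
    have e1 : 2 * #B ≤ ∑ y ∈ B, ∑ x ∈ {v ∈ S | f v = W},
        (if G.Adj y x then (if ∃ y', Solo G S f T B x y' then 2 else 1) else 0) := by
      rw [mul_comm, ← smul_eq_mul, ← sum_const]
      refine sum_le_sum fun y hy => ?_
      obtain ⟨w, hw, hyw, hwc⟩ := h1 y hy W (hTA hW)
      by_cases hs : ∃ y', Solo G S f T B w y'
      · refine le_trans ?_ (single_le_sum (fun _ _ => Nat.zero_le _)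
          (show w ∈ {v ∈ S | f v = W} by simp [hw, hwc]))
        rw [if_pos hyw, if_pos hs]
      · have : ∃ w' ∈ S, G.Adj y w' ∧ f w' = f w ∧ w' ≠ w := by
          by_contra hcon
          push Not at hcon
          exact hs ⟨y, hw, hwc ▸ hW, hy, hyw, hcon⟩
        obtain ⟨w', hw', hyw', hfw', hne⟩ := this
        have hsub : ({w, w'} : Finset V) ⊆ {v ∈ S | f v = W} := by
          intro x hx
          simp only [mem_insert, mem_singleton] at hx
          rcases hx with rfl | rfl
          · simp [hw, hwc]
          · simp [hw', hfw', hwc]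
        refine le_trans ?_ (sum_le_sum_of_subset hsub)
        rw [sum_pair hne.symm, if_pos hyw, if_pos hyw']
        split_ifs <;> omega
    rw [sum_comm] at e1
    have e2 : ∑ x ∈ {v ∈ S | f v = W}, ∑ y ∈ B,
        (if G.Adj y x then (if ∃ y', Solo G S f T B x y' then 2 else 1) else 0) ≤
        ∑ x ∈ {v ∈ S | f v = W}, 2 * q := by
      refine sum_le_sum fun x hx => ?_
      rw [mem_filter] at hx
      rw [← sum_filter, sum_const, smul_eq_mul]
      simp only [G.adj_comm _ x]
      split_ifs with hs
      · obtain ⟨y', hy'⟩ := hs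
        have := d3 x y' hy'
        omega
      · have := d2 x hx.1 (hx.2 ▸ hW)
        omega
    rw [sum_const, hsz W hW, smul_eq_mul] at e2
    have : s * (2 * q) = 2 * (q * s) := by ring
    omega
  -- weights
  by_contra hcon
  push Not at hcon
  set cz : V → ℕ := fun z => #{y ∈ B | Solo G S f T B z y} with hcz
  have w1 : ∑ y ∈ B, ∑ z ∈ {z ∈ S | Solo G S f T B z y}, (q : ℚ) / cz z ≤
      #T * s * q := by
    have : ∀ y ∈ B, ∑ z ∈ {z ∈ S | Solo G S f T B z y}, (q : ℚ) / cz z =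
        ∑ z ∈ {z ∈ S | f z ∈ T}, if Solo G S f T B z y then (q : ℚ) / cz z else 0 := by
      intro y hy
      rw [← sum_filter]
      congr 1
      ext z
      simp only [mem_filter]
      constructor
      · rintro ⟨h, h'⟩; exact ⟨⟨h, h'.2.1⟩, h'⟩
      · rintro ⟨h, h'⟩; exact ⟨h.1, h'⟩
    rw [sum_congr rfl this, sum_comm]
    have hcard : #{z ∈ S | f z ∈ T} = #T * s := by
      rw [card_eq_sum_card_fiberwise (f := f) (t := T) (fun w hw => (mem_filter.1 hw).2 : Set.MapsTo f (↑({z ∈ S | f z ∈ T} : Finset V)) ↑T),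
        ← smul_eq_mul, ← sum_const]
      refine sum_congr rfl fun c hc => ?_
      rw [← hsz c hc]
      congr 1
      ext w
      simp only [mem_filter]
      constructor
      · rintro ⟨⟨a, b⟩, c⟩; exact ⟨a, c⟩
      · rintro ⟨a, rfl⟩; exact ⟨⟨a, hc⟩, rfl⟩
    calc _ ≤ ∑ z ∈ {z ∈ S | f z ∈ T}, (q : ℚ) := by
          refine sum_le_sum fun z hz => ?_
          rw [← sum_filter, sum_const, nsmul_eq_mul]
          change (cz z : ℚ) * (q / cz z) ≤ q
          rcases Nat.eq_zero_or_pos (cz z) with h | h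
          · rw [h]; simp
          · have : (cz z : ℚ) ≠ 0 := by positivity
            rw [mul_div_cancel₀ _ this]
      _ = _ := by rw [sum_const, hcard, nsmul_eq_mul]; push_cast; ring
  have w2 : ∀ y ∈ B, (#T : ℚ) ≤ ∑ z ∈ {z ∈ S | Solo G S f T B z y}, (q : ℚ) / cz z := by
    intro y hy
    set D := #{w ∈ B | G.Adj y w} + 1 with hD
    have hDq : D ≤ q := d1 y hy
    have h4 := d4 y hy
    have hDp : (0 : ℚ) < D := by rw [hD]; positivity
    have : ∀ z ∈ {z ∈ S | Solo G S f T B z y}, (q : ℚ) / D ≤ q / cz z := by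
      intro z hz
      have hzy := (mem_filter.1 hz).2
      have hpos : 0 < cz z := card_pos.2 ⟨y, by simp [hy, hzy]⟩
      have hle : cz z ≤ D := by
        have : {y ∈ B | Solo G S f T B z y} ⊆ insert y {w ∈ B | G.Adj y w} := by
          intro y' hy'
          rw [mem_filter] at hy'
          rw [mem_insert, mem_filter]
          by_cases hh : y' = y
          · exact Or.inl hh
          · exact Or.inr ⟨hy'.1, hcon z y y' hzy hy'.2 (Ne.symm hh)⟩
        exact (card_le_card this).trans (card_insert_le _ _)
      have hpos' : (0 : ℚ) < cz z := by exact_mod_cast hpos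
      have hle' : (cz z : ℚ) ≤ D := by exact_mod_cast hle
      gcongr
    refine le_trans ?_ (sum_le_sum this)
    rw [sum_const, nsmul_eq_mul]
    have h4' : (#T : ℚ) + D ≤ #{z ∈ S | Solo G S f T B z y} + q := by
      have : #T + D ≤ #{z ∈ S | Solo G S f T B z y} + q := by omega
      exact_mod_cast this
    have h5 : (q : ℚ) < #T := by exact_mod_cast d5
    have h6 : (D : ℚ) ≤ q := by exact_mod_cast hDq
    rw [← mul_div_assoc, le_div_iff₀ hDp]
    have h7 : (0 : ℚ) ≤ q := by positivity
    nlinarith [mul_nonneg (sub_nonneg.2 h5.le) (sub_nonneg.2 h6),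
      mul_nonneg h7 (sub_nonneg.2 h4')]
  have w3 := (sum_le_sum w2).trans w1
  rw [sum_const, hBc, nsmul_eq_mul] at w3
  push_cast at w3
  have : (0 : ℚ) < #T := by have : 0 < #T := by omega
                            exact_mod_cast this
  nlinarith


theorem near_to_eq (G : SimpleGraph V) (S : Finset V) (C : Finset ℕ) (s : ℕ)
    (hdeg : ∀ v ∈ S, #{w ∈ S | G.Adj v w} < #C)
    (IH : ∀ S' ⊂ S, ∀ (C' : Finset ℕ), #S' = #C' * s →
      (∀ v ∈ S', #{w ∈ S' | G.Adj v w} < #C') → ∃ f, IsEq G S' C' s f) :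
    ∀ (n : ℕ) (f : V → ℕ) (a b : ℕ), #{c ∈ C | ¬ Rch (Mov G S C f) a ∅ c} = n →
      Near G S C s f a b → ∃ f', IsEq G S C s f' := by
  intro n
  induction n using Nat.strong_induction_on with
  | _ n ihn =>
  intro f a b hn hN
  by_cases hbacc : Rch (Mov G S C f) a ∅ b
  · exact shift G S C s f a ∅ b hbacc f (fun _ _ _ => rfl) (fun _ _ _ _ => rfl) hN
  by_contra hno
  set R := Mov G S C f with hR
  set 𝒜 : Finset ℕ := {c ∈ C | Rch R a ∅ c} with h𝒜
  have hAC : 𝒜 ⊆ C := filter_subset _ _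
  have hbA : b ∉ 𝒜 := by simp [h𝒜, hbacc]
  have haR : Rch R a ∅ a := Rch.refl _ (by simp)
  have haA : a ∈ 𝒜 := by simp [h𝒜, hN.ha, haR]
  have hab : a ≠ b := by rintro rfl; exact hbA haA
  have hCA : C \ 𝒜 = {c ∈ C | ¬ Rch R a ∅ c} := by
    ext c; simp only [h𝒜, mem_sdiff, mem_filter]; tauto
  have hn' : #(C \ 𝒜) = n := by rw [hCA, hn]
  have hAn : #𝒜 + n = #C := by
    rw [← hn']; have := card_sdiff_add_card_eq_card hAC; omega
  set B : Finset V := {v ∈ S | f v ∉ 𝒜} with hB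
  have hBS : B ⊆ S := filter_subset _ _
  have hBf : ∀ y ∈ B, f y ∈ C \ 𝒜 := fun y hy => by
    rw [hB, mem_filter] at hy; rw [mem_sdiff]; exact ⟨hN.mem y hy.1, hy.2⟩
  have hbC : b ∈ C \ 𝒜 := by simp [hN.hb, hbA]
  have hBc : #B = n * s + 1 := by
    rw [card_eq_sum_card_fiberwise (f := f) (t := C \ 𝒜) hBf]
    have : ∀ c ∈ C \ 𝒜, #{v ∈ B | f v = c} = s + if c = b then 1 else 0 := by
      intro c hc
      rw [mem_sdiff] at hc
      have hca : c ≠ a := by rintro rfl; exact hc.2 haA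
      have := hN.size c hc.1
      rw [← this, if_neg hca, add_zero]
      congr 1
      ext v
      simp only [hB, mem_filter]
      constructor
      · rintro ⟨⟨h1, h2⟩, h3⟩; exact ⟨h1, h3⟩
      · rintro ⟨h1, rfl⟩; exact ⟨⟨h1, hc.2⟩, rfl⟩
    rw [sum_congr rfl this, sum_add_distrib, sum_const, hn', sum_ite_eq' , if_pos hbC, smul_eq_mul]
  have h1 : ∀ y ∈ B, ∀ c ∈ 𝒜, ∃ w ∈ S, G.Adj y w ∧ f w = c := by
    intro y hy c hc
    by_contra hcon
    push Not at hcon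
    have hy' := hBf y hy
    rw [hCA, mem_filter] at hy'
    rw [h𝒜, mem_filter] at hc
    exact hy'.2 (Rch.cons hc.2 ⟨hy'.1, hc.1, y, hBS hy, rfl, hcon⟩ (by simp))
  have hdeg' : ∀ v ∈ S, #{w ∈ S | G.Adj v w} < #𝒜 + n := by rwa [hAn]
  -- recolouring B - y
  have hrecB : ∀ y ∈ B, ∃ g, IsEq G (B.erase y) (C \ 𝒜) s g := by
    intro y hy
    refine IH (B.erase y) ?_ (C \ 𝒜) ?_ ?_
    · exact (erase_ssubset hy).trans_subset hBS
    · rw [card_erase_of_mem hy, hBc, hn']; rfl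
    · intro v hv
      have hvB := mem_of_mem_erase hv
      have := dB_le G S f 𝒜 𝒜 subset_rfl v (h1 v hvB)
      have h2 := hdeg' v (hBS hvB)
      rw [← hB] at this
      have h3 : #{w ∈ B.erase y | G.Adj v w} ≤ #{w ∈ B | G.Adj v w} :=
        card_le_card (filter_subset_filter _ (erase_subset _ _))
      rw [hn']
      omega
  -- |𝒜| ≥ 2
  have hA2 : ∃ c ∈ 𝒜, c ≠ a := by
    by_contra hcon
    push Not at hcon
    have hAa : 𝒜 = {a} := by
      ext c; rw [mem_singleton]; exact ⟨hcon c, fun h => h ▸ haA⟩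
    have e1 : #B ≤ ∑ y ∈ B, #{x ∈ {v ∈ S | f v = a} | G.Adj y x} := by
      rw [card_eq_sum_ones]
      refine sum_le_sum fun y hy => ?_
      obtain ⟨w, hw, hyw, hwa⟩ := h1 y hy a haA
      exact card_pos.2 ⟨w, by simp [hw, hyw, hwa]⟩
    rw [double_count] at e1
    have e2 : ∑ x ∈ {v ∈ S | f v = a}, #{y ∈ B | G.Adj x y} ≤ ∑ x ∈ {v ∈ S | f v = a}, n := by
      refine sum_le_sum fun x hx => ?_
      have h2 := hdeg' x (mem_filter.1 hx).1
      rw [hAa, card_singleton] at h2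
      have h3 : #{w ∈ B | G.Adj x w} ≤ #{w ∈ S | G.Adj x w} :=
        card_le_card (filter_subset_filter _ hBS)
      omega
    have e3 := hN.size a hN.ha
    rw [if_pos rfl, if_neg hab] at e3
    rw [sum_const, smul_eq_mul] at e2
    have : #{v ∈ S | f v = a} * n ≤ s * n := Nat.mul_le_mul_right _ (by omega)
    have : s * n = n * s := mul_comm _ _
    omega
  -- the sets T_U
  set T : ℕ → Finset ℕ := fun U => {c ∈ 𝒜 | c ≠ U ∧ ¬ Rch R a {U} c} with hT
  have hexU : ∃ U ∈ 𝒜, (T U).Nonempty ∧ ∀ U' ∈ 𝒜, (T U').Nonempty → #(T U) ≤ #(T U') := by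
    have hne : ({U ∈ 𝒜 | (T U).Nonempty} : Finset ℕ).Nonempty := by
      obtain ⟨c, hc, hca⟩ := hA2
      refine ⟨a, mem_filter.2 ⟨haA, c, ?_⟩⟩
      refine mem_filter.2 ⟨hc, hca, fun h => ?_⟩
      exact h.not_mem_end (by simp)
    obtain ⟨U, hU, hmin⟩ := exists_min_image _ (fun U => #(T U)) hne
    rw [mem_filter] at hU
    exact ⟨U, hU.1, hU.2, fun U' h1 h2 => hmin U' (mem_filter.2 ⟨h1, h2⟩)⟩
  obtain ⟨U, hUA, hTne, hUmin⟩ := hexU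
  have hacc : ∀ c ∈ 𝒜, Rch R a ∅ c := fun c hc => (mem_filter.1 hc).2
  have hterm : ∀ W ∈ T U, ∀ X ∈ 𝒜, X ≠ W → Rch R a {W} X := by
    intro W hW X hX hXW
    obtain ⟨hWA, hWU, hWr⟩ := mem_filter.1 hW
    by_contra hXr
    have hne : (T W).Nonempty := ⟨X, mem_filter.2 ⟨hX, hXW, hXr⟩⟩
    have hle := hUmin W hWA hne
    have hsub : T W ⊆ (T U).erase W := by
      intro c hc
      obtain ⟨hcA, hcW, hcr⟩ := mem_filter.1 hc
      refine mem_erase.2 ⟨hcW, mem_filter.2 ⟨hcA, ?_, ?_⟩⟩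
      · rintro rfl
        apply hcr
        have := hacc c hcA
        cases this with
        | refl _ h => exact Rch.refl _ (by simpa using hcW)
        | step _ _ d h hRcd hd =>
          rcases hd.split W (by simpa using hWU) with h' | h'
          · exact absurd (by simpa using h') hWr
          · refine Rch.step _ _ d (by simpa using hcW) hRcd ?_
            rw [Finset.insert_comm] at h'
            simpa using h'
      · intro hcU
        rcases hcU.split W (by simpa using hWU) with h' | h'
        · exact hWr h'
        · exact hcr (h'.mono _ (by simp))
    have h2 := card_le_card hsub
    rw [card_erase_of_mem hW] at h2
    have := card_pos.2 ⟨W, hW⟩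
    omega
  have hTA : T U ⊆ 𝒜 := filter_subset _ _
  have hUT : U ∉ T U := by simp [hT]
  have hTe : ∀ x ∈ S, f x ∈ T U → ∀ c ∈ 𝒜, c ≠ U → c ∉ T U → ∃ w ∈ S, G.Adj x w ∧ f w = c := by
    intro x hx hxT c hc hcU hcT
    by_contra hcon
    push Not at hcon
    obtain ⟨hxA, hxU, hxr⟩ := mem_filter.1 hxT
    have hcr : Rch R a {U} c := by
      by_contra h; exact hcT (mem_filter.2 ⟨hc, hcU, h⟩)
    exact hxr (hcr.cons ⟨hAC hxA, hAC hc, x, hx, rfl, hcon⟩ (by simpa using hxU))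
  have haT : a ∉ T U := by
    intro h
    obtain ⟨_, h2, h3⟩ := mem_filter.1 h
    exact h3 (Rch.refl _ (by simpa using h2))
  have hsz : ∀ c ∈ T U, #{v ∈ S | f v = c} = s := by
    intro c hc
    have hca : c ≠ a := by rintro rfl; exact haT hc
    have hcb : c ≠ b := by rintro rfl; exact hbA (hTA hc)
    have := hN.size c (hAC (hTA hc))
    simpa [hca, hcb] using this
  have hKacc : ∀ c ∈ C \ 𝒜, ¬ Rch R a ∅ c := by
    intro c hc; rw [hCA] at hc; exact (mem_filter.1 hc).2
  -- case 1
  have hso : ∀ z y, Solo G S f (T U) B z y → ∀ c ∈ 𝒜, c ≠ f z → ∃ w ∈ S, G.Adj z w ∧ f w = c := by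
    intro z y hzy X hX hXz
    by_contra hcon
    push Not at hcon
    obtain ⟨hzS, hzT, hyB, hyz, huniq⟩ := hzy
    obtain ⟨g, hg⟩ := hrecB y hyB
    have hNear := recol_near G S C s f g a b hN 𝒜 hAC hbA haA B hB y z hyB hzS (hTA hzT) huniq hg
      X (hAC hX) hXz (by
        intro w hw hzw hwy
        split_ifs with hwB
        · intro h
          have := hg.1 w (mem_erase.2 ⟨hwy, hwB⟩)
          rw [h, mem_sdiff] at this
          exact this.2 hX
        · exact hcon w hw hzw)
    have hr := (hterm (f z) hzT X hX hXz).enlarge (C \ 𝒜) hKacc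
    refine hno (shift G S C s f a _ X hr _ ?_ ?_ hNear)
    · intro v hv hvF
      simp only [mem_union, mem_singleton, not_or] at hvF
      have h2 : v ∉ B := fun h => hvF.2 (hBf v h)
      have h3 : v ≠ z := by rintro rfl; exact hvF.1 rfl
      have h4 : v ≠ y := by rintro rfl; exact h2 hyB
      simp [recol, h2, h3, h4]
    · intro v hv hvF hvX
      simp only [mem_union, mem_singleton, not_or] at hvF
      have h3 : v ≠ z := by rintro rfl; simp [recol] at hvX
      have h4 : v ≠ y := by rintro rfl; apply hvF.1; simp [recol, h3]
      have h2 : v ∉ B := by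
        intro h; apply hvF.2; simp only [recol, h3, h4, h, if_true, if_false]
        exact hg.1 v (mem_erase.2 ⟨h4, h⟩)
      simp [recol, h2, h3, h4]
  -- case 2
  obtain ⟨z, y, y₂, hzy, hzy₂, hne, hnadj⟩ := exists_pair G S f 𝒜 (T U) n s U B hB hdeg' hBc h1
    hTA hUA hUT hTne hTe hsz hso
  have hso' := hso z y hzy
  obtain ⟨hzS, hzT, hyB, hyz, huniq⟩ := hzy
  obtain ⟨-, -, hyB₂, hyz₂, huniq₂⟩ := hzy₂
  obtain ⟨g, hg⟩ := hrecB y hyB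
  have hexX : ∃ X ∈ C.erase (f z), X ∉ image (fun w => if w ∈ B then g w else f w)
      ({w ∈ S | G.Adj z w}.erase y) := by
    apply exists_mem_notMem_of_card_lt_card
    refine lt_of_le_of_lt card_image_le ?_
    rw [card_erase_of_mem (hAC (hTA hzT)), card_erase_of_mem (by simp [hBS hyB, hyz.symm])]
    have := hdeg z hzS
    have : 0 < #{w ∈ S | G.Adj z w} := card_pos.2 ⟨y, by simp [hBS hyB, hyz.symm]⟩
    omega
  obtain ⟨X, hX, hXfree⟩ := hexX
  obtain ⟨hXz, hXC⟩ := mem_erase.1 hX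
  have hfree : ∀ w ∈ S, G.Adj z w → w ≠ y → (if w ∈ B then g w else f w) ≠ X := by
    intro w hw hzw hwy h
    exact hXfree (mem_image.2 ⟨w, by simp [hw, hzw, hwy], h⟩)
  have hXA : X ∉ 𝒜 := by
    intro hXA
    obtain ⟨w, hw, hzw, hwX⟩ := hso' X hXA hXz
    have hwB : w ∉ B := by simp [hB, hwX, hXA]
    refine hfree w hw hzw ?_ (by simp [hwB, hwX])
    rintro rfl; exact hwB hyB
  have hNear := recol_near G S C s f g a b hN 𝒜 hAC hbA haA B hB y z hyB hzS (hTA hzT) huniq hg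
      X hXC hXz hfree
  set f2 := recol f g B y z (f z) X with hf2
  have hzB : z ∉ B := by simp [hB, hTA hzT]
  -- classes in 𝒜 other than f z unchanged
  have hsame : ∀ v ∈ S, ∀ c ∈ 𝒜, c ≠ f z → (f2 v = c ↔ f v = c) := by
    intro v hv c hc hcz
    simp only [hf2, recol]
    split_ifs with h3 h4 h5
    · subst h3
      exact ⟨fun h => absurd (h ▸ hc) hXA, fun h => absurd h.symm hcz⟩
    · subst h4
      refine ⟨fun h => absurd h.symm hcz, fun h => ?_⟩
      have := hBf v hyB
      rw [mem_sdiff, h] at this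
      exact absurd hc this.2
    · refine ⟨fun h => ?_, fun h => ?_⟩
      · have := hg.1 v (mem_erase.2 ⟨h4, h5⟩)
        rw [mem_sdiff, h] at this
        exact absurd hc this.2
      · have := hBf v h5
        rw [mem_sdiff, h] at this
        exact absurd hc this.2
    · rfl
  have hin : ∀ c, Rch R a ∅ c → c ∈ C → c ∈ 𝒜 := fun c h h' => mem_filter.2 ⟨h', h⟩
  have hacc2 : ∀ c ∈ 𝒜, c ≠ f z → Rch (Mov G S C f2) a ∅ c := by
    intro c hc hcz
    refine (hterm (f z) hzT c hc hcz).transfer ?_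
    rintro b' d hb' hd hrb hrd ⟨hbC', hdC', v, hv, hvb, hvd⟩
    have hb'z : b' ≠ f z := by simpa using hb'
    have hdz : d ≠ f z := by simpa using hd
    refine ⟨hbC', hdC', v, hv, (hsame v hv b' (hin _ hrb hbC') hb'z).2 hvb, ?_⟩
    intro w hw hvw h
    exact hvd w hw hvw ((hsame w hw d (hin _ hrd hdC') hdz).1 h)
  have hacc3 : Rch (Mov G S C f2) a ∅ (f z) := by
    have := hacc (f z) (hTA hzT)
    rcases this with ⟨_⟩ | ⟨_, _, d, _, hRd, hd⟩
    · exact absurd hzT haT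
    · obtain ⟨hzC, hdC, v, hv, hvz, hvd⟩ := hRd
      have hdA : d ∈ 𝒜 := hin d (hd.mono _ (by simp)) hdC
      have hdz : d ≠ f z := by have := hd.not_mem; simpa using this
      refine (hacc2 d hdA hdz).cons ⟨hzC, hdC, v, hv, ?_, ?_⟩ (by simp)
      · have h3 : v ≠ z := by
          rintro rfl
          obtain ⟨w, hw, hzw, hwd⟩ := hso' d hdA hdz
          exact hvd w hw hzw hwd
        have h5 : v ∉ B := by
          simp [hB, hvz, hTA hzT]
        have h4 : v ≠ y := by rintro rfl; exact h5 hyB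
        simp [hf2, recol, h3, h4, h5, hvz]
      · intro w hw hvw h
        exact hvd w hw hvw ((hsame w hw d hdA hdz).1 h)
  have hy₂z : y₂ ≠ z := by rintro rfl; exact hzB hyB₂
  have hfy₂ : f2 y₂ = g y₂ := by simp [hf2, recol, hy₂z, hne.symm, hyB₂]
  have hgy₂ := hg.1 y₂ (mem_erase.2 ⟨hne.symm, hyB₂⟩)
  have hacc4 : Rch (Mov G S C f2) a ∅ (g y₂) := by
    refine hacc3.cons ⟨(mem_sdiff.1 hgy₂).1, hAC (hTA hzT), y₂, hBS hyB₂, hfy₂, ?_⟩ (by simp)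
    intro w hw hyw h
    have h4 : w ≠ y := by rintro rfl; exact hnadj hyw.symm
    have h3 : w ≠ z := by rintro rfl; apply hXz; rw [← h]; simp [hf2, recol]
    by_cases h5 : w ∈ B
    · have := hg.1 w (mem_erase.2 ⟨h4, h5⟩)
      simp only [hf2, recol, h3, h4, h5, if_true, if_false] at h
      rw [h, mem_sdiff] at this
      exact this.2 (hTA hzT)
    · simp only [hf2, recol, h3, h4, h5, if_false] at h
      exact h3 (huniq₂ w hw hyw h)
  refine hno (ihn _ ?_ f2 a X rfl hNear)
  rw [← hn']
  apply card_lt_card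
  rw [ssubset_iff_of_subset]
  · exact ⟨g y₂, hgy₂, by simp [hacc4]⟩
  · intro c hc
    rw [mem_filter] at hc
    rw [mem_sdiff]
    refine ⟨hc.1, fun h => hc.2 ?_⟩
    by_cases hcz : c = f z
    · rw [hcz]; exact hacc3
    · exact hacc2 c h hcz

theorem exists_noedge (s : ℕ) (C : Finset ℕ) : ∀ (S : Finset V), #S = #C * s →
    ∃ f : V → ℕ, (∀ v ∈ S, f v ∈ C) ∧ ∀ c ∈ C, #{v ∈ S | f v = c} = s := by
  induction C using Finset.induction_on with
  | empty =>
    intro S hS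
    have : S = ∅ := by simpa using hS
    subst this
    exact ⟨fun _ => 0, by simp, by simp⟩
  | insert a C ha ih =>
    intro S hS
    rw [card_insert_of_notMem ha, add_mul, one_mul] at hS
    obtain ⟨P, hPS, hP⟩ := exists_subset_card_eq (show s ≤ #S by omega)
    obtain ⟨f, hf1, hf2⟩ := ih (S \ P) (by rw [card_sdiff_of_subset hPS]; omega)
    refine ⟨fun v => if v ∈ P then a else f v, ?_, ?_⟩
    · intro v hv
      dsimp only
      split_ifs with h
      · simp
      · exact mem_insert_of_mem (hf1 v (by simp [hv, h]))
    · intro c hc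
      by_cases hca : c = a
      · subst hca
        rw [← hP]
        congr 1
        ext v
        rw [mem_filter]
        constructor
        · rintro ⟨h1, h2⟩
          by_contra h
          simp only [if_neg h] at h2
          exact ha (h2 ▸ hf1 v (by simp [h1, h]))
        · intro h; exact ⟨hPS h, by simp [h]⟩
      · rw [← hf2 c (by simpa [hca] using hc)]
        congr 1
        ext v
        by_cases h : v ∈ P
        · simp [h, Ne.symm hca]
        · simp [h]

def GD (G : SimpleGraph V) (D : Finset V) : SimpleGraph V where
  Adj := fun u v => G.Adj u v ∧ u ∈ D ∧ v ∈ D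
  symm := ⟨fun _ _ h => ⟨h.1.symm, h.2.2, h.2.1⟩⟩
  loopless := ⟨fun u h => G.loopless.irrefl u h.1⟩

theorem main (n : ℕ) : ∀ (S : Finset V), #S = n → ∀ (G : SimpleGraph V) (C : Finset ℕ) (s : ℕ),
    #S = #C * s → (∀ v ∈ S, #{w ∈ S | G.Adj v w} < #C) → ∃ f, IsEq G S C s f := by
  induction n using Nat.strong_induction_on with
  | _ n ih =>
  intro S hSn G C s hS hdeg
  have key : ∀ D : Finset V, ∃ f, IsEq (GD G D) S C s f := by
    intro D
    induction D using Finset.induction_on with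
    | empty =>
      obtain ⟨f, h1, h2⟩ := exists_noedge s C S hS
      exact ⟨f, h1, fun u hu v hv h => absurd h.2.1 (by simp), h2⟩
    | insert u D hu ihD =>
      obtain ⟨f, h1, h2, h3⟩ := ihD
      by_cases huS : u ∈ S
      · have hd : ∀ v ∈ S, #{w ∈ S | (GD G (insert u D)).Adj v w} < #C := fun v hv =>
          lt_of_le_of_lt (card_le_card (monotone_filter_right _ (fun w _ hw => hw.1))) (hdeg v hv)
        obtain ⟨X, hX, hXf⟩ : ∃ X ∈ C, X ∉ image f {w ∈ S | (GD G (insert u D)).Adj u w} := by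
          apply exists_mem_notMem_of_card_lt_card
          exact lt_of_le_of_lt card_image_le (hd u huS)
        have hXf' : ∀ w ∈ S, (GD G (insert u D)).Adj u w → f w ≠ X := fun w hw ha h =>
          hXf (mem_image.2 ⟨w, mem_filter.2 ⟨hw, ha⟩, h⟩)
        refine near_to_eq (GD G (insert u D)) S C s hd ?_ _ (Function.update f u X) (f u) X rfl
          ⟨?_, ?_, h1 u huS, hX, ?_⟩
        · intro S' hS' C' h4 h5
          exact ih _ (hSn ▸ card_lt_card hS') S' rfl _ C' s h4 h5
        · intro v hv
          by_cases hvu : v = u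
          · subst hvu; simpa using hX
          · rw [Function.update_of_ne hvu]; exact h1 v hv
        · intro v hv w hw hvw
          by_cases hvu : v = u
          · subst hvu
            rw [Function.update_self, Function.update_of_ne hvw.ne']
            exact (hXf' w hw hvw).symm
          · rw [Function.update_of_ne hvu]
            by_cases hwu : w = u
            · subst hwu
              rw [Function.update_self]; exact hXf' v hv hvw.symm
            · rw [Function.update_of_ne hwu]
              refine h2 v hv w hw ⟨hvw.1, ?_, ?_⟩
              · exact (mem_insert.1 hvw.2.1).resolve_left hvu
              · exact (mem_insert.1 hvw.2.2).resolve_left hwu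
        · intro c hc
          rw [card_update S f u huS X c, h3 c hc]
      · refine ⟨f, h1, ?_, h3⟩
        intro v hv w hw hvw
        refine h2 v hv w hw ⟨hvw.1, ?_, ?_⟩
        · exact (mem_insert.1 hvw.2.1).resolve_left (fun h => huS (h ▸ hv))
        · exact (mem_insert.1 hvw.2.2).resolve_left (fun h => huS (h ▸ hw))
  obtain ⟨f, h1, h2, h3⟩ := key S
  exact ⟨f, h1, fun u hu v hv h => h2 u hu v hv ⟨h, hu, hv⟩, h3⟩

end HS

/-- **Hajnal–Szemerédi theorem.** For `k ≥ 1`, every graph `G` with `Δ(G) + 1 ≤ k` has an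
equitable `k`-coloring. -/
theorem hajnal_szemeredi {V : Type*} [Fintype V] (G : SimpleGraph V) [DecidableRel G.Adj]
    (k : ℕ) (hk : 1 ≤ k) (h : G.maxDegree + 1 ≤ k) :
    G.HasEquitableColoring k := by
  classical
  obtain ⟨p, s, hp, hps⟩ : ∃ p s, p < k ∧ Fintype.card V + p = k * s := by
    have h1 := Nat.div_add_mod (Fintype.card V) k
    have h2 := Nat.mod_lt (Fintype.card V) hk
    by_cases h0 : Fintype.card V % k = 0
    · exact ⟨0, Fintype.card V / k, hk, by omega⟩
    · refine ⟨k - Fintype.card V % k, Fintype.card V / k + 1, by omega, ?_⟩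
      rw [mul_add, mul_one]; omega
  let H : SimpleGraph (V ⊕ Fin p) := G ⊕g (⊤ : SimpleGraph (Fin p))
  obtain ⟨f, h1, h2, h3⟩ := HS.main _ (Finset.univ : Finset (V ⊕ Fin p)) rfl H (Finset.range k) s
    (by simp [hps]) (by
      rintro (v | i) -
      · rw [Finset.card_range]
        have : (Finset.univ.filter fun w => H.Adj (Sum.inl v) w) =
            (G.neighborFinset v).map Function.Embedding.inl := by
          ext w
          rcases w with w | w <;> simp [H]
        have e := congrArg Finset.card this
        rw [Finset.card_map, SimpleGraph.card_neighborFinset_eq_degree] at e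
        have := G.degree_le_maxDegree v
        convert (show G.degree v < k by omega)
      · rw [Finset.card_range]
        have : (Finset.univ.filter fun w => H.Adj (Sum.inr i) w) ⊆
            (Finset.univ : Finset (Fin p)).map Function.Embedding.inr := by
          intro w
          rcases w with w | w <;> simp [H]
        have e := Finset.card_le_card this
        rw [Finset.card_map, Finset.card_univ, Fintype.card_fin] at e
        refine lt_of_le_of_lt ?_ hp
        convert e)
  refine ⟨SimpleGraph.Coloring.mk (fun v => ⟨f (Sum.inl v), Finset.mem_range.1 (h1 _ (Finset.mem_univ _))⟩) ?_, ?_⟩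
  · intro u v huv heq
    refine h2 (Sum.inl u) (Finset.mem_univ _) (Sum.inl v) (Finset.mem_univ _) (by simpa [H] using huv) ?_
    simpa using heq
  · have hcl : ∀ i : Fin k, (Finset.univ.filter fun v : V => f (Sum.inl v) = i).card ≤ s ∧
        s ≤ (Finset.univ.filter fun v : V => f (Sum.inl v) = i).card + 1 := by
      intro i
      have e := h3 i (Finset.mem_range.2 i.2)
      have e2 : (Finset.univ.filter fun v : V ⊕ Fin p => f v = i).card =
          (Finset.univ.filter fun v : V => f (Sum.inl v) = i).card +
          (Finset.univ.filter fun j : Fin p => f (Sum.inr j) = i).card := by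
        simp only [Finset.card_filter]
        rw [Fintype.sum_sum_type]
      have e3 : (Finset.univ.filter fun j : Fin p => f (Sum.inr j) = i).card ≤ 1 := by
        rw [Finset.card_le_one]
        intro a ha b hb
        rw [Finset.mem_filter] at ha hb
        by_contra hab
        exact h2 (Sum.inr a) (Finset.mem_univ _) (Sum.inr b) (Finset.mem_univ _)
          (by simpa [H] using hab) (ha.2.trans hb.2.symm)
      have e4 : (Finset.univ.filter fun v : V ⊕ Fin p => f v = i).card = s := by
        convert e
      omega
    intro i j
    have hi := (hcl i).1
    have hj := (hcl j).2
    have conv : ∀ i : Fin k, (Finset.univ.filter fun v : V =>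
        (⟨f (Sum.inl v), Finset.mem_range.1 (h1 _ (Finset.mem_univ _))⟩ : Fin k) = i).card =
        (Finset.univ.filter fun v : V => f (Sum.inl v) = i).card := by
      intro i
      congr 1
      ext v
      simp [Fin.ext_iff]
    have := conv i
    have := conv j
    refine le_trans (le_of_eq ?_) (le_trans (hi.trans hj) (le_of_eq ?_))
    · rw [← conv i]; rfl
    · rw [← conv j]; rfl
end

section
/- Let k ≥ 1 be an integer. Every finite simple graph G with θ(G) ≤ 2k−1 has an equitable k-coloring. -/
/-- The maximum Ore degree `θ(G)`: the maximum of `d(x) + d(y)` over edges `xy` of `G`,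
with value `0` if `G` has no edges. -/
noncomputable def SimpleGraph.maxOreDeg {V : Type*} [Fintype V] (G : SimpleGraph V)
    [DecidableRel G.Adj] : ℕ :=
  sSup {n | ∃ x y, G.Adj x y ∧ n = G.degree x + G.degree y}

namespace OreEq
open scoped Classical
noncomputable section
universe u

/-- reachability of `c0` inside `S` -/
def Rc (R : ℕ → ℕ → Prop) (c0 : ℕ) (S : Finset ℕ) (c : ℕ) : Prop :=
  Relation.ReflTransGen (fun a b => R a b ∧ a ∈ S ∧ b ∈ S) c c0

lemma Rc.step {R : ℕ → ℕ → Prop} {c0 : ℕ} {S : Finset ℕ} {a b : ℕ} (h : R a b) (ha : a ∈ S)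
    (hb : b ∈ S) (hr : Rc R c0 S b) : Rc R c0 S a :=
  Relation.ReflTransGen.head ⟨h, ha, hb⟩ hr

lemma Rc.mem {R : ℕ → ℕ → Prop} {c0 : ℕ} {S : Finset ℕ} {a : ℕ} (h : Rc R c0 S a) :
    a = c0 ∨ (a ∈ S ∧ c0 ∈ S) := by
  rcases Relation.ReflTransGen.cases_head h with h1 | ⟨b, hb, _⟩
  · exact Or.inl h1
  · rcases Relation.ReflTransGen.cases_tail h with h2 | ⟨d, _, hd⟩
    · exact Or.inl h2.symm
    · exact Or.inr ⟨hb.2.1, hd.2.2⟩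

lemma Rc.mono {R R' : ℕ → ℕ → Prop} {c0 : ℕ} {S S' : Finset ℕ} {c : ℕ} (h : Rc R c0 S c)
    (hS : S ⊆ S') (hR : ∀ a ∈ S, ∀ b ∈ S, R a b → R' a b) : Rc R' c0 S' c :=
  Relation.ReflTransGen.mono
    (fun a b hab => ⟨hR a hab.2.1 b hab.2.2 hab.1, hS hab.2.1, hS hab.2.2⟩) _ _ h

lemma Rc.first {R : ℕ → ℕ → Prop} {c0 : ℕ} {S : Finset ℕ} {c : ℕ} (h : Rc R c0 S c)
    (hc : c ≠ c0) : ∃ d ∈ S.erase c, R c d ∧ Rc R c0 (S.erase c) d := by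
  have key : ∀ e, Rc R c0 S e → Rc R c0 (S.erase c) e ∨
      ∃ d ∈ S.erase c, R c d ∧ Rc R c0 (S.erase c) d := by
    intro e he
    induction he using Relation.ReflTransGen.head_induction_on with
    | refl => exact Or.inl Relation.ReflTransGen.refl
    | @head a b hab hb ih =>
      rcases ih with ih | ih
      · have hbc : b ≠ c := by
          rintro rfl
          rcases ih.mem with h1 | h1
          · exact hc h1
          · simp at h1
        by_cases hac : a = c
        · subst hac
          exact Or.inr ⟨b, by simp [hbc, hab.2.2], hab.1, ih⟩
        · exact Or.inl (Rc.step hab.1 (by simp [hac, hab.2.1]) (by simp [hbc, hab.2.2]) ih)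
      · exact Or.inr ih
  rcases key c h with h1 | h1
  · rcases h1.mem with h2 | h2
    · exact absurd h2 hc
    · simp at h2
  · exact h1

lemma Rc.acc {R : ℕ → ℕ → Prop} {c0 : ℕ} {K : Finset ℕ} {c : ℕ} (h : Rc R c0 K c) :
    Rc R c0 (K.filter fun c => Rc R c0 K c) c := by
  induction h using Relation.ReflTransGen.head_induction_on with
  | refl => exact Relation.ReflTransGen.refl
  | @head a b hab hb ih =>
    exact Rc.step hab.1 (by simpa using ⟨hab.2.1, Rc.step hab.1 hab.2.1 hab.2.2 hb⟩)
      (by simpa using ⟨hab.2.2, hb⟩) ih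

lemma exists_min {α : Type*} (p : α → Prop) (g : α → ℕ) (h : ∃ a, p a) :
    ∃ a, p a ∧ ∀ b, p b → g a ≤ g b := by
  have h' : ∃ n, ∃ a, p a ∧ g a = n := by
    obtain ⟨a, ha⟩ := h
    exact ⟨_, a, ha, rfl⟩
  obtain ⟨a, ha, hg⟩ := Nat.find_spec h'
  exact ⟨a, ha, fun b hb => hg ▸ Nat.find_min' h' ⟨b, hb, rfl⟩⟩

lemma exists_T (R : ℕ → ℕ → Prop) (c0 : ℕ) (A : Finset ℕ) (hc0 : c0 ∈ A)
    (hA : ∀ c ∈ A, Rc R c0 A c) :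
    ∃ T ⊆ A, T.Nonempty ∧ (∀ W ∈ T, ∀ c ∈ A, c ≠ W → Rc R c0 (A.erase W) c) ∧
      ∃ U, ∀ W ∈ T, ∀ c ∈ A, c ∉ T → c ≠ U → ¬ R W c := by
  by_cases h1 : ∃ c ∈ A, c ≠ c0
  · let T : ℕ → Finset ℕ := fun U => A.filter fun c => c ≠ U ∧ ¬ Rc R c0 (A.erase U) c
    have hT : ∀ U c, c ∈ T U ↔ c ∈ A ∧ c ≠ U ∧ ¬ Rc R c0 (A.erase U) c := fun U c => by
      simp [T]
    have hex : ∃ U, U ∈ A ∧ (T U).Nonempty := by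
      obtain ⟨c, hc, hcc⟩ := h1
      refine ⟨c0, hc0, c, (hT _ _).2 ⟨hc, hcc, fun h => ?_⟩⟩
      rcases h.mem with h2 | h2
      · exact hcc h2
      · simp at h2
    obtain ⟨U, ⟨hU, hne⟩, hmin⟩ := exists_min _ (fun U => (T U).card) hex
    refine ⟨T U, fun c hc => ((hT _ _).1 hc).1, hne, ?_, U, ?_⟩
    · intro W hW c hc hcW
      by_contra hcon
      have hWm := (hT _ _).1 hW
      have hav : ∀ e, Rc R c0 (A.erase U) e → Rc R c0 (A.erase W) e := by
        intro e he
        induction he using Relation.ReflTransGen.head_induction_on with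
        | refl => exact Relation.ReflTransGen.refl
        | @head a b hab hb ih =>
          refine Rc.step hab.1 ?_ ?_ ih
          · refine Finset.mem_erase.2 ⟨?_, (Finset.mem_erase.1 hab.2.1).2⟩
            rintro rfl
            exact hWm.2.2 (Rc.step hab.1 hab.2.1 hab.2.2 hb)
          · refine Finset.mem_erase.2 ⟨?_, (Finset.mem_erase.1 hab.2.2).2⟩
            rintro rfl
            exact hWm.2.2 hb
      have hss : T W ⊂ T U := by
        refine Finset.ssubset_iff_subset_ne.2 ⟨?_, ?_⟩
        · intro e he
          have hem := (hT _ _).1 he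
          by_contra heU
          apply hem.2.2
          by_cases heq : e = U
          · subst heq
            by_cases he0 : e = c0
            · rw [he0]; exact Relation.ReflTransGen.refl
            · obtain ⟨d, hd, hed, hr⟩ := (hA e hU).first he0
              refine Rc.step hed ?_ ?_ (hav d hr)
              · exact Finset.mem_erase.2 ⟨hem.2.1, hU⟩
              · refine Finset.mem_erase.2 ⟨?_, (Finset.mem_erase.1 hd).2⟩
                rintro rfl
                exact hWm.2.2 hr
          · apply hav
            by_contra hh
            exact heU ((hT _ _).2 ⟨hem.1, heq, hh⟩)
        · intro heq
          rw [← heq] at hW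
          exact ((hT _ _).1 hW).2.1 rfl
      have h3 := Finset.card_lt_card hss
      have h4 := hmin W ⟨hWm.1, c, (hT _ _).2 ⟨hc, hcW, hcon⟩⟩
      omega
    · intro W hW c hc hcT hcU hR
      have hWm := (hT _ _).1 hW
      apply hWm.2.2
      have : Rc R c0 (A.erase U) c := by
        by_contra hh
        exact hcT ((hT _ _).2 ⟨hc, hcU, hh⟩)
      exact Rc.step hR (Finset.mem_erase.2 ⟨hWm.2.1, hWm.1⟩) (Finset.mem_erase.2 ⟨hcU, hc⟩) this
  · push Not at h1
    refine ⟨A, subset_rfl, ⟨c0, hc0⟩, ?_, 0, ?_⟩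
    · intro W hW c hc hcW
      exact absurd ((h1 c hc).trans (h1 W hW).symm) hcW
    · intro W _ c hc hcT
      exact absurd hc hcT

variable {V : Type u}

/-- degree into a set -/
def dg (G : SimpleGraph V) (X : Finset V) (x : V) : ℕ := (X.filter fun y => G.Adj x y).card

/-- exact equitable coloring of `U` with color set `K`, all classes of size `s` -/
def EqCol (G : SimpleGraph V) (U : Finset V) (K : Finset ℕ) (s : ℕ) : Prop :=
  ∃ f : V → ℕ, (∀ x ∈ U, f x ∈ K) ∧ (∀ x ∈ U, ∀ y ∈ U, G.Adj x y → f x ≠ f y) ∧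
    ∀ c ∈ K, (U.filter fun x => f x = c).card = s

/-- partial coloring with one uncolored vertex `v` and one small class `c0` -/
structure St (G : SimpleGraph V) (U : Finset V) (K : Finset ℕ) (s : ℕ) (v : V) (f : V → ℕ)
    (c0 : ℕ) : Prop where
  hv : v ∈ U
  hc0 : c0 ∈ K
  col : ∀ x ∈ U.erase v, f x ∈ K
  prop : ∀ x ∈ U.erase v, ∀ y ∈ U.erase v, G.Adj x y → f x ≠ f y
  sz : ∀ c ∈ K, c ≠ c0 → ((U.erase v).filter fun x => f x = c).card = s
  sz0 : ((U.erase v).filter fun x => f x = c0).card + 1 = s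

/-- some vertex of class `c` is movable to class `d` -/
def mv (G : SimpleGraph V) (X : Finset V) (f : V → ℕ) (c d : ℕ) : Prop :=
  ∃ x ∈ X, f x = c ∧ ∀ y ∈ X, f y = d → ¬ G.Adj x y

lemma shift {G : SimpleGraph V} {U : Finset V} {K : Finset ℕ} {s : ℕ} {c0 : ℕ} :
    ∀ (n : ℕ) (S : Finset ℕ) (v : V) (f : V → ℕ) (c : ℕ), S.card = n → S ⊆ K → c ∈ K →
      St G U K s v f c0 → Rc (mv G (U.erase v) f) c0 S c →
      (∀ y ∈ U.erase v, f y = c → ¬ G.Adj v y) → EqCol G U K s := by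
  intro n
  induction n using Nat.strong_induction_on with
  | _ n ih =>
  intro S v f c hn hSK hcK hst hr hfree
  by_cases hc : c = c0
  · subst hc
    refine ⟨Function.update f v c, ?_, ?_, ?_⟩
    · intro x hx
      by_cases hxv : x = v
      · subst hxv; simpa using hcK
      · rw [Function.update_of_ne hxv]; exact hst.col x (by simp [hxv, hx])
    · intro x hx y hy hxy
      by_cases hxv : x = v
      · subst hxv
        have hyx : y ≠ x := hxy.ne'
        rw [Function.update_self, Function.update_of_ne hyx]
        intro h
        exact hfree y (by simp [hyx, hy]) h.symm hxy
      · by_cases hyv : y = v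
        · subst hyv
          rw [Function.update_self, Function.update_of_ne hxv]
          intro h
          exact hfree x (by simp [hxv, hx]) h hxy.symm
        · rw [Function.update_of_ne hxv, Function.update_of_ne hyv]
          exact hst.prop x (by simp [hxv, hx]) y (by simp [hyv, hy]) hxy
    · intro d hd
      by_cases hdc : d = c
      · subst hdc
        have : (U.filter fun x => Function.update f v d x = d) =
            insert v ((U.erase v).filter fun x => f x = d) := by
          ext x
          by_cases hxv : x = v
          · subst hxv; simp [hst.hv]
          · simp [Function.update_of_ne hxv, hxv]
        rw [this, Finset.card_insert_of_notMem (by simp)]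
        exact hst.sz0
      · rw [← hst.sz d hd hdc]
        congr 1
        ext x
        by_cases hxv : x = v
        · subst hxv; simp [Ne.symm hdc]
        · simp [Function.update_of_ne hxv, hxv]
  · obtain ⟨d, hd, ⟨x, hx, hxc, hxd⟩, hr'⟩ := hr.first hc
    have hcS : c ∈ S := by
      rcases hr.mem with h | h
      · exact absurd h hc
      · exact h.1
    have hdc : d ≠ c := (Finset.mem_erase.1 hd).1
    have hxv : x ≠ v := (Finset.mem_erase.1 hx).1
    have hxU : x ∈ U := (Finset.mem_erase.1 hx).2
    have hcls : ∀ e, e ≠ c → ∀ y, (y ∈ U.erase x ∧ Function.update f v c y = e) ↔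
        (y ∈ U.erase v ∧ f y = e) := by
      intro e he y
      by_cases hyv : y = v
      · subst hyv; simp [Ne.symm he]
      · rw [Function.update_of_ne hyv]
        by_cases hyx : y = x
        · subst hyx; simp [hxc, Ne.symm he]
        · simp [hyx, hyv]
    refine ih (S.erase c).card (by rw [← hn]; exact Finset.card_erase_lt_of_mem hcS) (S.erase c) x
      (Function.update f v c) d rfl ((Finset.erase_subset _ _).trans hSK)
      (hSK (Finset.mem_erase.1 hd).2) ?_ ?_ ?_
    · refine ⟨hxU, hst.hc0, ?_, ?_, ?_, ?_⟩
      · intro y hy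
        by_cases hyv : y = v
        · subst hyv; simpa using hcK
        · rw [Function.update_of_ne hyv]
          exact hst.col y (Finset.mem_erase.2 ⟨hyv, (Finset.mem_erase.1 hy).2⟩)
      · intro a ha b hb hab
        have haU := (Finset.mem_erase.1 ha).2
        have hbU := (Finset.mem_erase.1 hb).2
        by_cases hav : a = v
        · subst hav
          have hba : b ≠ a := hab.ne'
          rw [Function.update_self, Function.update_of_ne hba]
          intro h
          exact hfree b (by simp [hba, hbU]) h.symm hab
        · by_cases hbv : b = v
          · subst hbv
            rw [Function.update_self, Function.update_of_ne hav]
            intro h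
            exact hfree a (by simp [hav, haU]) h hab.symm
          · rw [Function.update_of_ne hav, Function.update_of_ne hbv]
            exact hst.prop a (by simp [hav, haU]) b (by simp [hbv, hbU]) hab
      · intro e he hec0
        by_cases hec : e = c
        · subst hec
          have h1 : ((U.erase x).filter fun y => Function.update f v e y = e) =
              insert v (((U.erase v).filter fun y => f y = e).erase x) := by
            ext y
            by_cases hyv : y = v
            · subst hyv; simp [hst.hv, Ne.symm hxv]
            · simp only [Finset.mem_filter, Finset.mem_erase, Function.update_of_ne hyv,
                Finset.mem_insert, hyv, ne_eq, not_false_eq_true, false_or, true_and]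
              tauto
          rw [h1, Finset.card_insert_of_notMem (by simp), Finset.card_erase_add_one]
          · exact hst.sz e he hec0
          · simp only [Finset.mem_filter]; exact ⟨hx, hxc⟩
        · rw [← hst.sz e he hec0]
          congr 1
          ext y
          simp only [Finset.mem_filter]
          exact hcls e hec y
      · rw [← hst.sz0]
        congr 2
        ext y
        simp only [Finset.mem_filter]
        exact hcls c0 (Ne.symm hc) y
    · refine hr'.mono subset_rfl ?_
      rintro a ha b hb ⟨w, hw, hwa, hwb⟩
      have h1 := (hcls a (Finset.mem_erase.1 ha).1 w).2 ⟨hw, hwa⟩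
      refine ⟨w, h1.1, h1.2, fun y hy hyb => ?_⟩
      have h2 := (hcls b (Finset.mem_erase.1 hb).1 y).1 ⟨hy, hyb⟩
      exact hwb y h2.1 h2.2
    · intro y hy hyd
      have h2 := (hcls d hdc y).1 ⟨hy, hyd⟩
      exact hxd y h2.1 h2.2

end
end OreEq

namespace OreEq
open scoped Classical
noncomputable section
universe u
variable {V : Type u}

/-- accessible classes -/
def acc (G : SimpleGraph V) (U : Finset V) (K : Finset ℕ) (v : V) (f : V → ℕ) (c0 : ℕ) :
    Finset ℕ := K.filter fun c => Rc (mv G (U.erase v) f) c0 K c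

/-- vertices in accessible classes -/
def AV (G : SimpleGraph V) (U : Finset V) (K : Finset ℕ) (v : V) (f : V → ℕ) (c0 : ℕ) :
    Finset V := (U.erase v).filter fun x => f x ∈ acc G U K v f c0

lemma St.acc_nbr {G : SimpleGraph V} {U : Finset V} {K : Finset ℕ} {s : ℕ} {v : V} {f : V → ℕ}
    {c0 : ℕ} (h : St G U K s v f c0) (hno : ¬ EqCol G U K s) {y : V}
    (hy : y ∈ U \ AV G U K v f c0) {c : ℕ} (hc : c ∈ acc G U K v f c0) :
    ∃ x ∈ AV G U K v f c0, f x = c ∧ G.Adj y x := by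
  by_contra hcon
  push Not at hcon
  have hcm := Finset.mem_filter.1 hc
  have hfree : ∀ x ∈ U.erase v, f x = c → ¬ G.Adj y x := by
    intro x hx hxc
    exact hcon x (Finset.mem_filter.2 ⟨hx, hxc ▸ hc⟩) hxc
  by_cases hyv : y = v
  · subst hyv
    exact hno (shift _ K y f c rfl subset_rfl hcm.1 h hcm.2 hfree)
  · have hy1 := Finset.mem_sdiff.1 hy
    have hyU : y ∈ U.erase v := Finset.mem_erase.2 ⟨hyv, hy1.1⟩
    apply hy1.2
    refine Finset.mem_filter.2 ⟨hyU, Finset.mem_filter.2 ⟨h.col y hyU, ?_⟩⟩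
    exact Rc.step ⟨y, hyU, rfl, hfree⟩ (h.col y hyU) hcm.1 hcm.2

lemma St.swap {G : SimpleGraph V} {U : Finset V} {K : Finset ℕ} {s : ℕ} {v : V} {f : V → ℕ}
    {c0 : ℕ} (h : St G U K s v f c0) (hno : ¬ EqCol G U K s) {A : Finset ℕ} {X : Finset V}
    (hA : A = acc G U K v f c0) (hX : X = AV G U K v f c0) {y z : V}
    (hy : y ∈ U \ X) (hz : z ∈ X)
    (hterm : ∀ c ∈ A, c ≠ f z → Rc (mv G (U.erase v) f) c0 (A.erase (f z)) c)
    (hsolo : ∀ x ∈ X, f x = f z → G.Adj y x → x = z)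
    (hg : EqCol G ((U \ X).erase y) (K \ A) s) :
    ∃ f', St G U K s z f' c0 ∧ A ⊆ acc G U K z f' c0 ∧ (∀ x ∈ X, f' x = f x) ∧ f' y = f z ∧
      ∀ x ∈ (U \ X).erase y, f' x ∉ A := by
  obtain ⟨g, hg1, hg2, hg3⟩ := hg
  have hAK : A ⊆ K := by rw [hA]; exact Finset.filter_subset _ _
  have hXU : ∀ x, x ∈ X ↔ x ∈ U.erase v ∧ f x ∈ A := by
    intro x; rw [hX, hA]; exact Finset.mem_filter
  have hXU' : ∀ x ∈ X, x ∈ U := fun x hx => (Finset.mem_erase.1 ((hXU x).1 hx).1).2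
  have hyX : y ∉ X := (Finset.mem_sdiff.1 hy).2
  have hyU : y ∈ U := (Finset.mem_sdiff.1 hy).1
  have hzA : f z ∈ A := ((hXU z).1 hz).2
  have hc0A : c0 ∈ A := by
    rw [hA]; exact Finset.mem_filter.2 ⟨h.hc0, Relation.ReflTransGen.refl⟩
  have hyz : y ≠ z := fun e => hyX (e ▸ hz)
  let f' : V → ℕ := fun x => if x ∈ X then f x else if x = y then f z else g x
  have fX : ∀ x ∈ X, f' x = f x := fun x hx => by simp [f', hx]
  have fy : f' y = f z := by simp [f', hyX]
  have fB : ∀ x ∈ (U \ X).erase y, f' x = g x := fun x hx => by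
    have h1 := Finset.mem_erase.1 hx
    have h2 := Finset.mem_sdiff.1 h1.2
    simp [f', h1.1, h2.2]
  have fBA : ∀ x ∈ (U \ X).erase y, f' x ∉ A := fun x hx => by
    rw [fB x hx]; exact (Finset.mem_sdiff.1 (hg1 x hx)).2
  have hcase : ∀ x ∈ U, x ∈ X ∨ x = y ∨ x ∈ (U \ X).erase y := by
    intro x hx
    by_cases h1 : x ∈ X
    · exact Or.inl h1
    · by_cases h2 : x = y
      · exact Or.inr (Or.inl h2)
      · exact Or.inr (Or.inr (by simp [h1, h2, hx]))
  have fyA : f' y ∈ A := fy ▸ hzA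
  have fXA : ∀ x ∈ X, f' x ∈ A := fun x hx => by rw [fX x hx]; exact ((hXU x).1 hx).2
  -- classes
  have cls1 : ∀ c ∈ A, c ≠ f z → ∀ x, (x ∈ U.erase z ∧ f' x = c) ↔ (x ∈ U.erase v ∧ f x = c) := by
    intro c hc hcz x
    constructor
    · rintro ⟨hx, hxc⟩
      rcases hcase x (Finset.mem_erase.1 hx).2 with h1 | h1 | h1
      · exact ⟨((hXU x).1 h1).1, by rw [← fX x h1]; exact hxc⟩
      · subst h1; rw [fy] at hxc; exact absurd hxc.symm hcz
      · exact absurd (hxc ▸ hc) (fBA x h1)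
    · rintro ⟨hx, hxc⟩
      have h1 : x ∈ X := (hXU x).2 ⟨hx, hxc ▸ hc⟩
      refine ⟨Finset.mem_erase.2 ⟨?_, hXU' x h1⟩, by rw [fX x h1]; exact hxc⟩
      rintro rfl
      exact hcz hxc.symm
  have cls2 : ((U.erase z).filter fun x => f' x = f z) =
      insert y (((U.erase v).filter fun x => f x = f z).erase z) := by
    ext x
    simp only [Finset.mem_filter, Finset.mem_insert]
    constructor
    · rintro ⟨hx, hxc⟩
      rcases hcase x (Finset.mem_erase.1 hx).2 with h1 | h1 | h1
      · right
        exact Finset.mem_erase.2 ⟨(Finset.mem_erase.1 hx).1, Finset.mem_filter.2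
          ⟨((hXU x).1 h1).1, by rw [← fX x h1]; exact hxc⟩⟩
      · exact Or.inl h1
      · exact absurd (hxc ▸ hzA) (fBA x h1)
    · rintro (rfl | hx)
      · exact ⟨Finset.mem_erase.2 ⟨hyz, hyU⟩, fy⟩
      · have h1 := Finset.mem_erase.1 hx
        have h2 := Finset.mem_filter.1 h1.2
        have h3 : x ∈ X := (hXU x).2 ⟨h2.1, by rw [h2.2]; exact hzA⟩
        exact ⟨Finset.mem_erase.2 ⟨h1.1, hXU' x h3⟩, by rw [fX x h3]; exact h2.2⟩
  have cls2c : ((U.erase z).filter fun x => f' x = f z).card =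
      ((U.erase v).filter fun x => f x = f z).card := by
    rw [cls2, Finset.card_insert_of_notMem, Finset.card_erase_add_one]
    · exact Finset.mem_filter.2 ⟨((hXU z).1 hz).1, rfl⟩
    · intro hh
      have h2 := Finset.mem_filter.1 (Finset.mem_erase.1 hh).2
      exact hyX ((hXU y).2 ⟨h2.1, by rw [h2.2]; exact hzA⟩)
  have cls1c : ∀ c ∈ A, ((U.erase z).filter fun x => f' x = c).card =
      ((U.erase v).filter fun x => f x = c).card := by
    intro c hc
    by_cases hcz : c = f z
    · rw [hcz]; exact cls2c
    · congr 1
      ext x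
      simp only [Finset.mem_filter]
      exact cls1 c hc hcz x
  have cls3 : ∀ c ∈ K \ A, ((U.erase z).filter fun x => f' x = c).card = s := by
    intro c hc
    rw [← hg3 c hc]
    have hcA := (Finset.mem_sdiff.1 hc).2
    congr 1
    ext x
    simp only [Finset.mem_filter]
    constructor
    · rintro ⟨hx, hxc⟩
      rcases hcase x (Finset.mem_erase.1 hx).2 with h1 | h1 | h1
      · exact absurd (hxc ▸ fXA x h1) hcA
      · subst h1; exact absurd (hxc ▸ fyA) hcA
      · exact ⟨h1, by rw [← fB x h1]; exact hxc⟩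
    · rintro ⟨hx, hxc⟩
      refine ⟨Finset.mem_erase.2 ⟨?_, (Finset.mem_sdiff.1 (Finset.mem_erase.1 hx).2).1⟩, by
        rw [fB x hx]; exact hxc⟩
      rintro rfl
      exact (Finset.mem_sdiff.1 (Finset.mem_erase.1 hx).2).2 hz
  have hst : St G U K s z f' c0 := by
    refine ⟨hXU' z hz, h.hc0, ?_, ?_, ?_, ?_⟩
    · intro x hx
      rcases hcase x (Finset.mem_erase.1 hx).2 with h1 | h1 | h1
      · exact hAK (fXA x h1)
      · subst h1; exact hAK fyA
      · rw [fB x h1]; exact (Finset.mem_sdiff.1 (hg1 x h1)).1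
    · have hXy : ∀ x ∈ X, x ≠ z → G.Adj y x → f' x ≠ f' y := by
        intro x hx hxz hadj he
        rw [fX x hx, fy] at he
        exact hxz (hsolo x hx he hadj)
      intro a ha b hb hab
      rcases hcase a (Finset.mem_erase.1 ha).2 with h1 | h1 | h1
      · rcases hcase b (Finset.mem_erase.1 hb).2 with h2 | h2 | h2
        · rw [fX a h1, fX b h2]
          exact h.prop a ((hXU a).1 h1).1 b ((hXU b).1 h2).1 hab
        · subst h2
          exact hXy a h1 (Finset.mem_erase.1 ha).1 hab.symm
        · intro he
          exact fBA b h2 (he ▸ fXA a h1)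
      · subst h1
        rcases hcase b (Finset.mem_erase.1 hb).2 with h2 | h2 | h2
        · exact (hXy b h2 (Finset.mem_erase.1 hb).1 hab).symm
        · subst h2; exact absurd hab (G.loopless.irrefl _)
        · intro he
          exact fBA b h2 (he ▸ fyA)
      · rcases hcase b (Finset.mem_erase.1 hb).2 with h2 | h2 | h2
        · intro he
          exact fBA a h1 (he ▸ fXA b h2)
        · subst h2
          intro he
          exact fBA a h1 (he ▸ fyA)
        · rw [fB a h1, fB b h2]
          exact hg2 a h1 b h2 hab
    · intro c hc hcc
      by_cases hcA : c ∈ A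
      · rw [cls1c c hcA]; exact h.sz c hc hcc
      · exact cls3 c (Finset.mem_sdiff.2 ⟨hc, hcA⟩)
    · rw [cls1c c0 hc0A]; exact h.sz0
  have hr : ∀ c ∈ A, c ≠ f z → Rc (mv G (U.erase z) f') c0 K c := by
    intro c hc hcz
    refine (hterm c hc hcz).mono ((Finset.erase_subset _ _).trans hAK) ?_
    rintro a ha b hb ⟨w, hw, hwa, hwb⟩
    have ha' := Finset.mem_erase.1 ha
    have hb' := Finset.mem_erase.1 hb
    have h1 := (cls1 a ha'.2 ha'.1 w).2 ⟨hw, hwa⟩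
    refine ⟨w, h1.1, h1.2, fun t ht htb => ?_⟩
    have h2 := (cls1 b hb'.2 hb'.1 t).1 ⟨ht, htb⟩
    exact hwb t h2.1 h2.2
  refine ⟨f', hst, ?_, fX, fy, fBA⟩
  intro c hc
  refine Finset.mem_filter.2 ⟨hAK hc, ?_⟩
  by_cases hcz : c = f z
  · by_cases hc0 : c = c0
    · rw [hc0]; exact Relation.ReflTransGen.refl
    · have hcA : Rc (mv G (U.erase v) f) c0 A c := by
        rw [hA] at hc ⊢
        exact (Finset.mem_filter.1 hc).2.acc
      obtain ⟨d, hd, ⟨w, hw, hwc, hwd⟩, -⟩ := hcA.first hc0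
      have hd' := Finset.mem_erase.1 hd
      have hdz : d ≠ f z := hcz ▸ hd'.1
      have hwz : w ≠ z := by
        rintro rfl
        apply hno
        refine shift _ K w f' d rfl subset_rfl (hAK hd'.2) hst (hr d hd'.2 hdz) ?_
        intro t ht htd
        have h2 := (cls1 d hd'.2 hdz t).1 ⟨ht, htd⟩
        exact hwd t h2.1 h2.2
      have hwX : w ∈ X := (hXU w).2 ⟨hw, hwc ▸ hc⟩
      refine Rc.step ⟨w, Finset.mem_erase.2 ⟨hwz, hXU' w hwX⟩, by rw [fX w hwX]; exact hwc, ?_⟩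
        (hAK hc) (hAK hd'.2) (hr d hd'.2 hdz)
      intro t ht htd
      have h2 := (cls1 d hd'.2 hdz t).1 ⟨ht, htd⟩
      exact hwd t h2.1 h2.2
  · exact hr c hc hcz

end
end OreEq

namespace OreEq
open scoped Classical
noncomputable section
universe u
variable {V : Type u}

lemma dg_insert (G : SimpleGraph V) (X : Finset V) (a x : V) (ha : a ∉ X) :
    dg G (insert a X) x = dg G X x + if G.Adj x a then 1 else 0 := by
  unfold dg
  rw [Finset.filter_insert]
  split_ifs with h
  · rw [Finset.card_insert_of_notMem (by simp [ha])]
  · simp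

lemma dg_eq_sum (G : SimpleGraph V) (X : Finset V) (x : V) :
    dg G X x = ∑ a ∈ X, if G.Adj a x then 1 else 0 := by
  unfold dg
  rw [Finset.card_filter]
  exact Finset.sum_congr rfl fun a _ => by simp [G.adj_comm]

lemma cut_swap (G : SimpleGraph V) (X0 Y0 : Finset V) (y z : V) (hzX : z ∉ X0) (hyX : y ∉ X0)
    (hzY : z ∉ Y0) (hyY : y ∉ Y0) (hadj : G.Adj y z) :
    (∑ x ∈ insert y X0, dg G (insert z Y0) x) + dg G (insert y Y0) z + dg G (insert z X0) y =
    (∑ x ∈ insert z X0, dg G (insert y Y0) x) + dg G (insert z X0) z + dg G (insert y Y0) y + 2 := by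
  rw [Finset.sum_insert hyX, Finset.sum_insert hzX]
  simp only [dg_insert G _ _ _ hzY, dg_insert G _ _ _ hyY, dg_insert G _ _ _ hzX,
    Finset.sum_add_distrib, hadj, hadj.symm, SimpleGraph.irrefl, if_true, if_false]
  rw [← dg_eq_sum, ← dg_eq_sum]
  omega

lemma count (G : SimpleGraph V) (X B : Finset V) (f : V → ℕ) (A T : Finset ℕ) (k s q : ℕ)
    (hTA : T ⊆ A) (hT : T.Nonempty) (hf : ∀ x ∈ X, f x ∈ A) (hk : A.card + q = k)
    (hB : B.card = q * s + 1) (hs : ∀ c ∈ T, (X.filter fun x => f x = c).card ≤ s)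
    (hnb : ∀ y ∈ B, ∀ c ∈ A, ∃ x ∈ X, f x = c ∧ G.Adj y x)
    (hdT : ∀ z ∈ X, f z ∈ T → A.card ≤ dg G X z + T.card + 1)
    (hore : ∀ z ∈ X, ∀ y ∈ B, G.Adj y z → dg G X z + dg G B z + dg G X y + dg G B y + 1 ≤ 2 * k)
    (hsolo : ∀ z ∈ X, f z ∈ T → ∀ y ∈ B, G.Adj y z →
      (∀ x ∈ X, f x = f z → G.Adj y x → x = z) → dg G B z + dg G X y ≤ k) : False := by
  let N : V → ℕ → Finset V := fun y c => (X.filter fun x => G.Adj y x).filter fun x => f x = c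
  have hN : ∀ y c x, x ∈ N y c ↔ x ∈ X ∧ G.Adj y x ∧ f x = c := fun y c x => by
    simp [N, and_assoc]
  let sol : V → Finset ℕ := fun y => T.filter fun c => (N y c).card = 1
  have hNpos : ∀ y ∈ B, ∀ c ∈ A, 1 ≤ (N y c).card := by
    intro y hy c hc
    obtain ⟨x, hx, hxc, hadj⟩ := hnb y hy c hc
    exact Finset.card_pos.2 ⟨x, (hN _ _ _).2 ⟨hx, hadj, hxc⟩⟩
  have hdgB : ∀ z, ∀ y ∈ B, G.Adj y z → 1 ≤ dg G B z := by
    intro z y hy hadj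
    exact Finset.card_pos.2 ⟨y, by simp [hy, hadj.symm]⟩
  have hsolT : ∀ y, (sol y).card ≤ T.card := fun y => Finset.card_filter_le _ _
  have hdy : ∀ y ∈ B, A.card + T.card ≤ dg G X y + (sol y).card := by
    intro y hy
    have h1 : dg G X y = ∑ c ∈ A, (N y c).card := by
      unfold dg
      exact Finset.card_eq_sum_card_fiberwise (fun x hx => by
        have := (Finset.mem_filter.1 hx).1
        exact hf x this)
    have h2 : ∑ c ∈ A, (1 + if c ∈ T \ sol y then 1 else 0) ≤ ∑ c ∈ A, (N y c).card := by
      refine Finset.sum_le_sum fun c hc => ?_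
      have h3 := hNpos y hy c hc
      split_ifs with h4
      · have h5 := Finset.mem_sdiff.1 h4
        have : (N y c).card ≠ 1 := fun h6 => h5.2 (Finset.mem_filter.2 ⟨h5.1, h6⟩)
        omega
      · omega
    rw [Finset.sum_add_distrib, ← Finset.card_filter] at h2
    have h3 : A.filter (fun c => c ∈ T \ sol y) = T \ sol y := by
      ext c
      simp only [Finset.mem_filter, and_iff_right_iff_imp]
      intro hc
      exact hTA (Finset.mem_sdiff.1 hc).1
    have h4 : sol y ⊆ T := Finset.filter_subset _ _
    rw [h3, Finset.card_sdiff_of_subset h4] at h2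
    have := hsolT y
    simp only [Finset.sum_const, smul_eq_mul, mul_one] at h2
    omega
  -- any neighbour
  have hany : ∀ y ∈ B, ∀ z ∈ X, f z ∈ T → G.Adj y z → dg G B z ≤ 2 * q + (sol y).card := by
    intro y hy z hz hzT hadj
    have h1 := hdT z hz hzT
    have h2 := hore z hz y hy hadj
    have h3 := hdy y hy
    omega
  have hsol : ∀ y ∈ B, ∀ z ∈ X, f z ∈ sol y → G.Adj y z →
      dg G B z + T.card ≤ q + (sol y).card := by
    intro y hy z hz hzs hadj
    have h1 := Finset.mem_filter.1 hzs
    obtain ⟨w, hw⟩ := Finset.card_eq_one.1 h1.2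
    have hw' : ∀ x, x ∈ N y (f z) → x = w := fun x hx => by rw [hw] at hx; simpa using hx
    have hzw := hw' z ((hN _ _ _).2 ⟨hz, hadj, rfl⟩)
    have h2 := hsolo z hz h1.1 y hy hadj (fun x hx hxf hax => by
      rw [hzw]; exact hw' x ((hN _ _ _).2 ⟨hx, hax, hxf⟩))
    have h3 := hdy y hy
    omega
  let AT := X.filter fun x => f x ∈ T
  let w : V → ℚ := fun z => (q : ℚ) / (dg G B z : ℚ)
  have hrec : ∀ y ∈ B, (T.card : ℚ) ≤ ∑ z ∈ AT.filter (fun z => G.Adj y z), w z := by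
    intro y hy
    have h1 : ∑ z ∈ AT.filter (fun z => G.Adj y z), w z = ∑ c ∈ T, ∑ z ∈ N y c, w z := by
      rw [← Finset.sum_fiberwise_of_maps_to (s := AT.filter (fun z => G.Adj y z)) (t := T) (g := f)]
      · refine Finset.sum_congr rfl fun c hc => Finset.sum_congr ?_ fun _ _ => rfl
        ext x
        simp only [AT, Finset.mem_filter, hN]
        constructor
        · rintro ⟨⟨⟨h1, h2⟩, h3⟩, h4⟩; exact ⟨h1, h3, h4⟩
        · rintro ⟨h1, h3, h4⟩; exact ⟨⟨⟨h1, h4 ▸ hc⟩, h3⟩, h4⟩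
      · intro x hx
        simp only [AT, Finset.mem_filter] at hx
        exact hx.1.2
    rw [h1]
    have hq : 0 < q := by
      obtain ⟨c, hc⟩ := hT
      obtain ⟨z, hz, hzc, hadj⟩ := hnb y hy c (hTA hc)
      have h2 := hdgB z y hy hadj
      by_cases hs0 : (sol y).card = 0
      · have := hany y hy z hz (hzc ▸ hc) hadj
        omega
      · obtain ⟨d, hd⟩ := Finset.card_pos.1 (Nat.pos_of_ne_zero hs0)
        obtain ⟨z', hz', hzc', hadj'⟩ := hnb y hy d (hTA (Finset.mem_filter.1 hd).1)
        have h3 := hdgB z' y hy hadj'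
        have h4 := hsol y hy z' hz' (hzc' ▸ hd) hadj'
        have := hsolT y
        omega
    have hqQ : (0 : ℚ) < q := by exact_mod_cast hq
    set σ : ℚ := ((sol y).card : ℚ) with hσ
    set τ : ℚ := (T.card : ℚ) - σ with hτ
    have hσ0 : 0 ≤ σ := by positivity
    have hτ0 : 0 ≤ τ := by
      have : ((sol y).card : ℚ) ≤ T.card := by exact_mod_cast hsolT y
      rw [hτ]; linarith
    have hden : 0 < 2 * (q : ℚ) + σ := by linarith
    have hlow : ∀ c ∈ T, (if c ∈ sol y then 1 + τ / q else 1 - σ / (2 * q + σ)) ≤ ∑ z ∈ N y c, w z := by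
      intro c hc
      split_ifs with hcs
      · obtain ⟨z, hzN⟩ := Finset.card_eq_one.1 (Finset.mem_filter.1 hcs).2
        rw [hzN, Finset.sum_singleton]
        have hz : z ∈ N y c := by rw [hzN]; simp
        obtain ⟨hzX, hadj, hzc⟩ := (hN _ _ _).1 hz
        have h2 := hdgB z y hy hadj
        have h3 := hsol y hy z hzX (hzc ▸ hcs) hadj
        have h2' : (0 : ℚ) < dg G B z := by exact_mod_cast h2
        have h3' : (dg G B z : ℚ) + T.card ≤ q + σ := by rw [hσ]; exact_mod_cast h3
        have h4 : (dg G B z : ℚ) ≤ q - τ := by rw [hτ]; linarith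
        show _ ≤ (q : ℚ) / (dg G B z : ℚ)
        rw [le_div_iff₀ h2']
        have h5 : (1 + τ / q) * (dg G B z : ℚ) ≤ (1 + τ / q) * (q - τ) :=
          mul_le_mul_of_nonneg_left h4 (by positivity)
        have h6 : (1 + τ / q) * (q - τ) = q - τ * τ / q := by field_simp; ring
        have h7 : 0 ≤ τ * τ / q := by positivity
        linarith
      · have h2 : 2 ≤ (N y c).card := by
          have := hNpos y hy c (hTA hc)
          have h3 : (N y c).card ≠ 1 := fun h => hcs (Finset.mem_filter.2 ⟨hc, h⟩)
          omega
        have h3 : ∀ z ∈ N y c, (q : ℚ) / (2 * q + σ) ≤ w z := by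
          intro z hz
          obtain ⟨hzX, hadj, hzc⟩ := (hN _ _ _).1 hz
          have h2 := hdgB z y hy hadj
          have h2' : (0 : ℚ) < dg G B z := by exact_mod_cast h2
          have h3 := hany y hy z hzX (hzc ▸ hc) hadj
          have h3' : (dg G B z : ℚ) ≤ 2 * q + σ := by rw [hσ]; exact_mod_cast h3
          exact div_le_div_of_nonneg_left hqQ.le h2' h3'
        have h4 := Finset.card_nsmul_le_sum _ _ _ h3
        rw [nsmul_eq_mul] at h4
        have h5 : (2 : ℚ) * (q / (2 * q + σ)) ≤ ((N y c).card : ℚ) * (q / (2 * q + σ)) :=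
          mul_le_mul_of_nonneg_right (by exact_mod_cast h2) (by positivity)
        have h6 : 1 - σ / (2 * q + σ) = 2 * (q / (2 * q + σ)) := by field_simp; ring
        linarith
    refine le_trans ?_ (Finset.sum_le_sum hlow)
    rw [← Finset.sum_filter_add_sum_filter_not T (fun c => c ∈ sol y)]
    have e1 : T.filter (fun c => c ∈ sol y) = sol y := by
      ext c; simp only [Finset.mem_filter, and_iff_right_iff_imp]
      intro hc; exact (Finset.mem_filter.1 hc).1
    have e2 : T.filter (fun c => c ∉ sol y) = T \ sol y := by
      ext c; simp
    rw [Finset.sum_congr rfl (fun c hc => if_pos (Finset.mem_filter.1 hc).2),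
      Finset.sum_congr rfl (fun c hc => if_neg (Finset.mem_filter.1 hc).2), e1, e2,
      Finset.sum_const, Finset.sum_const,
      Finset.card_sdiff_of_subset (Finset.filter_subset _ _), nsmul_eq_mul, nsmul_eq_mul,
      Nat.cast_sub (hsolT y), ← hσ, ← hτ]
    have h8 : σ / (2 * q + σ) ≤ σ / q := div_le_div_of_nonneg_left hσ0 hqQ (by linarith)
    have h9 : τ * (σ / (2 * q + σ)) ≤ τ * (σ / q) := mul_le_mul_of_nonneg_left h8 hτ0
    have h10 : σ * (τ / q) = τ * (σ / q) := by ring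
    have h11 : (T.card : ℚ) = σ + τ := by rw [hτ]; ring
    rw [h11]
    nlinarith
  have htot := Finset.sum_le_sum hrec
  have hswap : ∑ y ∈ B, ∑ z ∈ AT.filter (fun z => G.Adj y z), w z =
      ∑ z ∈ AT, ∑ y ∈ B.filter (fun y => G.Adj z y), w z := by
    refine Finset.sum_comm' ?_
    intro x y
    simp only [Finset.mem_filter, G.adj_comm]
    tauto
  rw [hswap] at htot
  have hup : ∑ z ∈ AT, ∑ y ∈ B.filter (fun y => G.Adj z y), w z ≤ ∑ z ∈ AT, (q : ℚ) := by
    refine Finset.sum_le_sum fun z hz => ?_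
    rw [Finset.sum_const, nsmul_eq_mul]
    show (dg G B z : ℚ) * (q / (dg G B z : ℚ)) ≤ q
    by_cases h0 : (dg G B z : ℚ) = 0
    · rw [h0]; simp
    · rw [mul_div_cancel₀ _ h0]
  have hAT : AT.card ≤ T.card * s := by
    have : AT.card = ∑ c ∈ T, (AT.filter fun x => f x = c).card :=
      Finset.card_eq_sum_card_fiberwise (fun x hx => (Finset.mem_filter.1 hx).2)
    rw [this]
    refine le_trans (Finset.sum_le_card_nsmul _ _ s fun c hc => ?_) (by simp)
    refine le_trans (Finset.card_le_card ?_) (hs c hc)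
    exact Finset.filter_subset_filter _ (Finset.filter_subset _ _)
  have hfin := htot.trans hup
  simp only [Finset.sum_const, nsmul_eq_mul] at hfin
  have hfin' : B.card * T.card ≤ AT.card * q := by exact_mod_cast hfin
  have hTpos := Finset.card_pos.2 hT
  rw [hB] at hfin'
  nlinarith [Nat.mul_le_mul_right q hAT]

end
end OreEq

namespace OreEq
open scoped Classical
noncomputable section
universe u
variable {V : Type u}

lemma dg_mono {G : SimpleGraph V} {X Y : Finset V} (h : X ⊆ Y) (x : V) : dg G X x ≤ dg G Y x :=
  Finset.card_le_card (Finset.filter_subset_filter _ h)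

lemma dg_split {G : SimpleGraph V} {X U : Finset V} (h : X ⊆ U) (x : V) :
    dg G U x = dg G X x + dg G (U \ X) x := by
  unfold dg
  rw [← Finset.card_union_of_disjoint, ← Finset.filter_union, Finset.union_sdiff_of_subset h]
  exact Finset.disjoint_filter_filter Finset.disjoint_sdiff

lemma equip (s : ℕ) (K : Finset ℕ) : ∀ (U : Finset V), U.card = K.card * s →
    ∃ f : V → ℕ, (∀ x ∈ U, f x ∈ K) ∧ ∀ c ∈ K, (U.filter fun x => f x = c).card = s := by
  induction K using Finset.induction_on with
  | empty =>
    intro U hU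
    have : U = ∅ := by simpa using hU
    subst this
    exact ⟨fun _ => 0, by simp, by simp⟩
  | insert a K ha ih =>
    intro U hU
    rw [Finset.card_insert_of_notMem ha, add_mul, one_mul] at hU
    obtain ⟨W, hW, hWc⟩ := Finset.exists_subset_card_eq (s := U) (n := s) (by omega)
    obtain ⟨f, hf1, hf2⟩ := ih (U \ W) (by rw [Finset.card_sdiff_of_subset hW]; omega)
    refine ⟨fun x => if x ∈ W then a else f x, ?_, ?_⟩
    · intro x hx
      by_cases hxW : x ∈ W
      · simp [hxW]
      · simp only [hxW, if_false, Finset.mem_insert]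
        exact Or.inr (hf1 x (by simp [hx, hxW]))
    · intro c hc
      by_cases hca : c = a
      · subst hca
        rw [← hWc]
        congr 1
        ext x
        simp only [Finset.mem_filter]
        constructor
        · rintro ⟨hx, hxc⟩
          by_contra hxW
          simp only [hxW, if_false] at hxc
          exact ha (hxc ▸ hf1 x (by simp [hx, hxW]))
        · intro hx
          exact ⟨hW hx, by simp [hx]⟩
      · have hcK : c ∈ K := by simpa [hca] using hc
        rw [← hf2 c hcK]
        congr 1
        ext x
        by_cases hxW : x ∈ W
        · simp [hxW, Ne.symm hca]
        · simp [hxW]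

lemma exists_St {G : SimpleGraph V} {U : Finset V} {K : Finset ℕ} {s : ℕ} {v : V}
    (hv : v ∈ U) (G' : SimpleGraph V)
    (hG' : ∀ a b, G'.Adj a b ↔ G.Adj a b ∧ a ≠ v ∧ b ≠ v) (h : EqCol G' U K s) :
    ∃ f c0, St G U K s v f c0 := by
  obtain ⟨f, h1, h2, h3⟩ := h
  refine ⟨f, f v, hv, h1 v hv, fun x hx => h1 x (Finset.mem_erase.1 hx).2, ?_, ?_, ?_⟩
  · intro x hx y hy hxy
    have hx' := Finset.mem_erase.1 hx
    have hy' := Finset.mem_erase.1 hy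
    exact h2 x hx'.2 y hy'.2 ((hG' x y).2 ⟨hxy, hx'.1, hy'.1⟩)
  · intro c hc hcv
    rw [← h3 c hc]
    congr 1
    ext x
    simp only [Finset.mem_filter, Finset.mem_erase]
    constructor
    · rintro ⟨⟨_, b⟩, c⟩; exact ⟨b, c⟩
    · rintro ⟨b, c⟩
      refine ⟨⟨?_, b⟩, c⟩
      rintro rfl
      exact hcv c.symm
  · rw [← h3 (f v) (h1 v hv), Finset.filter_erase, Finset.card_erase_add_one]
    simp [hv]

theorem main : ∀ (n : ℕ) (G : SimpleGraph V) (U : Finset V) (K : Finset ℕ) (s : ℕ),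
    ∑ x ∈ U, dg G U x = n → U.card = K.card * s →
    (∀ x ∈ U, ∀ y ∈ U, G.Adj x y → dg G U x + dg G U y + 1 ≤ 2 * K.card) → EqCol G U K s := by
  intro n
  induction n using Nat.strong_induction_on with
  | _ n ih =>
  intro G U K s hn hU hore
  by_cases hedge : ∃ v ∈ U, ∃ u ∈ U, G.Adj v u
  swap
  · push Not at hedge
    obtain ⟨f, h1, h2⟩ := equip s K U hU
    exact ⟨f, h1, fun x hx y hy hxy => absurd hxy (hedge x hx y hy), h2⟩
  obtain ⟨v, hv, u, hu, hvu⟩ := hedge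
  by_contra hno
  have hst0 : ∃ p : V × (V → ℕ) × ℕ, St G U K s p.1 p.2.1 p.2.2 := by
    obtain ⟨G', hG'⟩ : ∃ G' : SimpleGraph V, ∀ a b, G'.Adj a b ↔ G.Adj a b ∧ a ≠ v ∧ b ≠ v :=
      ⟨{ Adj := fun a b => G.Adj a b ∧ a ≠ v ∧ b ≠ v
         symm := ⟨fun a b h => ⟨h.1.symm, h.2.2, h.2.1⟩⟩
         loopless := ⟨fun a h => G.loopless.irrefl a h.1⟩ }, fun _ _ => Iff.rfl⟩
    have hle : ∀ x, dg G' U x ≤ dg G U x := fun x =>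
      Finset.card_le_card (Finset.monotone_filter_right _ (fun y _ hy => ((hG' x y).1 hy).1))
    have hlt : ∑ x ∈ U, dg G' U x < n := by
      rw [← hn]
      refine Finset.sum_lt_sum (fun x _ => hle x) ⟨v, hv, ?_⟩
      have h0 : dg G' U v = 0 := by
        unfold dg
        rw [Finset.card_eq_zero, Finset.filter_eq_empty_iff]
        intro y _ hy
        exact ((hG' v y).1 hy).2.1 rfl
      rw [h0]
      exact Finset.card_pos.2 ⟨u, by simp [hu, hvu]⟩
    obtain ⟨f, c0, h⟩ := exists_St (G := G) hv G' hG'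
      (ih _ hlt G' U K s rfl hU (fun x hx y hy hxy => by
        have := hore x hx y hy ((hG' x y).1 hxy).1
        have := hle x
        have := hle y
        omega))
    exact ⟨(v, f, c0), h⟩
  let ac : V × (V → ℕ) × ℕ → Finset ℕ := fun p => acc G U K p.1 p.2.1 p.2.2
  let av : V × (V → ℕ) × ℕ → Finset V := fun p => AV G U K p.1 p.2.1 p.2.2
  have hacK : ∀ p, (ac p).card ≤ K.card := fun p => Finset.card_filter_le _ _
  obtain ⟨p0, hp0, hmax⟩ := exists_min _ (fun p => K.card - (ac p).card) hst0
  obtain ⟨p, ⟨hp, hpc⟩, hmin⟩ := exists_min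
    (fun p : V × (V → ℕ) × ℕ => St G U K s p.1 p.2.1 p.2.2 ∧ (ac p).card = (ac p0).card)
    (fun p => ∑ x ∈ av p, dg G (U \ av p) x) ⟨p0, hp0, rfl⟩
  have hmax' : ∀ p', St G U K s p'.1 p'.2.1 p'.2.2 → (ac p').card ≤ (ac p).card := by
    intro p' hp'
    have h1 := hmax p' hp'
    have h2 := hacK p'
    have h3 := hacK p
    omega
  obtain ⟨v, f, c0⟩ := p
  simp only at hp
  set A := acc G U K v f c0 with hA
  set X := AV G U K v f c0 with hX
  have hAK : A ⊆ K := Finset.filter_subset _ _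
  have hXU : ∀ x, x ∈ X ↔ x ∈ U.erase v ∧ f x ∈ A := fun x => Finset.mem_filter
  have hXsub : X ⊆ U := fun x hx => (Finset.mem_erase.1 ((hXU x).1 hx).1).2
  have hc0A : c0 ∈ A := Finset.mem_filter.2 ⟨hp.hc0, Relation.ReflTransGen.refl⟩
  have hnb : ∀ y ∈ U \ X, ∀ c ∈ A, ∃ x ∈ X, f x = c ∧ G.Adj y x :=
    fun y hy c hc => hp.acc_nbr hno hy hc
  obtain ⟨T, hTA, hTne, hterm, U0, hU0⟩ := exists_T (mv G (U.erase v) f) c0 A hc0A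
    (fun c hc => (Finset.mem_filter.1 hc).2.acc)
  have hcl : ∀ c ∈ A, (X.filter fun x => f x = c) = (U.erase v).filter fun x => f x = c := by
    intro c hc
    ext x
    simp only [Finset.mem_filter, hXU]
    constructor
    · rintro ⟨⟨a, _⟩, b⟩; exact ⟨a, b⟩
    · rintro ⟨a, b⟩; exact ⟨⟨a, b ▸ hc⟩, b⟩
  have hXcard : X.card + 1 = A.card * s := by
    have h1 : X.card = ∑ c ∈ A, (X.filter fun x => f x = c).card :=
      Finset.card_eq_sum_card_fiberwise (fun x hx => ((hXU x).1 hx).2)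
    have h4 : ∀ c ∈ A.erase c0, (X.filter fun x => f x = c).card = s := by
      intro c hc
      rw [hcl c (Finset.mem_erase.1 hc).2]
      exact hp.sz c (hAK (Finset.mem_erase.1 hc).2) (Finset.mem_erase.1 hc).1
    rw [h1, ← Finset.add_sum_erase _ _ hc0A, hcl c0 hc0A, Finset.sum_congr rfl h4]
    have h2 := hp.sz0
    have h3 := Finset.card_erase_add_one hc0A
    rw [Finset.sum_const, smul_eq_mul, ← h3, add_mul, one_mul]
    omega
  have hAKc := Finset.card_le_card hAK
  obtain ⟨q, hq⟩ := Nat.exists_eq_add_of_le hAKc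
  have hdA : ∀ y ∈ U \ X, A.card ≤ dg G X y := by
    intro y hy
    have h1 : A ⊆ (X.filter fun x => G.Adj y x).image f := by
      intro c hc
      obtain ⟨x, hx, hxc, hadj⟩ := hnb y hy c hc
      exact Finset.mem_image.2 ⟨x, by simp [hx, hadj], hxc⟩
    exact (Finset.card_le_card h1).trans Finset.card_image_le
  have hApos : 0 < A.card := Finset.card_pos.2 ⟨c0, hc0A⟩
  have hBcard : (U \ X).card = q * s + 1 := by
    have h1 := Finset.card_sdiff_add_card_eq_card hXsub
    rw [hU, hq, add_mul] at h1
    omega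
  have hg : ∀ y ∈ U \ X, EqCol G ((U \ X).erase y) (K \ A) s := by
    intro y hy
    have hsub : (U \ X).erase y ⊆ U \ X := Finset.erase_subset _ _
    have hKA : (K \ A).card = q := by rw [Finset.card_sdiff_of_subset hAK]; omega
    have hyU : y ∈ U := (Finset.mem_sdiff.1 hy).1
    refine ih _ ?_ G _ _ s rfl ?_ ?_
    · rw [← hn]
      calc ∑ x ∈ (U \ X).erase y, dg G ((U \ X).erase y) x
          ≤ ∑ x ∈ (U \ X).erase y, dg G U x :=
            Finset.sum_le_sum fun x _ => dg_mono (hsub.trans Finset.sdiff_subset) x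
        _ < ∑ x ∈ U, dg G U x := by
            refine Finset.sum_lt_sum_of_subset (hsub.trans Finset.sdiff_subset) hyU (by simp) ?_
              (fun _ _ _ => Nat.zero_le _)
            have h1 := hdA y hy
            have h2 : dg G X y ≤ dg G U y := dg_mono hXsub y
            omega
    · rw [hKA, Finset.card_erase_of_mem hy, hBcard]; rfl
    · intro a ha b hb hab
      rw [hKA]
      have h1 := hore a (Finset.mem_sdiff.1 (hsub ha)).1 b (Finset.mem_sdiff.1 (hsub hb)).1 hab
      rw [dg_split hXsub a, dg_split hXsub b] at h1
      have h2 := hdA a (hsub ha)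
      have h3 := hdA b (hsub hb)
      have h4 : dg G ((U \ X).erase y) a ≤ dg G (U \ X) a := dg_mono hsub a
      have h5 : dg G ((U \ X).erase y) b ≤ dg G (U \ X) b := dg_mono hsub b
      omega
  refine count G X (U \ X) f A T K.card s q hTA hTne (fun x hx => ((hXU x).1 hx).2) hq.symm hBcard
    ?_ hnb ?_ ?_ ?_
  · intro c hc
    rw [hcl c (hTA hc)]
    by_cases h0 : c = c0
    · rw [h0]; have := hp.sz0; omega
    · exact (hp.sz c (hAK (hTA hc)) h0).le
  · intro z hz hzT
    have h1 : (A \ T).erase U0 ⊆ (X.filter fun x => G.Adj z x).image f := by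
      intro c hc
      have hc1 := Finset.mem_erase.1 hc
      have hc2 := Finset.mem_sdiff.1 hc1.2
      have h2 := hU0 (f z) hzT c hc2.1 hc2.2 hc1.1
      by_contra hcon
      apply h2
      refine ⟨z, ((hXU z).1 hz).1, rfl, fun x hx hxc hadj => hcon ?_⟩
      exact Finset.mem_image.2 ⟨x, Finset.mem_filter.2
        ⟨(hXU x).2 ⟨hx, hxc ▸ hc2.1⟩, hadj⟩, hxc⟩
    have h2 : ((A \ T).erase U0).card ≤ dg G X z :=
      (Finset.card_le_card h1).trans Finset.card_image_le
    have h3 := Finset.pred_card_le_card_erase (s := A \ T) (a := U0)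
    have h4 := Finset.card_sdiff_add_card_eq_card hTA
    omega
  · intro z hz y hy hadj
    have h1 := hore z (hXsub hz) y (Finset.mem_sdiff.1 hy).1 hadj.symm
    rw [dg_split hXsub z, dg_split hXsub y] at h1
    omega
  · intro z hz hzT y hy hadj hsolo
    obtain ⟨f', hst', hA', hfX, hfy, hfB⟩ := hp.swap hno hA hX hy hz (hterm (f z) hzT) hsolo (hg y hy)
    have hAeq : acc G U K z f' c0 = A :=
      (Finset.eq_of_subset_of_card_le hA' (hmax' (z, f', c0) hst')).symm
    have hyX := (Finset.mem_sdiff.1 hy).2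
    have hyU := (Finset.mem_sdiff.1 hy).1
    have hyz : y ≠ z := hadj.ne
    have hX' : AV G U K z f' c0 = insert y (X.erase z) := by
      ext x
      unfold AV
      rw [hAeq]
      simp only [Finset.mem_filter, Finset.mem_insert, Finset.mem_erase]
      constructor
      · rintro ⟨⟨hxz, hxU⟩, hxA⟩
        by_cases hxy : x = y
        · exact Or.inl hxy
        · by_cases hxX : x ∈ X
          · exact Or.inr ⟨hxz, hxX⟩
          · exact absurd hxA (hfB x (by simp [hxy, hxX, hxU]))
      · rintro (rfl | ⟨hxz, hxX⟩)
        · exact ⟨⟨hyz, hyU⟩, by rw [hfy]; exact hTA hzT⟩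
        · exact ⟨⟨hxz, hXsub hxX⟩, by rw [hfX x hxX]; exact ((hXU x).1 hxX).2⟩
    have hc := hmin (z, f', c0) ⟨hst', by
      rw [← hpc]; exact congrArg Finset.card hAeq⟩
    simp only [av, hX', ← hX] at hc
    have hY' : U \ insert y (X.erase z) = insert z ((U \ X).erase y) := by
      ext x
      simp only [Finset.mem_sdiff, Finset.mem_insert, Finset.mem_erase]
      by_cases hxz : x = z
      · subst hxz; simp [hXsub hz, Ne.symm hyz]
      · simp only [hxz]; tauto
    rw [hY'] at hc
    have hcs := cut_swap G (X.erase z) ((U \ X).erase y) y z (by simp) (by simp [hyX])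
      (by simp [hz]) (by simp) hadj
    rw [Finset.insert_erase hz, Finset.insert_erase hy] at hcs
    have h1 := hore z (hXsub hz) y hyU hadj.symm
    rw [dg_split hXsub z, dg_split hXsub y] at h1
    omega

end
end OreEq

/-- For `k ≥ 1`, every graph `G` with maximum Ore degree `θ(G) ≤ 2k - 1` has an equitable
`k`-coloring. -/
theorem equitable_of_oreDeg {V : Type*} [Fintype V] (G : SimpleGraph V) [DecidableRel G.Adj]
    (k : ℕ) (hk : 1 ≤ k) (h : G.maxOreDeg ≤ 2 * k - 1) :
    G.HasEquitableColoring k := by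
  classical
  have hdeg : ∀ x y, G.Adj x y → G.degree x + G.degree y + 1 ≤ 2 * k := by
    intro x y hxy
    have h1 : G.degree x + G.degree y ≤ G.maxOreDeg := by
      refine le_csSup ⟨Fintype.card V + Fintype.card V, ?_⟩ ⟨x, y, hxy, rfl⟩
      rintro n ⟨a, b, -, rfl⟩
      exact Nat.add_le_add (G.degree_lt_card_verts a).le (G.degree_lt_card_verts b).le
    omega
  set n := Fintype.card V with hn
  set s := n / k + 1 with hs
  have hmod : k * (n / k) + n % k = n := Nat.div_add_mod n k
  have hlt := Nat.mod_lt n (show 0 < k by omega)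
  obtain ⟨p, hp⟩ : ∃ p, n + p = k * s := ⟨k - n % k, by rw [hs, mul_add, mul_one]; omega⟩
  have hpk : p ≤ k := by
    rw [hs, mul_add, mul_one] at hp; omega
  let G' : SimpleGraph (V ⊕ Fin p) := G ⊕g (⊤ : SimpleGraph (Fin p))
  have hl : ∀ x, OreEq.dg G' Finset.univ (Sum.inl x) = G.degree x := by
    intro x
    unfold OreEq.dg
    rw [← G.card_neighborFinset_eq_degree, ← Finset.card_map (Function.Embedding.inl : V ↪ V ⊕ Fin p)]
    congr 1
    ext y
    rcases y with y | y <;> simp [G']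
  have hr : ∀ x, OreEq.dg G' Finset.univ (Sum.inr x) + 1 ≤ p := by
    intro x
    unfold OreEq.dg
    have : (Finset.univ.filter fun y => G'.Adj (Sum.inr x) y) ⊆
        (Finset.univ.erase x).map (Function.Embedding.inr : Fin p ↪ V ⊕ Fin p) := by
      intro y
      rcases y with y | y
      · simp [G']
      · simp [G', eq_comm]
    have h2 := Finset.card_le_card this
    have hx := x.2
    rw [Finset.card_map, Finset.card_erase_of_mem (Finset.mem_univ _), Finset.card_univ,
      Fintype.card_fin] at h2
    have h3 : (Finset.univ.filter fun y => G'.Adj (Sum.inr x) y).card + 1 ≤ p := by omega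
    convert h3
  obtain ⟨f, hf1, hf2, hf3⟩ := OreEq.main _ G' Finset.univ (Finset.range k) s rfl
    (by rw [Finset.card_range, Finset.card_univ, Fintype.card_sum, Fintype.card_fin]; exact hp)
    (by
      intro x _ y _ hxy
      rw [Finset.card_range]
      rcases x with x | x <;> rcases y with y | y
      · rw [hl, hl]; exact hdeg x y (by simpa [G'] using hxy)
      · simp [G'] at hxy
      · simp [G'] at hxy
      · have := hr x
        have := hr y
        omega)
  have hfk : ∀ x, f x < k := fun x => Finset.mem_range.1 (hf1 x (Finset.mem_univ _))
  refine ⟨SimpleGraph.Coloring.mk (fun x => ⟨f (Sum.inl x), hfk _⟩) ?_, ?_⟩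
  · intro a b hab he
    have := hf2 (Sum.inl a) (Finset.mem_univ _) (Sum.inl b) (Finset.mem_univ _)
      (by simpa [G'] using hab)
    exact this (by simpa using he)
  · have key : ∀ i : Fin k,
        (Finset.univ.filter fun x : V => (⟨f (Sum.inl x), hfk _⟩ : Fin k) = i).card ≤ s ∧
        s ≤ (Finset.univ.filter fun x : V => (⟨f (Sum.inl x), hfk _⟩ : Fin k) = i).card + 1 := by
      intro i
      have h1 := hf3 i (Finset.mem_range.2 i.2)
      have h2 : (Finset.univ.filter fun x : V ⊕ Fin p => f x = i) =
          ((Finset.univ.filter fun x : V => (⟨f (Sum.inl x), hfk _⟩ : Fin k) = i)).disjSum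
          (Finset.univ.filter fun x : Fin p => f (Sum.inr x) = i) := by
        ext x
        rcases x with x | x <;> simp [Fin.ext_iff]
      have h4 : (Finset.univ.filter fun x : Fin p => f (Sum.inr x) = i).card ≤ 1 := by
        rw [Finset.card_le_one]
        intro a ha b hb
        by_contra hab
        simp only [Finset.mem_filter, Finset.mem_univ, true_and] at ha hb
        exact hf2 (Sum.inr a) (Finset.mem_univ _) (Sum.inr b) (Finset.mem_univ _)
          (by simpa [G'] using hab) (ha.trans hb.symm)
      have h5 : (Finset.univ.filter fun x : V ⊕ Fin p => f x = i).card = s := by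
        convert h1
      rw [h2, Finset.card_disjSum] at h5
      omega
    intro i j
    have h1 := (key i).1
    have h2 := (key j).2
    exact h1.trans h2
end

section
/- Let k ≥ 5 be an integer and let G be a finite simple graph with clique number ω(G) ≤ k and θ(G) ≤ 2k+1. Then the chromatic number satisfies χ(G) ≤ k. -/
open Finset Relation

namespace OreB

/-- Reachability within a vertex predicate. -/
def Rch {V : Type*} (G : SimpleGraph V) (S : V → Prop) : V → V → Prop :=
  ReflTransGen (fun u v => G.Adj u v ∧ S u ∧ S v)

theorem Rch.symm {V : Type*} {G : SimpleGraph V} {S : V → Prop} {a b : V} (h : Rch G S a b) :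
    Rch G S b a := by
  unfold Rch at *
  induction h with
  | refl => exact ReflTransGen.refl
  | tail _ h2 ih => exact ReflTransGen.head ⟨h2.1.symm, h2.2.2, h2.2.1⟩ ih

theorem Rch.trans {V : Type*} {G : SimpleGraph V} {S : V → Prop} {a b c : V} (h : Rch G S a b)
    (h' : Rch G S b c) : Rch G S a c := ReflTransGen.trans h h'

theorem Rch.step {V : Type*} {G : SimpleGraph V} {S : V → Prop} {a b c : V} (h : Rch G S a b)
    (h1 : G.Adj b c) (h2 : S b) (h3 : S c) : Rch G S a c := ReflTransGen.tail h ⟨h1, h2, h3⟩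

theorem Rch.mem {V : Type*} {G : SimpleGraph V} {S : V → Prop} {a b : V} (h : Rch G S a b)
    (ha : S a) : S b := by
  unfold Rch at h
  induction h with
  | refl => exact ha
  | tail _ h2 ih => exact h2.2.2

/-- carry along a closed predicate -/
theorem Rch.carry {V : Type*} {G : SimpleGraph V} {S T : V → Prop} {a b : V} (h : Rch G S a b)
    (ha : T a) (hT : ∀ u v, T u → S u → S v → G.Adj u v → T v) : Rch G T a b ∧ T b := by
  unfold Rch at *
  induction h with
  | refl => exact ⟨ReflTransGen.refl, ha⟩
  | tail _ h2 ih =>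
    have := hT _ _ ih.2 h2.2.1 h2.2.2 h2.1
    exact ⟨ih.1.tail ⟨h2.1, ih.2, this⟩, this⟩

theorem Rch.mono {V : Type*} {G : SimpleGraph V} {S T : V → Prop} {a b : V} (h : Rch G S a b)
    (hT : ∀ u, S u → T u) : Rch G T a b := by
  unfold Rch at *
  induction h with
  | refl => exact ReflTransGen.refl
  | tail _ h2 ih => exact ih.tail ⟨h2.1, hT _ h2.2.1, hT _ h2.2.2⟩

theorem Rch.avoid {V : Type*} {G : SimpleGraph V} {S : V → Prop} {y z : V} (h : Rch G S y z)
    (hne : y ≠ z) : ∃ u, G.Adj y u ∧ S u ∧ Rch G (fun t => S t ∧ t ≠ y) u z := by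
  have key : ∀ p, Rch G S p z → (p ≠ y ∧ Rch G (fun t => S t ∧ t ≠ y) p z) ∨
      ∃ u, G.Adj y u ∧ S u ∧ Rch G (fun t => S t ∧ t ≠ y) u z := by
    intro p hp
    unfold Rch at hp
    induction hp using ReflTransGen.head_induction_on with
    | refl => exact Or.inl ⟨hne.symm, ReflTransGen.refl⟩
    | @head a c hac _ ih =>
      rcases ih with ⟨h1, h2⟩ | h
      · by_cases hay : a = y
        · subst hay
          exact Or.inr ⟨c, hac.1, hac.2.2, h2⟩
        · exact Or.inl ⟨hay, ReflTransGen.head ⟨hac.1, ⟨hac.2.1, hay⟩, ⟨hac.2.2, h1⟩⟩ h2⟩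
      · exact Or.inr h
  rcases key y h with h | h
  · exact absurd rfl h.1
  · exact h

section Brooks
open Classical

variable {W : Type*} [Fintype W]

/-- proper `k`-colouring of `H - x` -/
def PC (H : SimpleGraph W) (k : ℕ) (x : W) (c : W → ℕ) : Prop :=
  (∀ u, u ≠ x → c u < k) ∧ ∀ u v, u ≠ x → v ≠ x → H.Adj u v → c u ≠ c v

/-- no proper `k`-colouring -/
def NC (H : SimpleGraph W) (k : ℕ) : Prop :=
  ∀ c : W → ℕ, (∀ u, c u < k) → ∃ u v, H.Adj u v ∧ c u = c v

theorem PC.ex {H : SimpleGraph W} {k : ℕ} (hn : NC H k) {x : W} {c : W → ℕ} (h : PC H k x c)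
    {a : ℕ} (ha : a < k) : ∃ y, H.Adj x y ∧ c y = a := by
  by_contra hcon
  push Not at hcon
  obtain ⟨u, v, huv, he⟩ := hn (Function.update c x a) (by
    intro u
    by_cases hu : u = x
    · subst hu; simpa
    · simpa [hu] using h.1 u hu)
  by_cases hu : u = x
  · subst hu
    have hv : v ≠ u := huv.ne'
    simp [hv] at he
    exact hcon v huv he.symm
  · by_cases hv : v = x
    · subst hv
      simp [hu] at he
      exact hcon u huv.symm he
    · simp [hu, hv] at he
      exact h.2 u v hu hv huv he

theorem PC.uniq {H : SimpleGraph W} {k : ℕ} (hn : NC H k)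
    (hd : ∀ x, (univ.filter (fun u => H.Adj x u)).card = k)
    {x : W} {c : W → ℕ} (h : PC H k x c)
    {y z : W} (hy : H.Adj x y) (hz : H.Adj x z) (he : c y = c z) : y = z := by
  have him : (univ.filter (fun u => H.Adj x u)).image c = range k := by
    ext a
    simp only [mem_image, mem_filter, mem_univ, true_and, mem_range]
    constructor
    · rintro ⟨u, hu, rfl⟩
      exact h.1 u hu.ne'
    · intro ha
      exact h.ex hn ha
  have : Set.InjOn c (univ.filter (fun u => H.Adj x u) : Finset W) := by
    apply Finset.card_image_iff.1
    rw [him, card_range, hd]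
  exact this (by simpa using hy) (by simpa using hz) he

theorem PC.slide {H : SimpleGraph W} {k : ℕ} (hn : NC H k)
    (hd : ∀ x, (univ.filter (fun u => H.Adj x u)).card = k)
    {x : W} {c : W → ℕ} (h : PC H k x c)
    {y : W} (hy : H.Adj x y) : PC H k y (Function.update c x (c y)) := by
  have hyx : y ≠ x := hy.ne'
  constructor
  · intro u hu
    by_cases hux : u = x
    · subst hux; simpa using h.1 y hyx
    · simpa [hux] using h.1 u hux
  · intro u v hu hv huv
    by_cases hux : u = x
    · subst hux
      have hv' : v ≠ u := huv.ne'
      simp only [Function.update_self, ne_eq, hv', not_false_eq_true, Function.update_of_ne]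
      intro he
      exact hv (h.uniq hn hd hy huv he).symm
    · by_cases hvx : v = x
      · subst hvx
        simp only [Function.update_self, ne_eq, hux, not_false_eq_true, Function.update_of_ne]
        intro he
        exact hu (h.uniq hn hd huv.symm hy he)
      · simpa [hux, hvx] using h.2 u v hux hvx huv

theorem PC.slideRch {H : SimpleGraph W} {k : ℕ} (hn : NC H k)
    (hd : ∀ x, (univ.filter (fun u => H.Adj x u)).card = k)
    {x : W} {c : W → ℕ} (h : PC H k x c) (a b : ℕ) {v : W}
    (hv : Rch H (fun u => u = x ∨ c u = a ∨ c u = b) x v) :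
    ∃ c', PC H k v c' ∧ (∀ u, ¬ (u = x ∨ c u = a ∨ c u = b) → c' u = c u) ∧
      ∀ u, (u = x ∨ c u = a ∨ c u = b) → u ≠ v → c' u = a ∨ c' u = b := by
  unfold Rch at hv
  induction hv with
  | refl =>
    refine ⟨c, h, fun _ _ => rfl, ?_⟩
    intro u hu hux
    rcases hu with hu | hu
    · exact absurd hu hux
    · exact hu
  | @tail v w _ hvw ih =>
    obtain ⟨c', h1, h2, h3⟩ := ih
    refine ⟨_, h1.slide hn hd hvw.1, ?_, ?_⟩
    · intro u hu
      have : u ≠ v := by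
        rintro rfl
        exact hu hvw.2.1
      simp only [ne_eq, this, not_false_eq_true, Function.update_of_ne]
      exact h2 u hu
    · intro u hu huw
      by_cases huv : u = v
      · subst huv
        simp only [Function.update_self]
        exact h3 w hvw.2.2 hvw.1.ne'
      · simp only [ne_eq, huv, not_false_eq_true, Function.update_of_ne]
        exact h3 u hu huv

theorem PC.F3 {H : SimpleGraph W} {k : ℕ} (hn : NC H k)
    (hd : ∀ x, (univ.filter (fun u => H.Adj x u)).card = k)
    {x : W} {c : W → ℕ} (h : PC H k x c) {a b d : ℕ} (ha : a < k) (hb : b < k)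
    (hab : a ≠ b) (hbd : b ≠ d) {v : W} (hvx : v ≠ x) (hva : c v = a)
    (hv : Rch H (fun u => u = x ∨ c u = a ∨ c u = b) x v)
    (hv' : Rch H (fun u => u = x ∨ c u = a ∨ c u = d) x v) : H.Adj x v := by
  by_contra hxv
  obtain ⟨c1, h1, h2, h3⟩ := h.slideRch hn hd a b hv
  obtain ⟨c2, g1, g2, g3⟩ := h.slideRch hn hd a d hv'
  obtain ⟨u1, hu1, e1⟩ := h1.ex hn ha
  obtain ⟨u2, hu2, e2⟩ := h1.ex hn hb
  have key : ∀ u, H.Adj v u → (c1 u = a ∨ c1 u = b) → c u = b ∧ u ≠ x := by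
    intro u hu he
    have hux : u ≠ x := by
      rintro rfl
      exact hxv hu.symm
    refine ⟨?_, hux⟩
    have hne := h.2 v u hvx hux hu
    by_contra hcb
    have := h2 u (by rintro (h | h | h) <;> simp_all)
    rcases he with he | he
    · rw [this] at he; exact hne (hva.trans he.symm)
    · rw [this] at he; exact hcb he
  have k1 := key u1 hu1 (Or.inl e1)
  have k2 := key u2 hu2 (Or.inr e2)
  have q1 := g2 u1 (by rintro (h | h | h) <;> simp_all)
  have q2 := g2 u2 (by rintro (h | h | h) <;> simp_all)
  have := g1.uniq hn hd hu1 hu2 (by rw [q1, q2, k1.1, k2.1])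
  subst this
  exact hab (e1.symm.trans e2)

/-- Kempe swap -/
theorem PC.swap {H : SimpleGraph W} {k : ℕ} 
    {x : W} {c : W → ℕ} (h : PC H k x c) {a b : ℕ} (ha : a < k) (hb : b < k)
    (hab : a ≠ b) {y : W} (hyx : y ≠ x) (hy : c y = a) : 
    PC H k x (fun u => if Rch H (fun u => u ≠ x ∧ (c u = a ∨ c u = b)) y u then
      (if c u = a then b else a) else c u) := by
  set K := Rch H (fun u => u ≠ x ∧ (c u = a ∨ c u = b)) y with hK
  have hKm : ∀ u, K u → u ≠ x ∧ (c u = a ∨ c u = b) := by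
    intro u hu
    exact Rch.mem (S := fun u => u ≠ x ∧ (c u = a ∨ c u = b)) hu ⟨hyx, Or.inl hy⟩
  have hKc : ∀ u v, K u → H.Adj u v → v ≠ x → (c v = a ∨ c v = b) → K v := by
    intro u v hu huv hvx hv
    exact Rch.step hu huv (hKm u hu) ⟨hvx, hv⟩
  constructor
  · intro u hu
    have := h.1 u hu
    dsimp only
    split_ifs <;> assumption
  · intro u v hu hv huv
    have h0 := h.2 u v hu hv huv
    have h1 := hKm u
    have h2 := hKm v
    have h3 := hKc u v
    have h4 := hKc v u
    have h5 := huv.symm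
    dsimp only
    split_ifs <;> grind

theorem PC.F2 {H : SimpleGraph W} {k : ℕ} (hn : NC H k)
    (hd : ∀ x, (univ.filter (fun u => H.Adj x u)).card = k)
    {x : W} {c : W → ℕ} (h : PC H k x c) {y z : W} (hy : H.Adj x y) (hz : H.Adj x z)
    (hyz : y ≠ z) : Rch H (fun u => u ≠ x ∧ (c u = c y ∨ c u = c z)) y z := by
  by_contra hcon
  have hne : c y ≠ c z := fun he => hyz (h.uniq hn hd hy hz he)
  have := h.swap (h.1 y hy.ne') (h.1 z hz.ne') hne hy.ne' rfl
  apply hyz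
  apply this.uniq hn hd hy hz
  have hyy : Rch H (fun u => u ≠ x ∧ (c u = c y ∨ c u = c z)) y y := ReflTransGen.refl
  simp [hcon, hyy]

theorem brooks_aux {H : SimpleGraph W} {k : ℕ} (hk : 3 ≤ k) (hn : NC H k)
    (hd : ∀ x, (univ.filter (fun u => H.Adj x u)).card = k)
    {x : W} {c : W → ℕ} (h : PC H k x c) {y z : W} (hy : H.Adj x y) (hz : H.Adj x z)
    (hyz : y ≠ z) : H.Adj y z := by
  by_contra hnyz
  have hne : c y ≠ c z := fun he => hyz (h.uniq hn hd hy hz he)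
  obtain ⟨d, hdk, hdy, hdz⟩ : ∃ d, d < k ∧ d ≠ c y ∧ d ≠ c z := by
    by_contra hcon
    push Not at hcon
    have h0 := hcon 0 (by omega)
    have h1 := hcon 1 (by omega)
    have h2 := hcon 2 (by omega)
    omega
  have hyk := h.1 y hy.ne'
  have hzk := h.1 z hz.ne'
  obtain ⟨u, hyu, hu, hur⟩ := (h.F2 hn hd hy hz hyz).avoid hyz
  have hcu : c u = c z := by
    have := h.2 y u hy.ne' hu.1 hyu
    rcases hu.2 with h | h
    · exact absurd h.symm this
    · exact h
  have huz : u ≠ z := by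
    rintro rfl
    exact hnyz hyu
  have hs := h.swap hyk hdk hdy.symm hy.ne' rfl
  set K := Rch H (fun u => u ≠ x ∧ (c u = c y ∨ c u = d)) y with hK
  set c' : W → ℕ := (fun u => if K u then (if c u = c y then d else c y) else c u) with hc'
  have hKm : ∀ u, K u → u ≠ x ∧ (c u = c y ∨ c u = d) := by
    intro u hu
    exact Rch.mem (S := fun u => u ≠ x ∧ (c u = c y ∨ c u = d)) hu ⟨hy.ne', Or.inl rfl⟩
  have hKy : K y := ReflTransGen.refl
  have c'y : c' y = d := by simp [hc', hKy]
  have c'2 : ∀ t, c t = c z → c' t = c z := by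
    intro t ht
    have : ¬ K t := by
      intro hk
      rcases (hKm t hk).2 with h | h
      · exact hne (h.symm.trans ht)
      · exact hdz (h.symm.trans ht)
    simp [hc', this, ht]
  have c'1 : ∀ t, Rch H (fun u => u = x ∨ c u = c y ∨ c u = c z) x t → t ≠ x → c t = c y →
      t ≠ y → c' t = c y := by
    intro t ht htx hcy hty
    have : ¬ K t := by
      intro hKt
      have h1 : Rch H (fun u => u = x ∨ c u = c y ∨ c u = d) x t := by
        have h2 : Rch H (fun u => u = x ∨ c u = c y ∨ c u = d) y t := by
          refine (Rch.carry hKt (Or.inr (Or.inl rfl)) ?_).1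
          intro u v _ _ hv _
          exact Or.inr hv.2
        refine Rch.trans (ReflTransGen.single ⟨hy, Or.inl rfl, Or.inr (Or.inl rfl)⟩) h2
      have := h.F3 hn hd hyk hzk hne hdz.symm htx hcy ht h1
      exact hty (h.uniq hn hd this hy hcy)
    simp [hc', this, hcy]
  -- u reachable in the new colouring
  have r1 : Rch H (fun t => t = x ∨ c' t = c z ∨ c' t = c y) x u := by
    have hzu := hur.symm
    let T : W → Prop := fun t => Rch H (fun u => u = x ∨ c u = c y ∨ c u = c z) x t ∧ t ≠ x ∧
      (c t = c y ∨ c t = c z) ∧ t ≠ y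
    have hT : ∀ t, T t → (t = x ∨ c' t = c z ∨ c' t = c y) := by
      rintro t ⟨h1, h2, h3, h4⟩
      rcases h3 with h3 | h3
      · exact Or.inr (Or.inr (c'1 t h1 h2 h3 h4))
      · exact Or.inr (Or.inl (c'2 t h3))
    have := (Rch.carry (T := T) hzu
      ⟨ReflTransGen.single ⟨hz, Or.inl rfl, Or.inr (Or.inr rfl)⟩, hz.ne', Or.inr rfl, hyz.symm⟩
      (by
        rintro p q ⟨h1, h2, h3, h4⟩ - ⟨h6, h7⟩ h8
        exact ⟨h1.step h8 (Or.inr h3) (Or.inr h6.2), h6.1, h6.2, h7⟩)).1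
    have h2 : Rch H (fun t => t = x ∨ c' t = c z ∨ c' t = c y) z u :=
      Rch.mono this hT
    exact Rch.trans (ReflTransGen.single ⟨hz, Or.inl rfl, Or.inr (Or.inl (c'2 z rfl))⟩) h2
  have r2 : Rch H (fun t => t = x ∨ c' t = c z ∨ c' t = d) x u := by
    refine Rch.step (ReflTransGen.single ⟨hy, Or.inl rfl, Or.inr (Or.inr c'y)⟩) hyu
      (Or.inr (Or.inr c'y)) (Or.inr (Or.inl (c'2 u hcu)))
  have := hs.F3 hn hd hzk hyk hne.symm hdy.symm hu.1 (c'2 u hcu) r1 r2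
  exact huz (h.uniq hn hd this hz hcu)

theorem brooks {H : SimpleGraph W} {k : ℕ} (hk : 3 ≤ k) (hn : NC H k)
    (hd : ∀ x, (univ.filter (fun u => H.Adj x u)).card = k)
    {x : W} {c : W → ℕ} (h : PC H k x c) (hconn : ∀ v, Rch H (fun _ => True) x v) :
    ∀ v, v ≠ x → H.Adj x v := by
  have hall : ∀ v, ∃ c, PC H k v c := by
    intro v
    have := hconn v
    unfold Rch at this
    induction this with
    | refl => exact ⟨c, h⟩
    | tail _ h2 ih =>
      obtain ⟨c1, h1⟩ := ih
      exact ⟨_, h1.slide hn hd h2.1⟩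
  intro v
  have := hconn v
  unfold Rch at this
  induction this with
  | refl => intro h; exact absurd rfl h
  | @tail u w _ h2 ih =>
    intro hw
    by_cases hux : u = x
    · subst hux; exact h2.1
    · obtain ⟨c1, h1⟩ := hall u
      exact brooks_aux hk hn hd h1 (ih hux).symm h2.1 hw.symm

end Brooks

section State
open Classical

variable {V : Type*} [Fintype V]

/-- neighbours on side `p` -/
noncomputable def nb (G : SimpleGraph V) (σ : V → Bool) (p : Bool) (v : V) : Finset V :=
  univ.filter (fun u => G.Adj v u ∧ σ u = p)

theorem mem_nb {G : SimpleGraph V} {σ : V → Bool} {p : Bool} {v u : V} :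
    u ∈ nb G σ p v ↔ G.Adj v u ∧ σ u = p := by simp [nb]

/-- good colouring -/
def GC (G : SimpleGraph V) (R : Bool → ℕ) (x : V) (σ : V → Bool) (c : V → ℕ) : Prop :=
  (∀ u, u ≠ x → c u < R (σ u)) ∧
    ∀ u v, u ≠ x → v ≠ x → G.Adj u v → σ u = σ v → c u ≠ c v

/-- no full colouring -/
def NF (G : SimpleGraph V) (R : Bool → ℕ) : Prop :=
  ∀ (σ : V → Bool) (c : V → ℕ), (∀ u, c u < R (σ u)) → ∃ u v, G.Adj u v ∧ σ u = σ v ∧ c u = c v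

/-- number of one-sided edges avoiding `x` (counted twice) -/
noncomputable def en (G : SimpleGraph V) (x : V) (σ : V → Bool) : ℕ :=
  (univ.filter (fun e : V × V => G.Adj e.1 e.2 ∧ e.1 ≠ x ∧ e.2 ≠ x ∧ σ e.1 = σ e.2)).card

theorem en_eq (G : SimpleGraph V) (x : V) (σ : V → Bool) :
    (univ.filter (fun e : V × V => G.Adj e.1 e.2 ∧ σ e.1 = σ e.2)).card =
      en G x σ + 2 * (nb G σ (σ x) x).card := by
  have h1 : ((nb G σ (σ x) x).image (fun u => (x, u))).card = (nb G σ (σ x) x).card :=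
    card_image_of_injective _ (fun a b h => by simpa using h)
  have h2 : ((nb G σ (σ x) x).image (fun u => (u, x))).card = (nb G σ (σ x) x).card :=
    card_image_of_injective _ (fun a b h => by simpa using h)
  have h3 : (univ.filter (fun e : V × V => G.Adj e.1 e.2 ∧ σ e.1 = σ e.2)) =
      (univ.filter (fun e : V × V => G.Adj e.1 e.2 ∧ e.1 ≠ x ∧ e.2 ≠ x ∧ σ e.1 = σ e.2)) ∪
      ((nb G σ (σ x) x).image (fun u => (x, u)) ∪ (nb G σ (σ x) x).image (fun u => (u, x))) := by
    ext ⟨a, b⟩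
    simp only [mem_filter, mem_univ, true_and, mem_union, mem_image, mem_nb, Prod.mk.injEq]
    constructor
    · rintro ⟨h, h'⟩
      by_cases ha : a = x
      · subst ha; exact Or.inr (Or.inl ⟨b, ⟨h, h'.symm⟩, rfl, rfl⟩)
      · by_cases hb : b = x
        · subst hb; exact Or.inr (Or.inr ⟨a, ⟨h.symm, h'⟩, rfl, rfl⟩)
        · exact Or.inl ⟨h, ha, hb, h'⟩
    · rintro (⟨h, _, _, h'⟩ | ⟨u, ⟨h, h'⟩, rfl, rfl⟩ | ⟨u, ⟨h, h'⟩, rfl, rfl⟩)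
      · exact ⟨h, h'⟩
      · exact ⟨h, h'.symm⟩
      · exact ⟨h.symm, h'⟩
  rw [h3, card_union_of_disjoint, card_union_of_disjoint, h1, h2, en]
  · ring
  · rw [disjoint_left]
    rintro ⟨a, b⟩ h h'
    simp only [mem_image, mem_nb, Prod.mk.injEq] at h h'
    obtain ⟨u, ⟨hu, _⟩, rfl, rfl⟩ := h
    obtain ⟨w, ⟨hw, _⟩, e, e'⟩ := h'
    exact hu.ne e'
  · rw [disjoint_left]
    rintro ⟨a, b⟩ h h'
    simp only [mem_filter, mem_univ, true_and, mem_union, mem_image, mem_nb,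
      Prod.mk.injEq] at h h'
    rcases h' with ⟨u, _, e, _⟩ | ⟨u, _, _, e⟩
    · exact h.2.1 e.symm
    · exact h.2.2.1 e.symm

/-- minimal state -/
def MS (G : SimpleGraph V) (R : Bool → ℕ) (x : V) (σ : V → Bool) : Prop :=
  (∃ c, GC G R x σ c) ∧ ∀ y τ c, GC G R y τ c → en G x σ ≤ en G y τ

theorem GC.upd {G : SimpleGraph V} {R : Bool → ℕ} {x : V} {σ : V → Bool} {c : V → ℕ}
    (h : GC G R x σ c) (q : Bool) : GC G R x (Function.update σ x q) c := by
  constructor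
  · intro u hu
    simpa [hu] using h.1 u hu
  · intro u v hu hv
    simpa [hu, hv] using h.2 u v hu hv

theorem MS.upd {G : SimpleGraph V} {R : Bool → ℕ} {x : V} {σ : V → Bool}
    (h : MS G R x σ) (q : Bool) : MS G R x (Function.update σ x q) := by
  obtain ⟨⟨c, hc⟩, h2⟩ := h
  refine ⟨⟨c, hc.upd q⟩, ?_⟩
  have : en G x (Function.update σ x q) = en G x σ := by
    unfold en
    congr 1
    ext ⟨a, b⟩
    simp only [mem_filter, mem_univ, true_and]
    constructor
    · rintro ⟨h1, h2, h3, h4⟩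
      simp [h2, h3] at h4
      exact ⟨h1, h2, h3, h4⟩
    · rintro ⟨h1, h2, h3, h4⟩
      simp [h1, h2, h3, h4]
  rw [this]
  exact h2

theorem nb_upd {G : SimpleGraph V} {x : V} {σ : V → Bool} (p q : Bool) :
    nb G (Function.update σ x q) p x = nb G σ p x := by
  ext u
  simp only [mem_nb]
  constructor
  · rintro ⟨h, h'⟩
    exact ⟨h, by simpa [h.ne'] using h'⟩
  · rintro ⟨h, h'⟩
    exact ⟨h, by simpa [h.ne'] using h'⟩

theorem GC.ex {G : SimpleGraph V} {R : Bool → ℕ} (hn : NF G R) {x : V} {σ : V → Bool} {c : V → ℕ}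
    (h : GC G R x σ c) (p : Bool) {a : ℕ} (ha : a < R p) : ∃ y ∈ nb G σ p x, c y = a := by
  by_contra hcon
  push Not at hcon
  obtain ⟨u, v, huv, hs, he⟩ := hn (Function.update σ x p) (Function.update c x a) (by
    intro u
    by_cases hu : u = x
    · subst hu; simpa
    · simpa [hu] using h.1 u hu)
  by_cases hu : u = x
  · subst hu
    have hv : v ≠ u := huv.ne'
    simp [hv] at he hs
    exact hcon v (mem_nb.2 ⟨huv, hs.symm⟩) he.symm
  · by_cases hv : v = x
    · subst hv
      simp [hu] at he hs
      exact hcon u (mem_nb.2 ⟨huv.symm, hs⟩) he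
    · simp [hu, hv] at he hs
      exact h.2 u v hu hv huv hs he

theorem GC.image {G : SimpleGraph V} {R : Bool → ℕ} (hn : NF G R) {x : V} {σ : V → Bool}
    {c : V → ℕ} (h : GC G R x σ c) (p : Bool) : (nb G σ p x).image c = range (R p) := by
  ext a
  simp only [mem_image, mem_range]
  constructor
  · rintro ⟨u, hu, rfl⟩
    rw [mem_nb] at hu
    have := h.1 u hu.1.ne'
    rwa [hu.2] at this
  · intro ha
    exact h.ex hn p ha

theorem GC.le {G : SimpleGraph V} {R : Bool → ℕ} (hn : NF G R) {x : V} {σ : V → Bool}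
    {c : V → ℕ} (h : GC G R x σ c) (p : Bool) : R p ≤ (nb G σ p x).card := by
  rw [← card_range (R p), ← h.image hn p]
  exact card_image_le

theorem GC.inj {G : SimpleGraph V} {R : Bool → ℕ} (hn : NF G R) {x : V} {σ : V → Bool}
    {c : V → ℕ} (h : GC G R x σ c) {p : Bool} (hp : (nb G σ p x).card = R p) {y z : V}
    (hy : y ∈ nb G σ p x) (hz : z ∈ nb G σ p x) (he : c y = c z) : y = z := by
  have : Set.InjOn c (nb G σ p x : Finset V) := by
    apply Finset.card_image_iff.1
    rw [h.image hn p, card_range, hp]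
  exact this hy hz he

theorem MS.slide {G : SimpleGraph V} {R : Bool → ℕ} (hn : NF G R) {x : V} {σ : V → Bool}
    (h : MS G R x σ) {p : Bool} (hx : σ x = p) (hp : (nb G σ p x).card = R p) {y : V}
    (hy : y ∈ nb G σ p x) : MS G R y σ ∧ (nb G σ p y).card = R p := by
  obtain ⟨⟨c, hc⟩, hmin⟩ := h
  have hy' := mem_nb.1 hy
  have hyx := hy'.1.ne'
  have hg : GC G R y σ (Function.update c x (c y)) := by
    constructor
    · intro u hu
      by_cases hux : u = x
      · subst hux
        have := hc.1 y hyx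
        rw [hy'.2] at this
        simpa [hx] using this
      · simpa [hux] using hc.1 u hux
    · intro u v hu hv huv hs
      by_cases hux : u = x
      · subst hux
        have hv' : v ≠ u := huv.ne'
        simp only [Function.update_self, ne_eq, hv', not_false_eq_true, Function.update_of_ne]
        intro he
        exact hv (hc.inj hn hp hy (mem_nb.2 ⟨huv, hs.symm.trans hx⟩) he).symm
      · by_cases hvx : v = x
        · subst hvx
          simp only [Function.update_self, ne_eq, hux, not_false_eq_true, Function.update_of_ne]
          intro he
          exact hu (hc.inj hn hp (mem_nb.2 ⟨huv.symm, hs.trans hx⟩) hy he)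
        · simpa [hux, hvx] using hc.2 u v hux hvx huv hs
  have e1 := hmin y σ _ hg
  have e2 := hg.le hn p
  have e3 := en_eq G x σ
  have e4 := en_eq G y σ
  rw [hx] at e3
  rw [hy'.2] at e4
  refine ⟨⟨⟨_, hg⟩, ?_⟩, by omega⟩
  intro z τ c' hz
  have := hmin z τ c' hz
  omega

theorem MS.comp {G : SimpleGraph V} {R : Bool → ℕ} (hn : NF G R) {x : V} {σ : V → Bool}
    (h : MS G R x σ) {p : Bool} (hx : σ x = p) (hp : (nb G σ p x).card = R p) {y : V}
    (hy : Rch G (fun u => σ u = p) x y) :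
    MS G R y σ ∧ (nb G σ p y).card = R p ∧ σ y = p := by
  unfold Rch at hy
  induction hy with
  | refl => exact ⟨h, hp, hx⟩
  | tail _ h2 ih =>
    have := ih.1.slide hn ih.2.2 ih.2.1 (mem_nb.2 ⟨h2.1, h2.2.2⟩)
    exact ⟨this.1, this.2, h2.2.2⟩

theorem MS.ncol {G : SimpleGraph V} {R : Bool → ℕ} (hn : NF G R) {x : V} {σ : V → Bool}
    (h : MS G R x σ) {p : Bool} (hx : σ x = p) (f : V → ℕ)
    (hf : ∀ u, Rch G (fun u => σ u = p) x u → f u < R p) :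
    ∃ u v, Rch G (fun u => σ u = p) x u ∧ Rch G (fun u => σ u = p) x v ∧ G.Adj u v ∧
      f u = f v := by
  obtain ⟨⟨c, hc⟩, -⟩ := h
  have hxx : Rch G (fun u => σ u = p) x x := ReflTransGen.refl
  have hmem : ∀ u, Rch G (fun u => σ u = p) x u → σ u = p := fun u hu =>
    Rch.mem (S := fun u => σ u = p) hu hx
  obtain ⟨u, v, huv, hs, he⟩ := hn σ
    (fun u => if Rch G (fun u => σ u = p) x u then f u else c u) (by
      intro u
      split_ifs with hu
      · rw [hmem u hu]; exact hf u hu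
      · apply hc.1 u
        rintro rfl
        exact hu hxx)
  by_cases hu : Rch G (fun u => σ u = p) x u
  · have hv : Rch G (fun u => σ u = p) x v := hu.step huv (hmem u hu) (hs ▸ hmem u hu)
    simp only [hu, hv, if_true] at he
    exact ⟨u, v, hu, hv, huv, he⟩
  · have hv : ¬ Rch G (fun u => σ u = p) x v := fun hv =>
      hu (hv.step huv.symm (hmem v hv) (hs ▸ hmem v hv))
    simp only [hu, hv, if_false] at he
    exact absurd he (hc.2 u v (by rintro rfl; exact hu hxx) (by rintro rfl; exact hv hxx) huv hs)

theorem MS.P2 {G : SimpleGraph V} {R : Bool → ℕ} (hn : NF G R) {x : V} {σ : V → Bool}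
    (h : MS G R x σ) {p : Bool} (hp : (nb G σ p x).card = R p) (hR : R p = 2)
    {y t : V} (hy : y ∈ nb G σ p x) (ht : t ∈ nb G σ p x) :
    Rch G (fun u => σ u = p ∧ u ≠ x) y t := by
  obtain ⟨⟨c, hc⟩, -⟩ := h
  by_contra hcon
  have hyt : y ≠ t := by
    rintro rfl
    exact hcon ReflTransGen.refl
  have hne : c y ≠ c t := fun he => hyt (hc.inj hn hp hy ht he)
  have hy' := mem_nb.1 hy
  have ht' := mem_nb.1 ht
  have hyx := hy'.1.ne'
  have htx := ht'.1.ne'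
  have hcy := hc.1 y hyx
  have hct := hc.1 t htx
  rw [hy'.2, hR] at hcy
  rw [ht'.2, hR] at hct
  set K := Rch G (fun u => σ u = p ∧ u ≠ x) y with hK
  have hKm : ∀ u, K u → σ u = p ∧ u ≠ x := by
    intro u hu
    exact Rch.mem (S := fun u => σ u = p ∧ u ≠ x) hu ⟨hy'.2, hyx⟩
  have hKc : ∀ u v, K u → G.Adj u v → v ≠ x → σ v = p → K v := by
    intro u v hu huv hvx hv
    exact Rch.step hu huv (hKm u hu) ⟨hv, hvx⟩
  have hg : GC G R x σ (fun u => if K u then 1 - c u else c u) := by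
    constructor
    · intro u hu
      have := hc.1 u hu
      dsimp only
      split_ifs with hk
      · rw [(hKm u hk).1, hR]; omega
      · exact this
    · intro u v hu hv huv hs
      have h0 := hc.2 u v hu hv huv hs
      have h1 := hKm u
      have h2 := hKm v
      have h3 := hKc u v
      have h4 := hKc v u
      have h5 := huv.symm
      have h6 := hc.1 u hu
      have h7 := hc.1 v hv
      dsimp only
      split_ifs with hk hk'
      · rw [(h1 hk).1, hR] at h6
        rw [(h2 hk').1, hR] at h7
        omega
      · exact absurd (h3 hk huv hv (hs ▸ (h1 hk).1)) hk'
      · rename_i hk'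
        exact absurd (h4 hk' h5 hu (hs ▸ (h2 hk').1)) hk
      · exact h0
  apply hyt
  apply hg.inj hn hp hy ht
  have hyy : K y := ReflTransGen.refl
  have htt : ¬ K t := hcon
  simp only [hyy, htt, if_true, if_false]
  omega

theorem MS.clique {G : SimpleGraph V} {R : Bool → ℕ} (hn : NF G R) {x : V} {σ : V → Bool}
    (h : MS G R x σ) {p : Bool} (hx : σ x = p) (hp : (nb G σ p x).card = R p) (hR : 3 ≤ R p)
    {y : V} (hy : Rch G (fun u => σ u = p) x y) (hyx : y ≠ x) : G.Adj x y := by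
  let C : Set V := {v | Rch G (fun u => σ u = p) x v}
  have hxx : x ∈ C := (ReflTransGen.refl : Rch G (fun u => σ u = p) x x)
  have hmem : ∀ u ∈ C, σ u = p := fun u hu =>
    Rch.mem (S := fun u => σ u = p) hu hx
  obtain ⟨c, hc⟩ := h.1
  have := brooks (H := G.induce C) (k := R p) hR (x := ⟨x, hxx⟩) (c := fun u => c u.1) ?_ ?_ ?_ ?_
    ⟨y, hy⟩ (by simpa using hyx)
  · simpa using this
  · intro f hf
    obtain ⟨u, v, hu, hv, huv, he⟩ := h.ncol hn hx (fun u => if hu : u ∈ C then f ⟨u, hu⟩ else 0) (by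
      intro u hu
      have hu : u ∈ C := hu
      simp only [hu, dite_true]
      exact hf _)
    have hu : u ∈ C := hu
    have hv : v ∈ C := hv
    simp only [hu, hv, dite_true] at he
    exact ⟨⟨u, hu⟩, ⟨v, hv⟩, by simpa using huv, he⟩
  · rintro ⟨v, hv⟩
    rw [← (h.comp hn hx hp hv).2.1]
    apply card_bij (fun u _ => u.1)
    · rintro ⟨u, hu⟩ h
      simp only [mem_filter, mem_univ, true_and, SimpleGraph.comap_adj,
        Function.Embedding.subtype_apply] at h
      exact mem_nb.2 ⟨h, hmem u hu⟩
    · intro a _ b _ hab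
      exact Subtype.ext hab
    · intro u hu
      have hu := mem_nb.1 hu
      refine ⟨⟨u, Rch.step hv hu.1 (hmem v hv) hu.2⟩, ?_, rfl⟩
      simpa using hu.1
  · constructor
    · rintro ⟨u, hu⟩ hux
      have := hc.1 u (by simpa using hux)
      rwa [hmem u hu] at this
    · rintro ⟨u, hu⟩ ⟨v, hv⟩ hux hvx huv
      exact hc.2 u v (by simpa using hux) (by simpa using hvx) (by simpa using huv)
        ((hmem u hu).trans (hmem v hv).symm)
  · rintro ⟨v, hv⟩
    have hv' : Rch G (fun u => σ u = p) x v := hv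
    unfold Rch at hv'
    induction hv' with
    | refl => exact ReflTransGen.refl
    | @tail a b hab h2 ih =>
      exact Rch.step (ih hab) (by simpa using h2.1) trivial trivial

end State

section Claim
open Classical

variable {V : Type*} [Fintype V]

/-- low vertices -/
def Low (G : SimpleGraph V) (R : Bool → ℕ) (v : V) : Prop :=
  (univ.filter (fun u => G.Adj v u)).card = R true + R false

/-- the context -/
structure Cx (G : SimpleGraph V) (R : Bool → ℕ) : Prop where
  nf : NF G R
  hT : R true = 2
  hF : 3 ≤ R false
  ind : ∀ u v, G.Adj u v → Low G R u ∨ Low G R v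
  deg : ∀ v, ¬ Low G R v → (univ.filter (fun u => G.Adj v u)).card = R true + R false + 1
  ncl : ∀ s : Finset V, (∀ u ∈ s, ∀ v ∈ s, u ≠ v → G.Adj u v) → s.card ≤ R true + R false
  crit : ∀ x, ∃ c, PC G (R true + R false) x c
  nc : NC G (R true + R false)

theorem exch {G : SimpleGraph V} {σ τ : V → Bool} {p : Bool} {x z v : V}
    (h1 : σ x = p) (h2 : τ x ≠ p) (h3 : σ z ≠ p) (h4 : τ z = p)
    (h5 : ∀ u, u ≠ x → u ≠ z → G.Adj v u → (σ u = p ↔ τ u = p))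
    (hc : (nb G σ p v).card = (nb G τ p v).card) : G.Adj v x ↔ G.Adj v z := by
  have hxz : x ≠ z := by
    rintro rfl
    exact h3 h1
  constructor
  · intro hx
    by_contra hz
    have : nb G τ p v ⊂ nb G σ p v := by
      rw [ssubset_iff_of_subset]
      · exact ⟨x, mem_nb.2 ⟨hx, h1⟩, fun h => h2 (mem_nb.1 h).2⟩
      · intro u hu
        obtain ⟨hu1, hu2⟩ := mem_nb.1 hu
        refine mem_nb.2 ⟨hu1, (h5 u ?_ ?_ hu1).2 hu2⟩
        · rintro rfl; exact h2 hu2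
        · rintro rfl; exact hz hu1
    have := card_lt_card this
    omega
  · intro hz
    by_contra hx
    have : nb G σ p v ⊂ nb G τ p v := by
      rw [ssubset_iff_of_subset]
      · exact ⟨z, mem_nb.2 ⟨hz, h4⟩, fun h => h3 (mem_nb.1 h).2⟩
      · intro u hu
        obtain ⟨hu1, hu2⟩ := mem_nb.1 hu
        refine mem_nb.2 ⟨hu1, (h5 u ?_ ?_ hu1).1 hu2⟩
        · rintro rfl; exact hx hu1
        · rintro rfl; exact h3 hu2
    have := card_lt_card this
    omega

theorem MS.low {G : SimpleGraph V} {R : Bool → ℕ} (hn : NF G R) {x : V} {σ : V → Bool}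
    (h : MS G R x σ) (hx : Low G R x) (p : Bool) : (nb G σ p x).card = R p := by
  obtain ⟨⟨c, hc⟩, -⟩ := h
  have h1 := hc.le hn true
  have h2 := hc.le hn false
  have h3 : (nb G σ true x).card + (nb G σ false x).card = R true + R false := by
    rw [← hx, ← card_union_of_disjoint]
    · congr 1
      ext u
      simp only [mem_union, mem_nb, mem_filter, mem_univ, true_and]
      cases σ u <;> simp
    · rw [disjoint_left]
      intro u hu hu'
      have := (mem_nb.1 hu).2.symm.trans (mem_nb.1 hu').2
      simp at this
  cases p <;> omega

theorem Cx.kminus {G : SimpleGraph V} {R : Bool → ℕ} (C : Cx G R) (L : Finset V)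
    (hL : L.card + 1 = R true + R false) (hlow : ∀ u ∈ L, Low G R u)
    (hcl : ∀ u ∈ L, ∀ v ∈ L, u ≠ v → G.Adj u v) {t h : V} (hth : t ≠ h) (ht : ¬ Low G R t)
    (hh : ¬ Low G R h) (htL : ∀ u ∈ L, G.Adj t u) (hhL : ∀ u ∈ L, G.Adj h u) : False := by
  have hk : 5 ≤ R true + R false := by have := C.hT; have := C.hF; omega
  set k := R true + R false with hkdef
  have htn : t ∉ L := fun h => ht (hlow t h)
  have hhn : h ∉ L := fun h' => hh (hlow h h')
  have hadj : ¬ G.Adj t h := fun hadj => (C.ind t h hadj).elim ht hh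
  have hnbr : ∀ u ∈ L, ∀ v, G.Adj u v → v ∈ L ∨ v = t ∨ v = h := by
    intro u hu v huv
    have hsub : insert t (insert h (L.erase u)) ⊆ univ.filter (fun w => G.Adj u w) := by
      intro w hw
      simp only [mem_insert, mem_erase] at hw
      simp only [mem_filter, mem_univ, true_and]
      rcases hw with rfl | rfl | ⟨h1, h2⟩
      · exact (htL u hu).symm
      · exact (hhL u hu).symm
      · exact hcl u hu w h2 h1.symm
    have hcard : (insert t (insert h (L.erase u))).card = k := by
      rw [card_insert_of_notMem, card_insert_of_notMem, card_erase_of_mem hu]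
      · omega
      · simp [hhn]
      · simp [htn, hth]
    have heq := eq_of_subset_of_card_le hsub (by rw [hcard]; exact (hlow u hu).le)
    have : v ∈ insert t (insert h (L.erase u)) := by rw [heq]; simpa using huv
    simp only [mem_insert, mem_erase] at this
    tauto
  obtain ⟨l0, hl0⟩ : L.Nonempty := by
    rw [← card_pos]; omega
  obtain ⟨c, hc⟩ := C.crit l0
  have hout : ∀ s, ¬ Low G R s → (∀ u ∈ L, G.Adj s u) →
      ((univ.filter (fun u => G.Adj s u)) \ L).card = 2 := by
    intro s hs hsL
    rw [card_sdiff_of_subset, C.deg s hs]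
    · omega
    · intro u hu; simpa using hsL u hu
  obtain ⟨e, hek, he⟩ : ∃ e, e < k ∧ ∀ s, (s = t ∨ s = h) → ∀ u, G.Adj s u → u ∉ L → c u ≠ e := by
    set F := (((univ.filter (fun u => G.Adj t u)) \ L) ∪ ((univ.filter (fun u => G.Adj h u)) \ L)).image c
      with hF
    have hFc : F.card ≤ 4 := by
      refine card_image_le.trans ((card_union_le _ _).trans ?_)
      rw [hout t ht htL, hout h hh hhL]
    obtain ⟨e, he1, he2⟩ : ∃ e ∈ range k, e ∉ F := by
      by_contra hcon
      push Not at hcon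
      have := card_le_card (show range k ⊆ F from hcon)
      rw [card_range] at this
      omega
    refine ⟨e, mem_range.1 he1, ?_⟩
    rintro s hs u hu huL rfl
    apply he2
    rw [hF, mem_image]
    refine ⟨u, ?_, rfl⟩
    simp only [mem_union, mem_sdiff, mem_filter, mem_univ, true_and]
    rcases hs with rfl | rfl
    · exact Or.inl ⟨hu, huL⟩
    · exact Or.inr ⟨hu, huL⟩
  have hce : L.card = ((range k).erase e).card := by
    rw [card_erase_of_mem (mem_range.2 hek), card_range]; omega
  let f := Finset.equivOfCardEq hce
  have hf : ∀ u (hu : u ∈ L), (f ⟨u, hu⟩).1 < k ∧ (f ⟨u, hu⟩).1 ≠ e := by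
    intro u hu
    have := (f ⟨u, hu⟩).2
    rw [mem_erase, mem_range] at this
    exact ⟨this.2, this.1⟩
  have hl : ∀ u, u ∉ L → u ≠ l0 := by
    rintro u hu rfl; exact hu hl0
  obtain ⟨u, v, huv, heq⟩ := C.nc
    (fun u => if hu : u ∈ L then (f ⟨u, hu⟩).1 else if u = t ∨ u = h then e else c u) (by
      intro u
      split_ifs with h1 h2
      · exact (hf u h1).1
      · exact hek
      · exact hc.1 u (hl u h1))
  have gen : ∀ u v, G.Adj u v → u ∈ L → v ∉ L → v = t ∨ v = h := by
    intro u v huv hu hv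
    have := hnbr u hu v huv
    tauto
  by_cases hu : u ∈ L
  · by_cases hv : v ∈ L
    · rw [dif_pos hu, dif_pos hv] at heq
      have := f.injective (Subtype.ext heq)
      exact huv.ne (by simpa using this)
    · rw [dif_pos hu, dif_neg hv, if_pos (gen u v huv hu hv)] at heq
      exact (hf u hu).2 heq
  · by_cases hv : v ∈ L
    · rw [dif_pos hv, dif_neg hu, if_pos (gen v u huv.symm hv hu)] at heq
      exact (hf v hv).2 heq.symm
    · rw [dif_neg hu, dif_neg hv] at heq
      by_cases hut : u = t ∨ u = h
      · by_cases hvt : v = t ∨ v = h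
        · rcases hut with rfl | rfl <;> rcases hvt with rfl | rfl
          · exact huv.ne rfl
          · exact hadj huv
          · exact hadj huv.symm
          · exact huv.ne rfl
        · rw [if_pos hut, if_neg hvt] at heq
          exact he u hut v huv hv heq.symm
      · by_cases hvt : v = t ∨ v = h
        · rw [if_pos hvt, if_neg hut] at heq
          exact he v hvt u huv.symm hu heq
        · rw [if_neg hut, if_neg hvt] at heq
          exact hc.2 u v (hl u hu) (hl v hv) huv heq

theorem Cx.c1b {G : SimpleGraph V} {R : Bool → ℕ} (C : Cx G R) {x : V} {σ : V → Bool}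
    (h : MS G R x σ) (hx : Low G R x) {y z : V} 
    (hy : Rch G (fun u => Function.update σ x true u = true) x y) (hyx : y ≠ x)
    (hz : z ∈ nb G σ false x) (hzl : Low G R z) (hyz : G.Adj y z) :
    y ∈ nb G σ true x ∧ ∀ t ∈ nb G σ true x, G.Adj t z := by
  have hn := C.nf
  have hz' := mem_nb.1 hz
  have hzx := hz'.1.ne'
  have hxz := hz'.1.ne
  have hT := h.upd true
  have hF := h.upd false
  set σT := Function.update σ x true with hσT
  set σF := Function.update σ x false with hσF
  have hTx : σT x = true := by simp [hσT]
  have hFx : σF x = false := by simp [hσF]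
  have hzF : σF z = false := by simp [hσF, hzx, hz'.2]
  have hMz := (hF.slide hn hFx (hF.low hn hx false) (mem_nb.2 ⟨hz'.1, hzF⟩)).1
  have hMz' := hMz.upd true
  set τ := Function.update σF z true with hτ
  have hτz : τ z = true := by simp [hτ]
  have hτx : τ x = false := by simp [hτ, hxz, hFx]
  have hTz : σT z = false := by simp [hσT, hzx, hz'.2]
  have hagree : ∀ u, u ≠ x → u ≠ z → (σT u = true ↔ τ u = true) := by
    intro u h1 h2
    simp [hσT, hτ, hσF, h1, h2]
  have hcy := hT.comp hn hTx (hT.low hn hx true) hy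
  have hyne : y ≠ z := hyz.ne
  have hyτ : τ y = true := (hagree y hyx hyne).1 hcy.2.2
  have hsy := hMz'.slide hn hτz (hMz'.low hn hzl true) (mem_nb.2 ⟨hyz.symm, hyτ⟩)
  have hxy : G.Adj y x := by
    refine (exch (G := G) (σ := σT) (τ := τ) (p := true) (x := x) (z := z) (v := y) hTx
      (by simp [hτx]) (by simp [hTz]) hτz (fun u h1 h2 _ => hagree u h1 h2) ?_).2 hyz
    rw [hcy.2.1, hsy.2]
  have hσy : σ y = true := by simpa [hσT, hyx] using hcy.2.2
  refine ⟨mem_nb.2 ⟨hxy.symm, hσy⟩, ?_⟩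
  intro t ht
  have ht' := mem_nb.1 ht
  have hp2 := h.P2 hn (h.low hn hx true) C.hT (mem_nb.2 ⟨hxy.symm, hσy⟩) ht
  have hzt : Rch G (fun u => τ u = true) z t := by
    refine Rch.trans (ReflTransGen.single ⟨hyz.symm, hτz, hyτ⟩) (hp2.mono ?_)
    rintro u ⟨h1, h2⟩
    by_cases huz : u = z
    · rw [huz]; exact hτz
    · simp [hτ, hσF, h2, huz, h1]
  have hct := hMz'.comp hn hτz (hMz'.low hn hzl true) hzt
  have hct2 := hT.slide hn hTx (hT.low hn hx true) (y := t)
    (mem_nb.2 ⟨ht'.1, by simp [hσT, ht'.1.ne', ht'.2]⟩)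
  refine (exch (G := G) (σ := σT) (τ := τ) (p := true) (x := x) (z := z) (v := t) hTx
      (by simp [hτx]) (by simp [hTz]) hτz (fun u h1 h2 _ => hagree u h1 h2) ?_).1 ht'.1.symm
  rw [hct2.2, hct.2.1]

theorem Cx.fclique {G : SimpleGraph V} {R : Bool → ℕ} (C : Cx G R) {x : V} {σ : V → Bool}
    (h : MS G R x σ) (hx : Low G R x) {d e : V} (hd : d ∈ nb G σ false x)
    (he : e ∈ nb G σ false x) (hde : d ≠ e) : G.Adj d e := by
  have hn := C.nf
  have hd' := mem_nb.1 hd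
  have he' := mem_nb.1 he
  have hF := h.upd false
  set σF := Function.update σ x false with hσF
  have hFx : σF x = false := by simp [hσF]
  have hdF : σF d = false := by simp [hσF, hd'.1.ne', hd'.2]
  have heF : σF e = false := by simp [hσF, he'.1.ne', he'.2]
  have := hF.slide hn hFx (hF.low hn hx false) (mem_nb.2 ⟨hd'.1, hdF⟩)
  refine this.1.clique hn hdF this.2 C.hF ?_ hde.symm
  exact Rch.step (ReflTransGen.single ⟨hd'.1.symm, hdF, hFx⟩) he'.1 hFx heF

theorem Cx.c1c {G : SimpleGraph V} {R : Bool → ℕ} (C : Cx G R) {x : V} {σ : V → Bool}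
    (h : MS G R x σ) (hx : Low G R x) {y z : V} 
    (hy : Rch G (fun u => Function.update σ x true u = true) x y) (hyx : y ≠ x)
    (hyl : Low G R y)
    (hz : z ∈ nb G σ false x) (hyz : G.Adj y z) :
    ∀ d ∈ nb G σ false x, G.Adj y d := by
  intro d hd
  by_cases hdz : d = z
  · rw [hdz]; exact hyz
  have hn := C.nf
  have hT := h.upd true
  have hTx : Function.update σ x true x = true := by simp
  have hcy := hT.comp hn hTx (hT.low hn hx true) hy
  have hM := hcy.1.upd false
  have hsy : σ y = true := by simpa [hyx] using hcy.2.2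
  set ρ := Function.update (Function.update σ x true) y false with hρ
  have hρd : ∀ d ∈ nb G σ false x, ρ d = false ∧ d ≠ y := by
    intro d hd
    obtain ⟨h1, h2⟩ := mem_nb.1 hd
    have : d ≠ y := by
      rintro rfl
      simp [hsy] at h2
    exact ⟨by simp [hρ, this, h1.ne', h2], this⟩
  have hρy : ρ y = false := by simp [hρ]
  refine hM.clique hn hρy (hM.low hn hyl false) C.hF ?_ (hρd d hd).2
  exact Rch.step (ReflTransGen.single ⟨hyz, hρy, (hρd z hz).1⟩)
    (C.fclique h hx hz hd (Ne.symm hdz)) (hρd z hz).1 (hρd d hd).1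

theorem Cx.claim1 {G : SimpleGraph V} {R : Bool → ℕ} (C : Cx G R) {x : V} {σ : V → Bool}
    (h : MS G R x σ) (hx : Low G R x) {y z : V} 
    (hy : Rch G (fun u => Function.update σ x true u = true) x y) (hyx : y ≠ x)
    (hyl : Low G R y)
    (hz : z ∈ nb G σ false x) (hzl : Low G R z) (hyz : G.Adj y z) : False := by
  have hn := C.nf
  have hT := h.upd true
  have hTx : Function.update σ x true x = true := by simp
  obtain ⟨hynb, hall⟩ := C.c1b h hx hy hyx hz hzl hyz
  have hynb' := mem_nb.1 hynb
  have hyD := C.c1c h hx hy hyx hyl hz hyz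
  have hz' := mem_nb.1 hz
  have hcy := hT.comp hn hTx (hT.low hn hx true) hy
  have hcardT := h.low hn hx true
  rw [C.hT] at hcardT
  -- t
  obtain ⟨t, ht, hty⟩ : ∃ t ∈ nb G σ true x, t ≠ y :=
    exists_mem_ne (by omega) y
  have ht' := mem_nb.1 ht
  have htR : Rch G (fun u => Function.update σ x true u = true) x t :=
    ReflTransGen.single ⟨ht'.1, hTx, by simp [ht'.1.ne', ht'.2]⟩
  have htz := hall t ht
  -- the other neighbour of y
  have htyadj : G.Adj t y := by
    have hcy2 := hcy.2.1
    rw [C.hT] at hcy2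
    obtain ⟨y', hy', hy'x⟩ : ∃ t ∈ nb G (Function.update σ x true) true y, t ≠ x :=
      exists_mem_ne (by omega) x
    have hy'' := mem_nb.1 hy'
    have hzσ : Function.update σ x true z = false := by simp [hz'.1.ne', hz'.2]
    have hupd : Function.update (Function.update σ x true) y true = Function.update σ x true := by
      rw [Function.update_eq_self_iff]; exact hcy.2.2.symm
    have := (C.c1b hcy.1 hyl (y := x) (z := z) (by
        rw [hupd]
        exact hy.symm) hyx.symm
      (mem_nb.2 ⟨hyz, hzσ⟩) hzl hz'.1).2 y' hy'
    -- z has only two neighbours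
    have hF := h.upd false
    have hFx : Function.update σ x false x = false := by simp
    have hzF : Function.update σ x false z = false := by simp [hz'.1.ne', hz'.2]
    have hMz := (hF.slide hn hFx (hF.low hn hx false) (mem_nb.2 ⟨hz'.1, hzF⟩)).1
    have hcz := hMz.low hn hzl true
    rw [C.hT] at hcz
    by_contra hcon
    have hy't : y' ≠ t := by
      rintro rfl
      exact hcon hy''.1.symm
    have hsub : ({y, t, y'} : Finset V) ⊆ nb G (Function.update σ x false) true z := by
      intro u hu
      simp only [mem_insert, mem_singleton] at hu
      rcases hu with rfl | rfl | rfl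
      · exact mem_nb.2 ⟨hyz.symm, by simp [hyx, hynb'.2]⟩
      · exact mem_nb.2 ⟨htz.symm, by simp [ht'.1.ne', ht'.2]⟩
      · exact mem_nb.2 ⟨this.symm, by simpa [hy'x] using hy''.2⟩
    have h3 := card_le_card hsub
    rw [hcz, card_insert_of_notMem, card_insert_of_notMem, card_singleton] at h3
    · omega
    · simpa using hy't.symm
    · simp [hty.symm, hy''.1.ne]
  set D := insert x (nb G σ false x) with hD
  have hDcard : D.card = R false + 1 := by
    rw [hD, card_insert_of_notMem, h.low hn hx false]
    intro hh
    exact (mem_nb.1 hh).1.ne rfl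
  have hDcl : ∀ u ∈ D, ∀ v ∈ D, u ≠ v → G.Adj u v := by
    intro u hu v hv huv
    rw [hD, mem_insert] at hu hv
    rcases hu with rfl | hu <;> rcases hv with rfl | hv
    · exact absurd rfl huv
    · exact (mem_nb.1 hv).1
    · exact (mem_nb.1 hu).1.symm
    · exact C.fclique h hx hu hv huv
  have hyD' : ∀ u ∈ D, G.Adj y u := by
    intro u hu
    rw [hD, mem_insert] at hu
    rcases hu with rfl | hu
    · exact hynb'.1.symm
    · exact hyD u hu
  have hyn : y ∉ D := fun hh => (hyD' y hh).ne rfl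
  have htlow : ∀ u ∈ D, Low G R u → G.Adj t u := by
    intro u hu hul
    rw [hD, mem_insert] at hu
    rcases hu with rfl | hu
    · exact ht'.1.symm
    · exact (C.c1b h hx hy hyx hu hul (hyD u hu)).2 t ht
  have hnt : ¬ ∀ u ∈ D, G.Adj t u := by
    intro htD
    have htn : t ∉ D := fun hh => (htD t hh).ne rfl
    have := C.ncl (insert t (insert y D)) (by
      intro u hu v hv huv
      rw [mem_insert, mem_insert] at hu hv
      rcases hu with rfl | rfl | hu <;> rcases hv with rfl | rfl | hv
      · exact absurd rfl huv
      · exact htyadj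
      · exact htD _ hv
      · exact htyadj.symm
      · exact absurd rfl huv
      · exact hyD' _ hv
      · exact (htD _ hu).symm
      · exact (hyD' _ hu).symm
      · exact hDcl _ hu _ hv huv)
    rw [card_insert_of_notMem, card_insert_of_notMem hyn, hDcard, C.hT] at this
    · omega
    · rw [mem_insert]
      rintro (h | h)
      · exact hty h
      · exact htn h
  have htl : ¬ Low G R t := by
    intro htl
    apply hnt
    intro u hu
    rw [hD, mem_insert] at hu
    rcases hu with rfl | hu
    · exact ht'.1.symm
    · exact C.c1c h hx htR ht'.1.ne' htl hz htz u hu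
  push Not at hnt
  obtain ⟨w, hw, hwt⟩ := hnt
  have hwl : ¬ Low G R w := fun hl => hwt (htlow w hw hl)
  have hDlow : ∀ u ∈ D, u ≠ w → Low G R u := by
    intro u hu huw
    exact (C.ind u w (hDcl u hu w hw huw)).resolve_right hwl
  refine C.kminus (insert y (D.erase w)) ?_ ?_ ?_ (t := t) (h := w) ?_ htl hwl ?_ ?_
  · rw [card_insert_of_notMem, card_erase_of_mem hw, hDcard, C.hT]
    · omega
    · simp [hyn]
  · intro u hu
    rw [mem_insert, mem_erase] at hu
    rcases hu with rfl | ⟨h1, h2⟩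
    · exact hyl
    · exact hDlow u h2 h1
  · intro u hu v hv huv
    rw [mem_insert, mem_erase] at hu hv
    rcases hu with rfl | ⟨_, hu⟩ <;> rcases hv with rfl | ⟨_, hv⟩
    · exact absurd rfl huv
    · exact hyD' _ hv
    · exact (hyD' _ hu).symm
    · exact hDcl _ hu _ hv huv
  · rintro rfl
    rw [hD, mem_insert] at hw
    rcases hw with rfl | hw
    · exact ht'.1.ne rfl
    · have := (mem_nb.1 hw).2
      simp [ht'.2] at this
  · intro u hu
    rw [mem_insert, mem_erase] at hu
    rcases hu with rfl | ⟨h1, h2⟩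
    · exact htyadj
    · exact htlow u h2 (hDlow u h2 h1)
  · intro u hu
    rw [mem_insert, mem_erase] at hu
    rcases hu with rfl | ⟨h1, h2⟩
    · exact (hyD' w hw).symm
    · exact hDcl w hw u h2 h1.symm

end Claim

section Walk
open Classical

variable {V : Type*} [Fintype V]

theorem Cx.two_le {G : SimpleGraph V} {R : Bool → ℕ} (C : Cx G R) (p : Bool) : 2 ≤ R p := by
  have := C.hT
  have := C.hF
  cases p <;> omega

theorem Cx.pick {G : SimpleGraph V} {R : Bool → ℕ} (C : Cx G R) {x : V} {σ : V → Bool}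
    (h : MS G R x σ) {p : Bool} (hx : σ x = p) :
    ∃ x' w, Rch G (fun u => σ u = p) x x' ∧ Rch G (fun u => σ u = p) x w ∧ Low G R x' ∧
      Low G R w ∧ G.Adj x' w ∧ x' ≠ x := by
  have h2 := C.two_le p
  obtain ⟨u, v, hu, hv, huv, he⟩ := h.ncol C.nf hx (fun u => if Low G R u then 0 else 1) (by
    intro u _
    split_ifs <;> omega)
  have hi := C.ind u v huv
  have hl : Low G R u ∧ Low G R v := by
    by_cases h1 : Low G R u <;> by_cases h2 : Low G R v <;> simp_all
  by_cases hux : u = x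
  · refine ⟨v, u, hv, hu, hl.2, hl.1, huv.symm, ?_⟩
    rintro rfl
    exact huv.ne hux
  · exact ⟨u, v, hu, hv, hl.1, hl.2, huv, hux⟩

theorem Cx.seq {G : SimpleGraph V} {R : Bool → ℕ} (C : Cx G R) {x0 : V} {σ0 : V → Bool}
    (h0 : MS G R x0 σ0) (hl : Low G R x0) :
    ∃ (x : ℕ → V) (σ : ℕ → V → Bool) (w : ℕ → V) (p : ℕ → Bool), ∀ n,
      MS G R (x n) (σ n) ∧ Low G R (x n) ∧ σ n (x n) = p n ∧ p (n + 1) = !(p n) ∧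
      Rch G (fun u => σ n u = p n) (x n) (x (n + 1)) ∧ x (n + 1) ≠ x n ∧
      Rch G (fun u => σ n u = p n) (x n) (w n) ∧ Low G R (w n) ∧ G.Adj (x (n + 1)) (w n) ∧
      σ (n + 1) = Function.update (σ n) (x (n + 1)) (!(p n)) := by
  let St := {s : V × (V → Bool) // MS G R s.1 s.2 ∧ Low G R s.1}
  have step : ∀ s : St, ∃ s' : St, ∃ w, 
      Rch G (fun u => s.1.2 u = s.1.2 s.1.1) s.1.1 s'.1.1 ∧ s'.1.1 ≠ s.1.1 ∧
      Rch G (fun u => s.1.2 u = s.1.2 s.1.1) s.1.1 w ∧ Low G R w ∧ G.Adj s'.1.1 w ∧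
      s'.1.2 = Function.update s.1.2 s'.1.1 (!(s.1.2 s.1.1)) := by
    rintro ⟨⟨x, σ⟩, h, hl⟩
    obtain ⟨x', w, h1, h2, h3, h4, h5, h6⟩ := C.pick h rfl
    have := h.comp C.nf rfl (h.low C.nf hl _) h1
    exact ⟨⟨⟨x', Function.update σ x' (!(σ x))⟩, this.1.upd _, h3⟩, w, h1, h6, h2, h4, h5, rfl⟩
  choose nx w hw using step
  let s : ℕ → St := fun n => Nat.rec ⟨⟨x0, σ0⟩, h0, hl⟩ (fun _ s => nx s) n
  refine ⟨fun n => (s n).1.1, fun n => (s n).1.2, fun n => w (s n), 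
    fun n => (s n).1.2 (s n).1.1, ?_⟩
  intro n
  have hs : s (n + 1) = nx (s n) := rfl
  obtain ⟨h1, h2, h3, h4, h5, h6⟩ := hw (s n)
  refine ⟨(s n).2.1, (s n).2.2, rfl, ?_, ?_, ?_, h3, h4, ?_, ?_⟩
  · simp only [hs]
    rw [h6]; simp
  · simp only [hs]; exact h1
  · simp only [hs]; exact h2
  · simp only [hs]; exact h5
  · simp only [hs]; exact h6

theorem Cx.conn {G : SimpleGraph V} {R : Bool → ℕ} (C : Cx G R) {v : V} {σ : V → Bool}
    (h : MS G R v σ) {p : Bool} (hv : σ v = p) (hp : (nb G σ p v).card = R p) {u w : V}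
    (hu : Rch G (fun u => σ u = p) v u) (huv : u ≠ v) (hw : w ∈ nb G σ p v) :
    Rch G (fun u => σ u = p ∧ u ≠ v) w u := by
  obtain ⟨u0, h1, h2, h3⟩ := hu.avoid huv.symm
  refine Rch.trans ?_ h3
  have hu0 : u0 ∈ nb G σ p v := mem_nb.2 ⟨h1, h2⟩
  have hw' := mem_nb.1 hw
  cases p with
  | true => exact h.P2 C.nf hp C.hT hw hu0
  | false =>
    by_cases he : w = u0
    · rw [he]; exact ReflTransGen.refl
    · have hs := h.slide C.nf hv hp hw
      refine ReflTransGen.single ⟨?_, ⟨hw'.2, hw'.1.ne'⟩, ⟨h2, h1.ne'⟩⟩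
      refine hs.1.clique C.nf hw'.2 hs.2 C.hF ?_ (Ne.symm he)
      exact Rch.step (ReflTransGen.single ⟨hw'.1.symm, hw'.2, hv⟩) h1 hv h2

theorem Cx.claim1' {G : SimpleGraph V} {R : Bool → ℕ} (C : Cx G R) {w : V} {σ : V → Bool}
    (h : MS G R w σ) (hl : Low G R w) {p : Bool} (hw : σ w = p) {y z : V}
    (hy : Rch G (fun u => σ u = p) w y) (hyw : y ≠ w) (hyl : Low G R y)
    (hz : G.Adj w z) (hzp : σ z = !p) (hzl : Low G R z) (hyz : G.Adj y z) : False := by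
  cases p with
  | true =>
    have hupd : Function.update σ w true = σ := by
      rw [Function.update_eq_self_iff]; exact hw.symm
    exact C.claim1 h hl (y := y) (z := z) (by rw [hupd]; exact hy) hyw hyl
      (mem_nb.2 ⟨hz, by simpa using hzp⟩) hzl hyz
  | false =>
    have hadj := h.clique C.nf hw (h.low C.nf hl _) C.hF hy hyw
    have hyp := (h.comp C.nf hw (h.low C.nf hl _) hy).2.2
    refine C.claim1 h hl (y := z) (z := y) ?_ hz.ne' hzl (mem_nb.2 ⟨hadj, hyp⟩) hyl hyz.symm
    exact ReflTransGen.single ⟨hz, by simp, by simpa [hz.ne'] using hzp⟩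

theorem Cx.nowalk {G : SimpleGraph V} {R : Bool → ℕ} (C : Cx G R) 
    (x : ℕ → V) (σ : ℕ → V → Bool) (w : ℕ → V) (p : ℕ → Bool) (H : ∀ n,
      MS G R (x n) (σ n) ∧ Low G R (x n) ∧ σ n (x n) = p n ∧ p (n + 1) = !(p n) ∧
      Rch G (fun u => σ n u = p n) (x n) (x (n + 1)) ∧ x (n + 1) ≠ x n ∧
      Rch G (fun u => σ n u = p n) (x n) (w n) ∧ Low G R (w n) ∧ G.Adj (x (n + 1)) (w n) ∧
      σ (n + 1) = Function.update (σ n) (x (n + 1)) (!(p n))) : False := by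
  have hn := C.nf
  set D : ℕ → V → Prop := fun n v => Rch G (fun u => σ n u = p n) (x n) v with hD
  have hMS := fun n => (H n).1
  have hlow := fun n => (H n).2.1
  have hsx := fun n => (H n).2.2.1
  have hpn := fun n => (H n).2.2.2.1
  have hxD : ∀ n, D n (x (n + 1)) := fun n => (H n).2.2.2.2.1
  have hxx := fun n => (H n).2.2.2.2.2.1
  have hDx : ∀ n, D n (x n) := fun n => ReflTransGen.refl
  have hcomp : ∀ n v, D n v → MS G R v (σ n) ∧ (nb G (σ n) (p n) v).card = R (p n) ∧
      σ n v = p n := fun n v hv =>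
    (hMS n).comp hn (hsx n) ((hMS n).low hn (hlow n) _) hv
  have hstep : ∀ n u v, D n u → G.Adj u v → σ n v = p n → D n v := fun n u v hu huv hv =>
    Rch.step hu huv (hcomp n u hu).2.2 hv
  have hex : ∃ j, ∃ i, i < j ∧ ∃ u, D j u ∧ u ≠ x j ∧ D i u := by
    obtain ⟨a, b, hab, he⟩ := Finite.exists_ne_map_eq_of_infinite (fun n => x (n + 1))
    rcases lt_or_gt_of_ne hab with h | h
    · exact ⟨b, a, h, x (b + 1), hxD b, hxx b, he ▸ hxD a⟩
    · exact ⟨a, b, h, x (a + 1), hxD a, hxx a, he ▸ hxD b⟩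
  obtain ⟨i', hi'j, u, huj, hux, hui'⟩ := Nat.find_spec hex
  have hmin := fun m => Nat.find_min hex (m := m)
  set j := Nat.find hex with hj
  have fr : ∀ m, m < j → ∀ l, l < m → ∀ u, D m u → u ≠ x m → ¬ D l u := by
    intro m hm l hl u h1 h2 h3
    exact hmin m hm ⟨l, hl, u, h1, h2, h3⟩
  have xnot : ∀ l m, l < m → m < j → ¬ D l (x (m + 1)) := fun l m hl hm =>
    fr m hm l hl _ (hxD m) (hxx m)
  have xne : ∀ l m, l < m → m ≤ j → x m ≠ x l := by
    intro l m hl hm he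
    obtain ⟨m, rfl⟩ : ∃ m', m = m' + 1 := ⟨m - 1, by omega⟩
    by_cases hlm : l = m
    · subst hlm; exact hxx l he
    · exact xnot l m (by omega) (by omega) (he ▸ hDx l)
  have sig : ∀ i n v, i ≤ n → (∀ m, i < m → m ≤ n → v ≠ x m) → σ n v = σ i v := by
    intro i n v hin
    induction n, hin using Nat.le_induction with
    | base => intro _; rfl
    | succ n hin ih =>
      intro hv
      rw [(H n).2.2.2.2.2.2.2.2.2, Function.update_of_ne (hv (n + 1) (by omega) le_rfl)]
      exact ih (fun m h1 h2 => hv m h1 (by omega))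
  have sigx : ∀ l n, l ≤ n → n ≤ j → σ n (x l) = p l := by
    intro l n h1 h2
    rw [sig l n _ h1 (fun m h3 h4 => (xne l m h3 (by omega)).symm), hsx]
  have sigb : ∀ i m, i ≤ m → m < j → σ i (x (m + 1)) = p m := by
    intro i m h1 h2
    rw [← sig i m _ h1 (fun l h3 h4 => xne l (m + 1) (by omega) (by omega))]
    exact (hcomp m _ (hxD m)).2.2
  -- maximal i
  obtain ⟨i, hij, hui, himax⟩ : ∃ i, i < j ∧ D i u ∧ ∀ l, i < l → l < j → ¬ D l u := by
    obtain ⟨i, hi, hmax⟩ := Finset.exists_max_image ((range j).filter (fun l => D l u)) id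
      ⟨i', by simp [hi'j, hui']⟩
    simp only [mem_filter, mem_range] at hi hmax
    refine ⟨i, hi.1, hi.2, ?_⟩
    intro l h1 h2 h3
    have := hmax l ⟨h2, h3⟩
    simp only [id] at this
    omega
  have hpij : p j = p i := by
    rw [← (hcomp j u huj).2.2, ← (hcomp i u hui).2.2]
    apply sig i j u hij.le
    intro m h1 h2 he
    by_cases hm : m = j
    · exact hux (hm ▸ he)
    · exact himax m h1 (by omega) (he ▸ hDx m)
  have hpi1 := hpn i
  have hij1 : i + 1 < j := by
    rcases Nat.lt_or_ge (i + 1) j with h | h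
    · exact h
    · exfalso
      have : j = i + 1 := by omega
      rw [this, hpi1] at hpij
      cases hh : p i <;> simp [hh] at hpij
  have hu1 : u ≠ x (i + 1) := by
    rintro rfl
    exact himax (i + 1) (by omega) hij1 (hDx _)
  have stay : ∀ v n, D i v → v ≠ x (i + 1) → i ≤ n → n ≤ j → σ n v = p i := by
    intro v n hv hvx h1 h2
    rw [sig i n v h1, (hcomp i v hv).2.2]
    intro m h3 h4
    obtain ⟨m, rfl⟩ : ∃ m', m = m' + 1 := ⟨m - 1, by omega⟩
    by_cases hm : m = i
    · subst hm; exact hvx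
    · rintro rfl
      exact xnot i m (by omega) (by omega) hv
  have f4 : ∀ v a, v ≠ x j → σ j v = p i → D i a → a ≠ x (i + 1) → G.Adj a v → D i v := by
    intro v a hvj hv ha hax hav
    by_cases hm : ∃ m, i < m ∧ m ≤ j ∧ v = x m
    · obtain ⟨l, h1, h2, rfl⟩ := hm
      by_cases hl1 : l = i + 1
      · subst hl1; exact hxD i
      have hlj : l < j := by
        refine lt_of_le_of_ne h2 ?_
        rintro rfl
        exact hvj rfl
      have hpl : p l = p i := by rw [← hv, sigx l j h2 le_rfl]
      have hal : D l a := hstep l (x l) a (hDx l) hav.symm (by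
        rw [hpl]; exact stay a l ha hax h1.le h2)
      by_cases hal' : a = x l
      · rw [← hal']; exact ha
      · exact absurd ha (fr l hlj i h1 a hal hal')
    · push Not at hm
      refine hstep i a v ha hav ?_
      rw [← sig i j v hij.le hm, hv]
  have hx1 := hcomp i _ (hxD i)
  obtain ⟨j', hj'⟩ : ∃ j', j = j' + 1 := ⟨j - 1, by omega⟩
  have hpj' : p j' = !(p i) := by
    rw [← hpij, hj', hpn j']; simp
  have hxjσ : σ i (x j) = !(p i) := by
    rw [hj', sigb i j' (by omega) (by omega), hpj']
  have hadj : ∀ a ∈ nb G (σ i) (p i) (x (i + 1)), G.Adj a (x j) ∧ D i a ∧ a ≠ x (i + 1) := by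
    intro a ha
    have ha' := mem_nb.1 ha
    have hDa : D i a := hstep i _ a (hxD i) ha'.1 ha'.2
    have hax := ha'.1.ne'
    refine ⟨?_, hDa, hax⟩
    have hR := C.conn hx1.1 hx1.2.2 hx1.2.1 (u := u) (Rch.trans (Rch.symm (hxD i)) hui) hu1 ha
    have hc := (Rch.carry (T := fun t => D i t ∧ t ≠ x (i + 1)) hR ⟨hDa, hax⟩ (by
      rintro s t ⟨h1, h2⟩ - ⟨h3, h4⟩ h5
      exact ⟨hstep i s t h1 h5 h3, h4⟩)).1
    have hDja : D j a := Rch.trans huj (Rch.symm (hc.mono (by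
      rintro t ⟨h1, h2⟩
      rw [stay t j h1 h2 hij.le le_rfl, hpij])))
    refine (exch (G := G) (σ := σ i) (τ := σ j) (p := p i) (x := x (i + 1)) (z := x j) (v := a)
      hx1.2.2 ?_ ?_ ?_ ?_ ?_).1 ha'.1.symm
    · rw [sigx (i + 1) j hij1.le le_rfl, hpi1]; simp
    · rw [hxjσ]; simp
    · rw [hsx, hpij]
    · intro v h1 h2 h3
      constructor
      · intro h4
        exact stay v j (hstep i a v hDa h3 h4) h1 hij.le le_rfl
      · intro h4
        exact (hcomp i v (f4 v a h2 h4 hDa hax h3)).2.2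
    · rw [(hcomp i a hDa).2.1, ← hpij, (hcomp j a hDja).2.1]
  have hwD : D i (w i) := (H i).2.2.2.2.2.2.1
  have hwl := (H i).2.2.2.2.2.2.2.1
  have hwx := (H i).2.2.2.2.2.2.2.2.1
  have hwc := hcomp i _ hwD
  have hwnb : w i ∈ nb G (σ i) (p i) (x (i + 1)) := mem_nb.2 ⟨hwx, hwc.2.2⟩
  have hwj := (hadj _ hwnb).1
  have fin : ∀ y, D i y → y ≠ w i → Low G R y → G.Adj y (x j) → False := by
    intro y h1 h2 h3 h4
    exact C.claim1' hwc.1 hwl hwc.2.2 (Rch.trans (Rch.symm hwD) h1) h2 h3 hwj hxjσ (hlow j) h4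
  have hc2 := C.two_le (p i)
  obtain ⟨w', hw', hww'⟩ : ∃ t ∈ nb G (σ i) (p i) (x (i + 1)), t ≠ w i :=
    exists_mem_ne (by rw [hx1.2.1]; omega) _
  have aw' := hadj w' hw'
  by_cases hw'l : Low G R w'
  · exact fin w' aw'.2.1 hww' hw'l aw'.1
  cases hpi : p i with
  | false =>
    have hR := C.hF
    obtain ⟨t, ht⟩ : ((nb G (σ i) (p i) (x (i + 1))) \ {w i, w'}).Nonempty := by
      rw [← card_pos]
      have h1 := le_card_sdiff ({w i, w'} : Finset V) (nb G (σ i) (p i) (x (i + 1)))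
      have h2 : ({w i, w'} : Finset V).card ≤ 2 := card_le_two
      rw [hx1.2.1, hpi] at h1
      rw [hpi]
      omega
    simp only [mem_sdiff, mem_insert, mem_singleton, not_or] at ht
    obtain ⟨ht1, ht2, ht3⟩ := ht
    have at' := hadj t ht1
    have hct := hcomp i t at'.2.1
    have htw : G.Adj t w' := hct.1.clique hn hct.2.2 hct.2.1 (by rw [hpi]; exact hR)
      (Rch.trans (Rch.symm at'.2.1) aw'.2.1) (Ne.symm ht3)
    have htl := (C.ind t w' htw).resolve_right hw'l
    exact fin t at'.2.1 ht2 htl at'.1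
  | true =>
    have hpj'f : p j' = false := by rw [hpj', hpi]; rfl
    have hj'c : G.Adj (x j') (x j) := by
      rw [hj']
      exact (hMS j').clique hn (hsx j') ((hMS j').low hn (hlow j') _)
        (by rw [hpj'f]; exact C.hF) (hxD j') (hxx j')
    by_cases hji : j' = i + 1
    · subst hji
      exact fin _ (hxD i) hwx.ne (hlow _) hj'c
    · obtain ⟨m, hm⟩ : ∃ m, j' = m + 1 := ⟨j' - 1, by omega⟩
      have hxm : ¬ D i (x j') := by
        rw [hm]; exact xnot i m (by omega) (by omega)
      have hpm : p m = true := by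
        have := hpn m
        rw [← hm, hpj'f] at this
        cases hh : p m <;> simp [hh] at this ⊢
      have hσm : σ i (x j') = true := by
        rw [hm, sigb i m (by omega) (by omega), hpm]
      have hMw := hwc.1.upd false
      set τ := Function.update (σ i) (w i) false with hτ
      have hτw : τ (w i) = false := by simp [hτ]
      have hxjw : x j ≠ w i := hwj.ne'
      have hτj : τ (x j) = false := by simp [hτ, hxjw, hxjσ, hpi]
      have hMj := (hMw.slide hn hτw (hMw.low hn hwl false) (mem_nb.2 ⟨hwj, hτj⟩)).1
      have hp2 := hMj.P2 hn (hMj.low hn (hlow j) true) C.hT (y := w') (t := x j')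
        (mem_nb.2 ⟨aw'.1.symm, by
          have := (mem_nb.1 hw').2
          simp [hτ, hww', this, hpi]⟩)
        (mem_nb.2 ⟨hj'c.symm, by
          have : x j' ≠ w i := by
            intro he
            exact hxm (he ▸ hwD)
          simp [hτ, this, hσm]⟩)
      apply hxm
      refine Rch.trans aw'.2.1 (hp2.mono ?_)
      rintro t ⟨h1, -⟩
      by_cases htw : t = w i
      · rw [htw, hτw] at h1
        simp at h1
      · simp [hτ, htw] at h1
        rw [h1, hpi]

theorem Cx.contra {G : SimpleGraph V} {R : Bool → ℕ} (C : Cx G R) : False := by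
  have hn := C.nf
  have hne : ∃ v : V, True := by
    by_contra hcon
    obtain ⟨u, _⟩ := C.nf (fun _ => true) (fun _ => 0) (fun u => absurd ⟨u, trivial⟩ hcon)
    exact hcon ⟨u, trivial⟩
  obtain ⟨v, -⟩ := hne
  have hgood : ∃ n x σ c, GC G R x σ c ∧ en G x σ = n := by
    obtain ⟨c, hc⟩ := C.crit v
    refine ⟨_, v, fun u => decide (c u < R true), 
      fun u => if c u < R true then c u else c u - R true, ⟨?_, ?_⟩, rfl⟩
    · intro u hu
      have := hc.1 u hu
      by_cases h : c u < R true
      · simp [h]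
      · simp [h]; omega
    · intro a b ha hb hab hs
      have := hc.2 a b ha hb hab
      by_cases h : c a < R true <;> by_cases h' : c b < R true
      · simp [h, h', this]
      · simp [h, h'] at hs
      · simp [h, h'] at hs
      · simp [h, h']; omega
  obtain ⟨x, σ, c, hc, he⟩ := Nat.find_spec hgood
  have hM : MS G R x σ := by
    refine ⟨⟨c, hc⟩, ?_⟩
    intro y τ c' hy
    rw [he]
    exact Nat.find_min' hgood ⟨y, τ, c', hy, rfl⟩
  have hlow : ∃ x σ, MS G R x σ ∧ Low G R x := by
    by_cases hx : Low G R x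
    · exact ⟨x, σ, hM, hx⟩
    · have hd := C.deg x hx
      have h1 := hc.le hn true
      have h2 := hc.le hn false
      have h3 : (nb G σ true x).card + (nb G σ false x).card = R true + R false + 1 := by
        rw [← hd, ← card_union_of_disjoint]
        · congr 1
          ext u
          simp only [mem_union, mem_nb, mem_filter, mem_univ, true_and]
          cases σ u <;> simp
        · rw [disjoint_left]
          intro u hu hu'
          have := (mem_nb.1 hu).2.symm.trans (mem_nb.1 hu').2
          simp at this
      obtain ⟨p, hp⟩ : ∃ p, (nb G σ p x).card = R p := by
        by_cases h : (nb G σ true x).card = R true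
        · exact ⟨true, h⟩
        · exact ⟨false, by omega⟩
      obtain ⟨y, hy⟩ : (nb G σ p x).Nonempty := by
        rw [← card_pos, hp]
        have := C.two_le p
        omega
      rw [← nb_upd (q := p)] at hy hp
      have := ((hM.upd p).slide hn (by simp) hp hy).1
      exact ⟨y, _, this, (C.ind x y (mem_nb.1 hy).1).resolve_left hx⟩
  obtain ⟨x, σ, hM, hl⟩ := hlow
  obtain ⟨x, σ, w, p, H⟩ := C.seq hM hl
  exact C.nowalk x σ w p H

end Walk

end OreB

open Classical in
theorem OreB.main {V : Type*} [Fintype V] (G : SimpleGraph V)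
    (k : ℕ) (hk : 5 ≤ k) (hclique : G.cliqueNum ≤ k)
    (hore : ∀ x y, G.Adj x y → (univ.filter (fun u => G.Adj x u)).card +
      (univ.filter (fun u => G.Adj y u)).card ≤ 2 * k + 1) :
    ∃ c : V → ℕ, (∀ u, c u < k) ∧ ∀ u v, G.Adj u v → c u ≠ c v := by
  by_contra hcon
  let Bad : Finset V → Prop := fun S => ∀ c : V → ℕ, (∀ u ∈ S, c u < k) →
    ∃ u ∈ S, ∃ v ∈ S, G.Adj u v ∧ c u = c v
  have hbad : Bad univ := by
    intro c hc
    by_contra h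
    push Not at h
    exact hcon ⟨c, fun u => hc u (mem_univ u), fun u v huv => h u (mem_univ u) v (mem_univ v) huv⟩
  obtain ⟨S, hS, hmin⟩ := Finset.exists_min_image (univ.filter Bad) card ⟨univ, by simpa using hbad⟩
  simp only [mem_filter, mem_univ, true_and] at hS hmin
  let H : SimpleGraph S := G.comap (fun u => u.1)
  have hadj : ∀ u v : S, H.Adj u v ↔ G.Adj u.1 v.1 := fun u v => Iff.rfl
  have hnc : OreB.NC H k := by
    intro c hc
    obtain ⟨u, hu, v, hv, huv, he⟩ := hS (fun u => if hu : u ∈ S then c ⟨u, hu⟩ else 0) (by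
      intro u hu
      simp only [hu, dite_true]
      exact hc _)
    simp only [hu, hv, dite_true] at he
    exact ⟨⟨u, hu⟩, ⟨v, hv⟩, huv, he⟩
  have hcrit : ∀ x, ∃ c, OreB.PC H k x c := by
    rintro ⟨x, hx⟩
    have : ¬ Bad (S.erase x) := by
      intro hb
      have := hmin _ hb
      rw [card_erase_of_mem hx] at this
      have := card_pos.2 ⟨x, hx⟩
      omega
    simp only [Bad] at this
    push Not at this
    obtain ⟨c, h1, h2⟩ := this
    refine ⟨fun u => c u.1, ?_, ?_⟩
    · rintro ⟨u, hu⟩ hne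
      exact h1 u (mem_erase.2 ⟨by simpa using hne, hu⟩)
    · rintro ⟨u, hu⟩ ⟨v, hv⟩ hne hne' huv
      exact h2 u (mem_erase.2 ⟨by simpa using hne, hu⟩) v
        (mem_erase.2 ⟨by simpa using hne', hv⟩) huv
  let d : S → ℕ := fun v => (univ.filter (fun u => H.Adj v u)).card
  have hdge : ∀ v, k ≤ d v := by
    intro v
    obtain ⟨c, hc⟩ := hcrit v
    have : range k ⊆ (univ.filter (fun u => H.Adj v u)).image c := by
      intro a ha
      obtain ⟨y, h1, h2⟩ := hc.ex hnc (mem_range.1 ha)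
      rw [mem_image]
      exact ⟨y, by simpa using h1, h2⟩
    have := (card_le_card this).trans card_image_le
    rwa [card_range] at this
  have hdle : ∀ v : S, d v ≤ (univ.filter (fun u => G.Adj v.1 u)).card := by
    intro v
    apply card_le_card_of_injOn (fun u => u.1)
    · intro u hu
      simp only [coe_filter, mem_univ, true_and, Set.mem_ofPred_eq] at hu ⊢
      exact hu
    · intro a _ b _ h
      exact Subtype.ext h
  have hsum : ∀ u v, H.Adj u v → d u + d v ≤ 2 * k + 1 := by
    intro u v huv
    have := hore u.1 v.1 huv
    have := hdle u
    have := hdle v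
    omega
  let R : Bool → ℕ := fun b => if b then 2 else k - 2
  have hR : R true + R false = k := by
    simp only [R]; simp; omega
  refine OreB.Cx.contra (G := H) (R := R) ⟨?_, rfl, ?_, ?_, ?_, ?_, ?_, ?_⟩
  · intro σ c hc
    obtain ⟨u, v, huv, he⟩ := hnc (fun u => if σ u then c u else 2 + c u) (by
      intro u
      have := hc u
      cases hσ : σ u <;> simp [R, hσ] at this ⊢ <;> omega)
    have hcu := hc u
    have hcv := hc v
    refine ⟨u, v, huv, ?_⟩
    cases hσ : σ u <;> cases hσ' : σ v <;> simp [R, hσ, hσ'] at hcu hcv he ⊢ <;> omega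
  · simp [R]; omega
  · intro u v huv
    have h1 := hsum u v huv
    have h2 := hdge u
    have h3 := hdge v
    unfold OreB.Low
    rw [hR]
    change d u = k ∨ d v = k
    omega
  · intro v hv
    unfold OreB.Low at hv
    rw [hR] at hv ⊢
    change d v ≠ k at hv
    change d v = k + 1
    have h1 := hdge v
    obtain ⟨u, hu⟩ : (univ.filter (fun u => H.Adj v u)).Nonempty := by
      rw [← card_pos]
      change 0 < d v
      omega
    have h2 := hsum v u (by simpa using hu)
    have h3 := hdge u
    omega
  · intro s hs
    rw [hR]
    have : G.IsClique (s.image (fun u => u.1) : Finset V) := by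
      intro a ha b hb hab
      simp only [coe_image, Set.mem_image, mem_coe] at ha hb
      obtain ⟨a, ha, rfl⟩ := ha
      obtain ⟨b, hb, rfl⟩ := hb
      exact hs a ha b hb (fun h => hab (by rw [h]))
    have h1 := this.card_le_cliqueNum
    rw [card_image_of_injective _ Subtype.val_injective] at h1
    omega
  · rw [hR]; exact hcrit
  · rw [hR]; exact hnc

/-- For `k ≥ 5`, every graph `G` with clique number `ω(G) ≤ k` and maximum Ore degree
`θ(G) ≤ 2k + 1` has chromatic number `χ(G) ≤ k`. -/
theorem chromatic_of_oreDeg_cliqueNum {V : Type*} [Fintype V] (G : SimpleGraph V)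
    [DecidableRel G.Adj] (k : ℕ) (hk : 5 ≤ k)
    (hclique : G.cliqueNum ≤ k) (hore : G.maxOreDeg ≤ 2 * k + 1) :
    G.chromaticNumber ≤ k := by
  have hdeg : ∀ x y, G.Adj x y → G.degree x + G.degree y ≤ 2 * k + 1 := by
    intro x y hxy
    have hb : BddAbove {n | ∃ x y, G.Adj x y ∧ n = G.degree x + G.degree y} := by
      refine ⟨Fintype.card V + Fintype.card V, ?_⟩
      rintro n ⟨a, b, _, rfl⟩
      exact add_le_add (card_le_univ _) (card_le_univ _)
    exact le_trans (le_csSup hb ⟨x, y, hxy, rfl⟩) hore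
  obtain ⟨c, h1, h2⟩ := OreB.main G k hk hclique (by
    intro x y hxy
    have := hdeg x y hxy
    rw [← SimpleGraph.card_neighborFinset_eq_degree, ← SimpleGraph.card_neighborFinset_eq_degree,
      SimpleGraph.neighborFinset_eq_filter, SimpleGraph.neighborFinset_eq_filter] at this
    convert this)
  rw [SimpleGraph.chromaticNumber_le_iff_colorable]
  exact ⟨SimpleGraph.Coloring.mk (fun u => (⟨c u, h1 u⟩ : Fin k)) (by
    intro u v huv he
    exact h2 u v huv (by simpa using he))⟩
end
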